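/- There is a constant C > 0 such that for every integer k ≥ 1 the following holds: for every set V ⊆ ℝ² of exactly 2 distinct points, every point x ∉ V, and every finite family of pairwise non-homotopic x-loops in which each loop has fewer than k self-intersections and every two distinct loops of the family have fewer than k intersections, the family has at most exp(C·√k) members. -/

import Mathlib

/-- An `x`-loop with respect to the obstacle set `V`: a continuous function on `[0,1]`
with both endpoints at `x`, avoiding `V` on the open interval `(0,1)`. -/
def IsLoop (V : Set (ℝ × ℝ)) (x : ℝ × ℝ) (f : ℝ → ℝ × ℝ) : Prop :=
  ContinuousOn f (Set.Icc 0 1) ∧ f 0 = x ∧ f 1 = x ∧ ∀ t ∈ Set.Ioo (0:ℝ) 1, f t ∉ V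

/-- Two `x`-loops are homotopic (relative to the obstacle set `V`). -/
def LoopHomotopic (V : Set (ℝ × ℝ)) (x : ℝ × ℝ) (f g : ℝ → ℝ × ℝ) : Prop :=
  ∃ H : ℝ → ℝ → ℝ × ℝ,
    ContinuousOn (fun p : ℝ × ℝ => H p.1 p.2) (Set.Icc 0 1 ×ˢ Set.Icc 0 1) ∧
    (∀ t ∈ Set.Icc (0:ℝ) 1, H 0 t = f t ∧ H 1 t = g t) ∧
    (∀ s ∈ Set.Icc (0:ℝ) 1, H s 0 = x ∧ H s 1 = x) ∧
    (∀ s ∈ Set.Ioo (0:ℝ) 1, ∀ t ∈ Set.Ioo (0:ℝ) 1, H s t ∉ V)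

/-- The set of self-intersections of a loop: unordered pairs `{t,u} ⊆ (0,1)`, `t ≠ u`,
`f t = f u`, encoded as ordered pairs with `t < u`. -/
def SelfIntersections (f : ℝ → ℝ × ℝ) : Set (ℝ × ℝ) :=
  {p | p.1 ∈ Set.Ioo (0:ℝ) 1 ∧ p.2 ∈ Set.Ioo (0:ℝ) 1 ∧ p.1 < p.2 ∧ f p.1 = f p.2}

/-- The set of intersections of two loops: ordered pairs `(t,u) ∈ (0,1)²` with
`f t = g u`. -/
def Intersections (f g : ℝ → ℝ × ℝ) : Set (ℝ × ℝ) :=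
  {p | p.1 ∈ Set.Ioo (0:ℝ) 1 ∧ p.2 ∈ Set.Ioo (0:ℝ) 1 ∧ f p.1 = g p.2}

/-- Loop `f` has fewer than `k` self-intersections. -/
def FewerSelfInterThan (k : ℕ) (f : ℝ → ℝ × ℝ) : Prop :=
  (SelfIntersections f).Finite ∧ (SelfIntersections f).ncard < k

/-- Loops `f` and `g` have fewer than `k` intersections. -/
def FewerInterThan (k : ℕ) (f g : ℝ → ℝ × ℝ) : Prop :=
  (Intersections f g).Finite ∧ (Intersections f g).ncard < k

theorem exists_abs_sub_lt_of_cos_pos {θ : ℝ → ℝ} {a b φ : ℝ} (hab : a ≤ b)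
    (hθ : ContinuousOn θ (Set.Icc a b)) (h : ∀ t ∈ Set.Icc a b, 0 < Real.cos (θ t - φ)) :
    ∃ k : ℤ, ∀ t ∈ Set.Icc a b, |θ t - φ - 2 * Real.pi * k| < Real.pi / 2 := by
  have hpi := Real.pi_pos
  have ha : a ∈ Set.Icc a b := ⟨le_rfl, hab⟩
  obtain ⟨k, hk⟩ : ∃ k : ℤ, |θ a - φ - 2 * Real.pi * k| ≤ Real.pi := by
    refine ⟨round ((θ a - φ) / (2 * Real.pi)), ?_⟩
    have := abs_sub_round ((θ a - φ) / (2 * Real.pi))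
    have e : θ a - φ - 2 * Real.pi * round ((θ a - φ) / (2 * Real.pi))
      = 2 * Real.pi * ((θ a - φ) / (2 * Real.pi) - round ((θ a - φ) / (2 * Real.pi))) := by
      field_simp
    rw [e, abs_mul, abs_of_pos (by positivity)]
    nlinarith
  have hcos : ∀ x : ℝ, Real.cos (x - 2 * Real.pi * k) = Real.cos x := by
    intro x
    rw [mul_comm]; exact Real.cos_sub_int_mul_two_pi x k
  have hka : |θ a - φ - 2 * Real.pi * k| < Real.pi / 2 := by
    by_contra! hc
    have h1 := h a ha
    rw [← hcos, ← Real.cos_abs] at h1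
    have := Real.cos_nonpos_of_pi_div_two_le_of_le hc (by linarith)
    linarith
  refine ⟨k, fun t ht => ?_⟩
  by_contra! hc
  have hcont : ContinuousOn (fun t => |θ t - φ - 2 * Real.pi * k|) (Set.Icc a t) :=
    ((hθ.mono (Set.Icc_subset_Icc_right ht.2)).sub continuousOn_const |>.sub
      continuousOn_const).abs
  obtain ⟨u, hu, hu'⟩ := intermediate_value_Icc ht.1 hcont ⟨hka.le, hc⟩
  have h1 := h u ⟨hu.1, hu.2.trans ht.2⟩
  simp only at hu'
  rw [← hcos, ← Real.cos_abs, hu', Real.cos_pi_div_two] at h1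
  exact lt_irrefl _ h1

theorem exists_continuous_log_on_plane (F : ℝ × ℝ → ℂ) (hF : Continuous F) (h0 : ∀ p, F p ≠ 0) :
    ∃ G : ℝ × ℝ → ℂ, Continuous G ∧ ∀ p, Complex.exp (G p) = F p := by
  obtain ⟨g, ⟨-, hg⟩, -⟩ :=
    Complex.isCoveringMapOn_exp.existsUnique_continuousMap_lifts (A := ℝ × ℝ) ⟨F, hF⟩
      (e₀ := Complex.log (F 0)) (a₀ := 0) (by simp [Complex.exp_log (h0 0)])
      (by simp [h0])
  exact ⟨g, g.continuous, fun p => congrFun hg p⟩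

theorem poincare_miranda_strict (F : ℝ × ℝ → ℂ) (hF : Continuous F) {s₀ s₁ t₀ t₁ : ℝ}
    (hs : s₀ ≤ s₁) (ht : t₀ ≤ t₁)
    (h1 : ∀ t ∈ Set.Icc t₀ t₁, (F (s₀, t)).re < 0) (h2 : ∀ t ∈ Set.Icc t₀ t₁, 0 < (F (s₁, t)).re)
    (h3 : ∀ s ∈ Set.Icc s₀ s₁, 0 < (F (s, t₀)).im) (h4 : ∀ s ∈ Set.Icc s₀ s₁, (F (s, t₁)).im < 0) :
    ∃ s ∈ Set.Icc s₀ s₁, ∃ t ∈ Set.Icc t₀ t₁, F (s, t) = 0 := by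
  by_contra! hne
  obtain ⟨G, hG, hGF⟩ := exists_continuous_log_on_plane
    (fun p => F (Set.projIcc s₀ s₁ hs p.1, Set.projIcc t₀ t₁ ht p.2)) (by fun_prop)
    (fun p => hne _ (Set.projIcc s₀ s₁ hs p.1).2 _ (Set.projIcc t₀ t₁ ht p.2).2)
  have key : ∀ s ∈ Set.Icc s₀ s₁, ∀ t ∈ Set.Icc t₀ t₁, Complex.exp (G (s, t)) = F (s, t) := by
    intro s hs' t ht'
    rw [hGF, Set.projIcc_of_mem hs hs', Set.projIcc_of_mem ht ht']
  have hre : ∀ s ∈ Set.Icc s₀ s₁, ∀ t ∈ Set.Icc t₀ t₁,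
      Real.exp (G (s, t)).re * Real.cos (G (s, t)).im = (F (s, t)).re := by
    intro s hs' t ht'
    rw [← key s hs' t ht', Complex.exp_re]
  have him : ∀ s ∈ Set.Icc s₀ s₁, ∀ t ∈ Set.Icc t₀ t₁,
      Real.exp (G (s, t)).re * Real.sin (G (s, t)).im = (F (s, t)).im := by
    intro s hs' t ht'
    rw [← key s hs' t ht', Complex.exp_im]
  have ms0 : s₀ ∈ Set.Icc s₀ s₁ := ⟨le_rfl, hs⟩
  have ms1 : s₁ ∈ Set.Icc s₀ s₁ := ⟨hs, le_rfl⟩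
  have mt0 : t₀ ∈ Set.Icc t₀ t₁ := ⟨le_rfl, ht⟩
  have mt1 : t₁ ∈ Set.Icc t₀ t₁ := ⟨ht, le_rfl⟩
  have hpi := Real.pi_pos
  obtain ⟨k1, hk1⟩ := exists_abs_sub_lt_of_cos_pos (θ := fun t => (G (s₀, t)).im) (φ := Real.pi) ht
    (by fun_prop) (fun t ht' => by
      have h := h1 t ht'
      rw [← hre _ ms0 _ ht'] at h
      have := (pos_iff_neg_of_mul_neg h).1 (Real.exp_pos _)
      rw [Real.cos_sub_pi]; linarith)
  obtain ⟨k2, hk2⟩ := exists_abs_sub_lt_of_cos_pos (θ := fun s => (G (s, t₁)).im)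
    (φ := Real.pi + Real.pi / 2) hs
    (by fun_prop) (fun s hs' => by
      have h := h4 s hs'
      rw [← him _ hs' _ mt1] at h
      have := (pos_iff_neg_of_mul_neg h).1 (Real.exp_pos _)
      rw [sub_add_eq_sub_sub, Real.cos_sub_pi_div_two, Real.sin_sub_pi]; linarith)
  obtain ⟨k3, hk3⟩ := exists_abs_sub_lt_of_cos_pos (θ := fun t => (G (s₁, t)).im)
    (φ := 2 * Real.pi) ht
    (by fun_prop) (fun t ht' => by
      have h := h2 t ht'
      rw [← hre _ ms1 _ ht'] at h
      have := (pos_iff_pos_of_mul_pos h).1 (Real.exp_pos _)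
      rwa [Real.cos_sub_two_pi])
  obtain ⟨k4, hk4⟩ := exists_abs_sub_lt_of_cos_pos (θ := fun s => (G (s, t₀)).im)
    (φ := 2 * Real.pi + Real.pi / 2) hs
    (by fun_prop) (fun s hs' => by
      have h := h3 s hs'
      rw [← him _ hs' _ mt0] at h
      have := (pos_iff_pos_of_mul_pos h).1 (Real.exp_pos _)
      rwa [sub_add_eq_sub_sub, Real.cos_sub_pi_div_two, Real.sin_sub_two_pi])
  have aux : ∀ {k l : ℤ} {x φ ψ : ℝ}, |x - φ - 2 * Real.pi * k| < Real.pi / 2 →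
      |x - ψ - 2 * Real.pi * l| < Real.pi / 2 → |ψ - φ| = Real.pi / 2 → k = l := by
    intro k l x φ ψ ha hb hc
    have h1 : |2 * Real.pi * ((k - l : ℤ) : ℝ)| < 2 * Real.pi * 1 := by
      have : 2 * Real.pi * ((k - l : ℤ) : ℝ) =
        (x - ψ - 2 * Real.pi * l) - (x - φ - 2 * Real.pi * k) + (ψ - φ) := by push_cast; ring
      rw [this]
      refine (abs_add_le _ _).trans_lt ?_
      have := abs_sub (x - ψ - 2 * Real.pi * l) (x - φ - 2 * Real.pi * k)
      linarith
    rw [abs_mul, abs_of_pos (by positivity : 0 < 2 * Real.pi)] at h1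
    have h2 := lt_of_mul_lt_mul_left h1 (by positivity)
    have h3 : |k - l| < 1 := by exact_mod_cast h2
    have := Int.abs_lt_one_iff.1 h3
    omega
  have e12 := aux (hk1 _ mt1) (hk2 _ ms0) (by rw [add_sub_cancel_left, abs_of_pos (by positivity)])
  have e23 := aux (hk2 _ ms1) (hk3 _ mt1) (by
    rw [abs_of_pos (by linarith)]; ring)
  have e34 := aux (hk3 _ mt0) (hk4 _ ms1) (by rw [add_sub_cancel_left, abs_of_pos (by positivity)])
  have ha := abs_lt.1 (hk1 _ mt0)
  have hb := abs_lt.1 (hk4 _ ms0)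
  subst e12 e23 e34
  linarith [ha.1, ha.2, hb.1, hb.2]

theorem poincare_miranda (F : ℝ × ℝ → ℂ) (hF : Continuous F) {s₀ s₁ t₀ t₁ : ℝ}
    (hs : s₀ < s₁) (ht : t₀ < t₁)
    (h1 : ∀ t ∈ Set.Icc t₀ t₁, (F (s₀, t)).re ≤ 0) (h2 : ∀ t ∈ Set.Icc t₀ t₁, 0 ≤ (F (s₁, t)).re)
    (h3 : ∀ s ∈ Set.Icc s₀ s₁, 0 ≤ (F (s, t₀)).im) (h4 : ∀ s ∈ Set.Icc s₀ s₁, (F (s, t₁)).im ≤ 0) :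
    ∃ s ∈ Set.Icc s₀ s₁, ∃ t ∈ Set.Icc t₀ t₁, F (s, t) = 0 := by
  have hcomp : IsCompact (Set.Icc s₀ s₁ ×ˢ Set.Icc t₀ t₁) := isCompact_Icc.prod isCompact_Icc
  obtain ⟨⟨s, t⟩, hst, hmin⟩ := hcomp.exists_isMinOn
    ⟨(s₀, t₀), ⟨⟨le_rfl, hs.le⟩, ⟨le_rfl, ht.le⟩⟩⟩ (f := fun p => ‖F p‖) (by fun_prop)
  let E : ℝ × ℝ → ℂ := fun p => ⟨p.1 - (s₀ + s₁) / 2, (t₀ + t₁) / 2 - p.2⟩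
  have hE : Continuous E := by
    have : E = fun p => ((p.1 - (s₀ + s₁) / 2 : ℝ) : ℂ) + ((t₀ + t₁) / 2 - p.2 : ℝ) * Complex.I := by
      funext p; apply Complex.ext <;> simp [E]
    rw [this]; fun_prop
  obtain ⟨B, hB⟩ := hcomp.exists_bound_of_continuousOn hE.continuousOn
  refine ⟨s, hst.1, t, hst.2, ?_⟩
  by_contra hne
  have hpos : 0 < ‖F (s, t)‖ := norm_pos_iff.2 hne
  have hB0 : 0 ≤ B := (norm_nonneg _).trans (hB (s, t) hst)
  set ε := ‖F (s, t)‖ / (2 * (B + 1)) with hε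
  have hε0 : 0 < ε := by positivity
  obtain ⟨s', hs', t', ht', hz⟩ := poincare_miranda_strict (fun p => F p + ε * E p) (by fun_prop)
    hs.le ht.le
    (fun t ht' => by have := h1 t ht'; simp [E]; nlinarith)
    (fun t ht' => by have := h2 t ht'; simp [E]; nlinarith)
    (fun s hs' => by have := h3 s hs'; simp [E]; nlinarith)
    (fun s hs' => by have := h4 s hs'; simp [E]; nlinarith)
  have h5 : ‖F (s, t)‖ ≤ ‖F (s', t')‖ := hmin (show (s', t') ∈ _ from ⟨hs', ht'⟩)
  have h6 := hB (s', t') ⟨hs', ht'⟩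
  have h7 : ‖F (s', t')‖ = ε * ‖E (s', t')‖ := by
    rw [eq_neg_of_add_eq_zero_left hz, norm_neg, norm_mul, Complex.norm_real, Real.norm_eq_abs,
      abs_of_pos hε0]
  have h8 : ε * (2 * (B + 1)) = ‖F (s, t)‖ := by rw [hε]; field_simp
  nlinarith

theorem poincare_miranda_uIcc {f g : ℝ × ℝ → ℝ} (hf : Continuous f) (hg : Continuous g)
    {s₀ s₁ t₀ t₁ : ℝ}
    (h1 : ∀ t ∈ Set.uIcc t₀ t₁, f (s₀, t) ≤ 0) (h2 : ∀ t ∈ Set.uIcc t₀ t₁, 0 ≤ f (s₁, t))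
    (h3 : ∀ s ∈ Set.uIcc s₀ s₁, 0 ≤ g (s, t₀)) (h4 : ∀ s ∈ Set.uIcc s₀ s₁, g (s, t₁) ≤ 0) :
    ∃ s t, f (s, t) = 0 ∧ g (s, t) = 0 := by
  have mem : ∀ a b : ℝ, ∀ r ∈ Set.Icc (0 : ℝ) 1, a + r * (b - a) ∈ Set.uIcc a b := by
    intro a b r hr
    rw [← segment_eq_uIcc, segment_eq_image']
    exact ⟨r, hr, by simp⟩
  let q : ℝ × ℝ → ℝ × ℝ := fun p => (s₀ + p.1 * (s₁ - s₀), t₀ + p.2 * (t₁ - t₀))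
  have hq : Continuous q := by fun_prop
  obtain ⟨s, -, t, -, h⟩ := poincare_miranda (s₀ := 0) (s₁ := 1) (t₀ := 0) (t₁ := 1)
    (fun p => (f (q p) : ℂ) + g (q p) * Complex.I) (by fun_prop) one_pos one_pos
    (fun t ht => by simpa [q] using h1 _ (mem _ _ t ht))
    (fun t ht => by simpa [q] using h2 _ (mem _ _ t ht))
    (fun t ht => by simpa [q] using h3 _ (mem _ _ t ht))
    (fun t ht => by simpa [q] using h4 _ (mem _ _ t ht))
  refine ⟨(q (s, t)).1, (q (s, t)).2, ?_, ?_⟩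
  · simpa using congrArg Complex.re h
  · simpa using congrArg Complex.im h

theorem Complex.eq_of_norm_eq_of_re_div_im_eq {z w : ℂ} (hz : 0 < z.im) (hw : 0 < w.im)
    (h1 : ‖z‖ = ‖w‖) (h2 : z.re / z.im = w.re / w.im) : z = w := by
  have h3 : ‖z‖ ^ 2 = ‖w‖ ^ 2 := by rw [h1]
  rw [Complex.sq_norm, Complex.sq_norm, Complex.normSq_apply, Complex.normSq_apply] at h3
  rw [div_eq_div_iff hz.ne' hw.ne'] at h2
  have h4 : z.im = w.im := by
    have h5 : (z.im ^ 2 - w.im ^ 2) * (w.re ^ 2 + w.im ^ 2) = 0 := by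
      have : (z.re * w.im) ^ 2 = (w.re * z.im) ^ 2 := by rw [h2]
      linear_combination w.im ^ 2 * h3 - this
    rcases mul_eq_zero.1 h5 with h | h
    · have : (z.im - w.im) * (z.im + w.im) = 0 := by linear_combination h
      rcases mul_eq_zero.1 this with h | h <;> linarith
    · nlinarith [sq_nonneg w.re]
  refine Complex.ext ?_ h4
  rw [h4] at h2
  exact mul_right_cancel₀ hw.ne' h2

theorem Function.Periodic.exists_abs_le {f : ℝ → ℝ} (hf : Continuous f)
    (hp : Function.Periodic f 1) : ∃ R, ∀ t, |f t| ≤ R := by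
  obtain ⟨R, hR⟩ := isCompact_Icc.exists_bound_of_continuousOn (s := Set.Icc (0 : ℝ) 1)
    hf.continuousOn
  refine ⟨R, fun t => ?_⟩
  obtain ⟨u, hu, h⟩ := hp.exists_mem_Ico₀ one_pos t
  rw [h]
  exact hR u (Set.Ico_subset_Icc_self hu)

theorem map_add_int_of_map_add_one {α : ℝ → ℂ} {μ : ℝ} (hμ : μ ≠ 0)
    (h : ∀ t, α (t + 1) = μ * α t) (t : ℝ) (n : ℤ) : α (t + n) = (μ : ℂ) ^ n * α t := by
  have hμ' : (μ : ℂ) ≠ 0 := by exact_mod_cast hμ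
  induction n using Int.induction_on with
  | zero => simp
  | succ n ih =>
    push_cast at ih ⊢
    rw [← add_assoc, h, ih, zpow_add_one₀ hμ']
    ring
  | pred n ih =>
    have := h (t + (-(n : ℤ) - 1 : ℤ))
    push_cast at ih this ⊢
    rw [show t + (-(n : ℝ) - 1) + 1 = t + -(n : ℝ) by ring, ih] at this
    rw [zpow_sub_one₀ hμ', mul_right_comm, this]
    field_simp

theorem exists_eq_of_scaling_of_re_div_im {α β : ℝ → ℂ} (hα : Continuous α) (hβ : Continuous β)
    (hαim : ∀ t, 0 < (α t).im) (hβim : ∀ t, 0 < (β t).im) {μ : ℝ} (h0 : 0 < μ) (h1 : μ < 1)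
    (hμ : ∀ t, α (t + 1) = μ * α t)
    (hu : ∀ R, ∃ u, R ≤ (β u).re / (β u).im) (hl : ∀ R, ∃ u, (β u).re / (β u).im ≤ R) :
    ∃ t u, α t = β u := by
  have hα0 : ∀ t, 0 < ‖α t‖ := fun t => norm_pos_iff.2 fun h => by
    have := hαim t; rw [h] at this; exact lt_irrefl _ this
  have hβ0 : ∀ t, 0 < ‖β t‖ := fun t => norm_pos_iff.2 fun h => by
    have := hβim t; rw [h] at this; exact lt_irrefl _ this
  obtain ⟨R, hR⟩ := Function.Periodic.exists_abs_le (f := fun t => (α t).re / (α t).im)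
    (by
      have h2 : ∀ t, (α t).im ≠ 0 := fun t => (hαim t).ne'
      have h3 : Continuous fun t => (α t).re := Complex.continuous_re.comp hα
      have h4 : Continuous fun t => (α t).im := Complex.continuous_im.comp hα
      exact h3.div h4 h2)
    (fun t => by simp only [hμ]; simp [mul_div_mul_left _ _ h0.ne'])
  obtain ⟨u₀, hu₀⟩ := hl (-R)
  obtain ⟨u₁, hu₁⟩ := hu R
  have hlog : Continuous fun t => Real.log ‖β t‖ := hβ.norm.log fun t => (hβ0 t).ne'
  obtain ⟨B, hB⟩ := isCompact_uIcc.exists_bound_of_continuousOn (s := Set.uIcc u₀ u₁)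
    hlog.continuousOn
  have hlogα : ∀ n : ℤ, Real.log ‖α n‖ = n * Real.log μ + Real.log ‖α 0‖ := by
    intro n
    have := map_add_int_of_map_add_one h0.ne' hμ 0 n
    rw [zero_add] at this
    rw [this, norm_mul, norm_zpow, Complex.norm_real, Real.norm_eq_abs, abs_of_pos h0,
      Real.log_mul (by positivity) (hα0 0).ne', Real.log_zpow]
  have hlμ : Real.log μ < 0 := Real.log_neg h0 h1
  obtain ⟨n, hn⟩ := exists_nat_gt ((B + |Real.log ‖α 0‖|) / (-Real.log μ))
  rw [div_lt_iff₀ (by linarith)] at hn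
  have hlb := neg_abs_le (Real.log ‖α 0‖)
  have hub := le_abs_self (Real.log ‖α 0‖)
  obtain ⟨t, u, ha, hb⟩ := poincare_miranda_uIcc
    (f := fun p => Real.log ‖α p.1‖ - Real.log ‖β p.2‖)
    (g := fun p => (α p.1).re / (α p.1).im - (β p.2).re / (β p.2).im)
    (s₀ := ((n : ℤ) : ℝ)) (s₁ := ((-(n : ℤ) : ℤ) : ℝ)) (t₀ := u₀) (t₁ := u₁)
    (((hα.comp continuous_fst).norm.log fun p => (hα0 _).ne').sub
      ((hβ.comp continuous_snd).norm.log fun p => (hβ0 _).ne'))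
    (((Complex.continuous_re.comp (hα.comp continuous_fst)).div
        (Complex.continuous_im.comp (hα.comp continuous_fst)) fun p => (hαim _).ne').sub
      ((Complex.continuous_re.comp (hβ.comp continuous_snd)).div
        (Complex.continuous_im.comp (hβ.comp continuous_snd)) fun p => (hβim _).ne'))
    (fun u hu => by
      have := (abs_le.1 (hB u hu)).1
      simp only [hlogα]; push_cast; linarith)
    (fun u hu => by
      have := (abs_le.1 (hB u hu)).2
      simp only [hlogα]; push_cast; linarith)
    (fun s _ => by have := (abs_le.1 (hR s)).1; simp only; linarith)
    (fun s _ => by have := (abs_le.1 (hR s)).2; simp only; linarith)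
  refine ⟨t, u, Complex.eq_of_norm_eq_of_re_div_im_eq (hαim t) (hβim u) ?_ (sub_eq_zero.1 hb)⟩
  exact Real.log_injOn_pos (hα0 t) (hβ0 u) (sub_eq_zero.1 ha)

theorem exists_le_laurent {μ : ℝ} (h0 : 0 < μ) (h1 : μ < 1) {A B C : ℝ} (hC : 0 < C) (R : ℝ) :
    ∃ n : ℕ, R ≤ A * μ ^ n + B + C * (μ⁻¹) ^ n := by
  obtain ⟨n, hn⟩ := pow_unbounded_of_one_lt ((|A| + |B| + |R|) / C) ((one_lt_inv₀ h0).2 h1)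
  refine ⟨n, ?_⟩
  rw [div_lt_iff₀ hC] at hn
  have h2 : -|A| ≤ A * μ ^ n := by
    have h3 : |A * μ ^ n| ≤ |A| := by
      rw [abs_mul, abs_of_pos (pow_pos h0 n)]
      exact mul_le_of_le_one_right (abs_nonneg A) (pow_le_one₀ h0.le h1.le)
    linarith [neg_abs_le (A * μ ^ n)]
  nlinarith [neg_abs_le B, le_abs_self R]

/-- A curve in the upper half-plane invariant under a contracting homothety meets its image under
every Möbius transformation whose axis endpoints are linked with `0, ∞`. -/
theorem exists_eq_mobius_of_scaling {α : ℝ → ℂ} (hα : Continuous α)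
    (hαim : ∀ t, 0 < (α t).im) {μ : ℝ} (h0 : 0 < μ) (h1 : μ < 1)
    (hμ : ∀ t, α (t + 1) = μ * α t) {x y x' y' : ℝ} (hdet : 0 < x * y' - x' * y)
    (hlink : x * y * x' * y' < 0) :
    ∃ t u, α t = (x * α u + y) / (x' * α u + y') := by
  have hne : ∀ u, (x' * α u + y' : ℂ) ≠ 0 := by
    intro u h
    have h2 := congrArg Complex.im h
    have h3 := congrArg Complex.re h
    simp at h2 h3
    rcases h2 with h2 | h2
    · rw [h2] at hlink; simp at hlink
    · exact (hαim u).ne' h2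
  have hre : ∀ u, ((x * α u + y) / (x' * α u + y') : ℂ).re =
      (x * x' * Complex.normSq (α u) + (x * y' + x' * y) * (α u).re + y * y') /
        Complex.normSq (x' * α u + y') := by
    intro u
    rw [Complex.div_re, ← add_div]
    congr 1
    simp [Complex.normSq_apply]
    ring
  have him : ∀ u, ((x * α u + y) / (x' * α u + y') : ℂ).im =
      ((x * y' - x' * y) * (α u).im) / Complex.normSq (x' * α u + y') := by
    intro u
    rw [Complex.div_im, ← sub_div]
    congr 1
    simp
    ring
  have hns : ∀ u, 0 < Complex.normSq (x' * α u + y') := fun u => Complex.normSq_pos.2 (hne u)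
  have hρ : ∀ n : ℤ, ((x * α n + y) / (x' * α n + y') : ℂ).re /
      ((x * α n + y) / (x' * α n + y') : ℂ).im =
      (x * x' * Complex.normSq (α 0) / ((x * y' - x' * y) * (α 0).im)) * μ ^ n +
      (x * y' + x' * y) * (α 0).re / ((x * y' - x' * y) * (α 0).im) +
      y * y' / ((x * y' - x' * y) * (α 0).im) * μ⁻¹ ^ n := by
    intro n
    have e := map_add_int_of_map_add_one h0.ne' hμ 0 n
    rw [zero_add, ← Complex.ofReal_zpow] at e
    have hi := (hαim 0).ne'
    have hz : μ ^ n ≠ 0 := (zpow_pos h0 n).ne'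
    rw [hre, him, div_div_div_cancel_right₀ (hns _).ne', e]
    simp only [Complex.normSq_mul, Complex.normSq_ofReal, Complex.re_ofReal_mul,
      Complex.im_ofReal_mul, inv_zpow]
    field_simp
  have hd : 0 < (x * y' - x' * y) * (α 0).im := mul_pos hdet (hαim 0)
  have hn0 : 0 < Complex.normSq (α 0) := Complex.normSq_pos.2 fun h => by
    have := hαim 0; rw [h] at this; exact lt_irrefl _ this
  have hxy : (0 < x * x' ∧ y * y' < 0) ∨ (x * x' < 0 ∧ 0 < y * y') := by
    have h2 : x * x' * (y * y') < 0 := by linarith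
    rcases mul_neg_iff.1 h2 with h | h
    · exact .inl h
    · exact .inr h
  have hcont : Continuous fun u => ((x * α u + y) / (x' * α u + y') : ℂ) :=
    Continuous.div (by fun_prop) (by fun_prop) hne
  refine exists_eq_of_scaling_of_re_div_im hα hcont hαim
    (fun u => by rw [him]; exact div_pos (mul_pos hdet (hαim u)) (hns u)) h0 h1 hμ ?_ ?_
  all_goals
    intro R
    rcases hxy with ⟨hx, hy⟩ | ⟨hx, hy⟩
  · obtain ⟨n, hn⟩ := exists_le_laurent h0 h1
      (A := y * y' / ((x * y' - x' * y) * (α 0).im))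
      (B := (x * y' + x' * y) * (α 0).re / ((x * y' - x' * y) * (α 0).im))
      (C := x * x' * Complex.normSq (α 0) / ((x * y' - x' * y) * (α 0).im)) (by positivity) R
    refine ⟨((-(n : ℤ) : ℤ) : ℝ), ?_⟩
    have := hρ (-(n : ℤ))
    rw [zpow_neg, zpow_neg, zpow_natCast, zpow_natCast, inv_pow μ, inv_inv] at this
    rw [inv_pow] at hn
    rw [this]
    linarith
  · obtain ⟨n, hn⟩ := exists_le_laurent h0 h1
      (C := y * y' / ((x * y' - x' * y) * (α 0).im))
      (B := (x * y' + x' * y) * (α 0).re / ((x * y' - x' * y) * (α 0).im))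
      (A := x * x' * Complex.normSq (α 0) / ((x * y' - x' * y) * (α 0).im)) (by positivity) R
    refine ⟨((n : ℤ) : ℝ), ?_⟩
    rw [hρ n, zpow_natCast, zpow_natCast]
    linarith
  · obtain ⟨n, hn⟩ := exists_le_laurent h0 h1
      (C := -(y * y' / ((x * y' - x' * y) * (α 0).im)))
      (B := -((x * y' + x' * y) * (α 0).re / ((x * y' - x' * y) * (α 0).im)))
      (A := -(x * x' * Complex.normSq (α 0) / ((x * y' - x' * y) * (α 0).im)))
      (by rw [neg_pos]; exact div_neg_of_neg_of_pos hy hd) (-R)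
    refine ⟨((n : ℤ) : ℝ), ?_⟩
    rw [hρ n, zpow_natCast, zpow_natCast]
    linarith
  · obtain ⟨n, hn⟩ := exists_le_laurent h0 h1
      (A := -(y * y' / ((x * y' - x' * y) * (α 0).im)))
      (B := -((x * y' + x' * y) * (α 0).re / ((x * y' - x' * y) * (α 0).im)))
      (C := -(x * x' * Complex.normSq (α 0) / ((x * y' - x' * y) * (α 0).im)))
      (by rw [neg_pos]; exact div_neg_of_neg_of_pos (mul_neg_of_neg_of_pos hx hn0) hd) (-R)
    refine ⟨((-(n : ℤ) : ℤ) : ℝ), ?_⟩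
    have := hρ (-(n : ℤ))
    rw [zpow_neg, zpow_neg, zpow_natCast, zpow_natCast, inv_pow μ, inv_inv] at this
    rw [inv_pow] at hn
    rw [this]
    linarith

/-- A curve in the plane invariant under a nontrivial horizontal translation meets all of its
horizontal translates. -/
theorem exists_eq_add_of_translation {γ : ℝ → ℂ} (hγ : Continuous γ) {N : ℝ} (hN : N ≠ 0)
    (h : ∀ t, γ (t + 1) = γ t + N) (a : ℝ) : ∃ t u, γ t = γ u + a := by
  have hn : ∀ (t : ℝ) (n : ℤ), γ (t + n) = γ t + n * N := by
    intro t n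
    induction n using Int.induction_on with
    | zero => simp
    | succ n ih =>
      push_cast at ih ⊢
      rw [← add_assoc, h, ih]; ring
    | pred n ih =>
      have := h (t + (-(n : ℤ) - 1 : ℤ))
      push_cast at ih this ⊢
      rw [show t + (-(n : ℝ) - 1) + 1 = t + -(n : ℝ) by ring, ih] at this
      linear_combination -this
  have hcim : Continuous fun t => (γ t).im := Complex.continuous_im.comp hγ
  have hcre : Continuous fun t => (γ t).re := Complex.continuous_re.comp hγ
  have hper : Function.Periodic (fun t => (γ t).im) 1 := fun t => by simp [h]
  obtain ⟨s₀, hs₀, h0⟩ := isCompact_Icc.exists_isMinOn (s := Set.Icc (0 : ℝ) 1)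
    ⟨0, by simp⟩ hcim.continuousOn
  obtain ⟨s₁, hs₁, h1⟩ := isCompact_Icc.exists_isMaxOn (s := Set.Icc (0 : ℝ) 1)
    ⟨0, by simp⟩ hcim.continuousOn
  have hmin : ∀ t, (γ s₀).im ≤ (γ t).im := by
    intro t
    obtain ⟨u, hu, e⟩ := hper.exists_mem_Ico₀ one_pos t
    rw [e]; exact h0 (Set.Ico_subset_Icc_self hu)
  have hmax : ∀ t, (γ t).im ≤ (γ s₁).im := by
    intro t
    obtain ⟨u, hu, e⟩ := hper.exists_mem_Ico₀ one_pos t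
    rw [e]; exact h1 (Set.Ico_subset_Icc_self hu)
  obtain ⟨B, hB⟩ := isCompact_uIcc.exists_bound_of_continuousOn (s := Set.uIcc s₀ s₁)
    hcre.continuousOn
  have hN2 : 0 < N ^ 2 := by positivity
  obtain ⟨m, hm⟩ : ∃ m : ℤ, B + |(γ 0).re| + |a| ≤ m * N := by
    obtain ⟨n, hn⟩ := exists_nat_gt ((B + |(γ 0).re| + |a|) / |N|)
    rw [div_lt_iff₀ (abs_pos.2 hN)] at hn
    rcases abs_cases N with ⟨e, -⟩ | ⟨e, -⟩ <;> rw [e] at hn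
    · exact ⟨n, by push_cast; linarith⟩
    · exact ⟨-n, by push_cast; linarith⟩
  have hr : ∀ n : ℤ, (γ n).re = (γ 0).re + n * N := by
    intro n
    have := hn 0 n
    rw [zero_add] at this
    rw [this]; simp
  obtain ⟨t, u, ha, hb⟩ := poincare_miranda_uIcc
    (f := fun p => (γ p.1).im - (γ p.2).im)
    (g := fun p => (γ p.1).re - (γ p.2).re - a)
    (s₀ := s₀) (s₁ := s₁) (t₀ := ((-m : ℤ) : ℝ)) (t₁ := (m : ℝ))
    (by fun_prop) (by fun_prop)
    (fun u _ => by simpa using hmin u) (fun u _ => by simpa using hmax u)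
    (fun s hs => by
      have := (abs_le.1 (hB s hs)).1
      simp only [hr]; push_cast; linarith [le_abs_self (γ 0).re, le_abs_self a])
    (fun s hs => by
      have := (abs_le.1 (hB s hs)).2
      simp only [hr]; linarith [neg_abs_le (γ 0).re, neg_abs_le a])
  refine ⟨t, u, Complex.ext ?_ ?_⟩
  · simp; linarith
  · simp; linarith

section

open scoped MatrixGroups UpperHalfPlane

theorem sl_det_eq (g : SL(2, ℤ)) : g 0 0 * g 1 1 - g 0 1 * g 1 0 = 1 := by
  have := g.det_coe
  rwa [Matrix.det_fin_two] at this

theorem sl_coe_smul (g : SL(2, ℤ)) (z : ℍ) :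
    ((g • z : ℍ) : ℂ) = ((g 0 0 : ℂ) * z + g 0 1) / ((g 1 0 : ℂ) * z + g 1 1) := by
  rw [UpperHalfPlane.coe_specialLinearGroup_apply]
  simp

theorem upperHalfPlane_linear_ne_zero {a b : ℝ} (h : a ≠ 0 ∨ b ≠ 0) (z : ℍ) :
    (a : ℂ) * z + b ≠ 0 := by
  intro h0
  have h2 := congrArg Complex.im h0
  have h3 := congrArg Complex.re h0
  simp at h2 h3
  rcases h2 with h2 | h2
  · subst h2
    simp at h3
    simp [h3] at h
  · exact z.im_ne_zero h2

theorem sl_row_ne_zero (g : SL(2, ℤ)) : (g 1 0 : ℝ) ≠ 0 ∨ (g 1 1 : ℝ) ≠ 0 := by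
  by_contra! h
  have h1 : g 1 0 = 0 := by exact_mod_cast h.1
  have h2 : g 1 1 = 0 := by exact_mod_cast h.2
  have := sl_det_eq g
  simp [h1, h2] at this

theorem sl_denom_ne_zero (g : SL(2, ℤ)) (z : ℍ) : (g 1 0 : ℂ) * z + g 1 1 ≠ 0 := by
  have := upperHalfPlane_linear_ne_zero (sl_row_ne_zero g) z
  push_cast at this
  exact this

theorem exists_eq_smul_of_linked_aux {γ : ℝ → ℍ} (hγ : Continuous γ) {h : SL(2, ℤ)}
    (hh : ∀ t, γ (t + 1) = h • γ t) (c : SL(2, ℤ)) {p₁ p₂ q₁ q₂ l : ℝ} (hl : 1 < l ^ 2)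
    (hp₁ : h 0 0 * p₁ + h 0 1 * p₂ = l * p₁) (hp₂ : h 1 0 * p₁ + h 1 1 * p₂ = l * p₂)
    (hq₁ : l * (h 0 0 * q₁ + h 0 1 * q₂) = q₁) (hq₂ : l * (h 1 0 * q₁ + h 1 1 * q₂) = q₂)
    (hpq : 0 < p₁ * q₂ - p₂ * q₁)
    (hlink : (p₁ * (c 1 0 * p₁ + c 1 1 * p₂) - p₂ * (c 0 0 * p₁ + c 0 1 * p₂)) *
      (p₁ * (c 1 0 * q₁ + c 1 1 * q₂) - p₂ * (c 0 0 * q₁ + c 0 1 * q₂)) *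
      (q₁ * (c 1 0 * p₁ + c 1 1 * p₂) - q₂ * (c 0 0 * p₁ + c 0 1 * p₂)) *
      (q₁ * (c 1 0 * q₁ + c 1 1 * q₂) - q₂ * (c 0 0 * q₁ + c 0 1 * q₂)) < 0) :
    ∃ t u, γ t = c • γ u := by
  have hl0 : l ≠ 0 := by rintro rfl; norm_num at hl
  have hq0 : q₂ ≠ 0 ∨ -q₁ ≠ 0 := by
    by_contra! h
    have h2 : q₁ = 0 := by linarith [h.2]
    simp [h.1, h2] at hpq
  have hden : ∀ z : ℍ, (q₂ : ℂ) * z - q₁ ≠ 0 := by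
    intro z
    have := upperHalfPlane_linear_ne_zero hq0 z
    push_cast at this
    rwa [← sub_eq_add_neg] at this
  set ω : ℍ → ℂ := fun z => ((p₂ : ℂ) * z - p₁) / ((q₂ : ℂ) * z - q₁) with hω
  have hωc : Continuous ω := by
    refine Continuous.div ?_ ?_ hden
    · exact (continuous_const.mul UpperHalfPlane.continuous_coe).sub continuous_const
    · exact (continuous_const.mul UpperHalfPlane.continuous_coe).sub continuous_const
  have hωim : ∀ z, 0 < (ω z).im := by
    intro z
    have h1 : (ω z).im = (p₁ * q₂ - p₂ * q₁) * z.im / Complex.normSq ((q₂ : ℂ) * z - q₁) := by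
      rw [hω]
      simp only
      rw [Complex.div_im, ← sub_div]
      congr 1
      simp
      ring
    rw [h1]
    exact div_pos (mul_pos hpq z.im_pos) (Complex.normSq_pos.2 (hden z))
  have hinj : ∀ z w, ω z = ω w → z = w := by
    intro z w hzw
    rw [hω] at hzw
    simp only at hzw
    rw [div_eq_div_iff (hden z) (hden w)] at hzw
    have h1 : ((p₁ * q₂ - p₂ * q₁ : ℝ) : ℂ) * ((z : ℂ) - w) = 0 := by
      push_cast
      linear_combination hzw
    rcases mul_eq_zero.1 h1 with h1 | h1
    · exact absurd (by exact_mod_cast h1) hpq.ne'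
    · exact UpperHalfPlane.ext (sub_eq_zero.1 h1)
  have hdet : ∀ g : SL(2, ℤ), (g 0 0 * g 1 1 - g 0 1 * g 1 0 : ℂ) = 1 := by
    intro g
    exact_mod_cast sl_det_eq g
  have hequi : ∀ z, ω (h • z) = ((l ^ 2)⁻¹ : ℝ) * ω z := by
    intro z
    have h1 := hdet h
    have e1 : (h 0 0 * p₁ + h 0 1 * p₂ : ℂ) = l * p₁ := by exact_mod_cast hp₁
    have e2 : (h 1 0 * p₁ + h 1 1 * p₂ : ℂ) = l * p₂ := by exact_mod_cast hp₂
    have e3 : (l * (h 0 0 * q₁ + h 0 1 * q₂) : ℂ) = q₁ := by exact_mod_cast hq₁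
    have e4 : (l * (h 1 0 * q₁ + h 1 1 * q₂) : ℂ) = q₂ := by exact_mod_cast hq₂
    have hl0' : (l : ℂ) ≠ 0 := by exact_mod_cast hl0
    have hd := sl_denom_ne_zero h z
    have hA : ((h • z : ℍ) : ℂ) * ((h 1 0 : ℂ) * z + h 1 1) = h 0 0 * z + h 0 1 := by
      rw [sl_coe_smul, div_mul_cancel₀ _ hd]
    have e1' : (p₁ : ℂ) = (l : ℂ)⁻¹ * (h 0 0 * p₁ + h 0 1 * p₂) := by
      rw [e1, inv_mul_cancel_left₀ hl0']
    have e2' : (p₂ : ℂ) = (l : ℂ)⁻¹ * (h 1 0 * p₁ + h 1 1 * p₂) := by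
      rw [e2, inv_mul_cancel_left₀ hl0']
    have f1 : (p₂ : ℂ) * (h • z : ℍ) - p₁ =
        (l : ℂ)⁻¹ * ((p₂ : ℂ) * z - p₁) / ((h 1 0 : ℂ) * z + h 1 1) := by
      rw [eq_div_iff hd]
      linear_combination p₂ * hA - (h 1 0 * z + h 1 1) * e1' + (h 0 0 * z + h 0 1) * e2' +
        (l : ℂ)⁻¹ * (p₂ * z - p₁) * h1
    have f2 : (q₂ : ℂ) * (h • z : ℍ) - q₁ =
        l * ((q₂ : ℂ) * z - q₁) / ((h 1 0 : ℂ) * z + h 1 1) := by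
      rw [eq_div_iff hd]
      linear_combination q₂ * hA + (h 1 0 * z + h 1 1) * e3 - (h 0 0 * z + h 0 1) * e4 +
        l * (q₂ * z - q₁) * h1
    rw [hω]
    simp only
    rw [f1, f2, div_div_div_cancel_right₀ hd, mul_div_mul_comm]
    congr 1
    push_cast
    field_simp
  have hμ0 : 0 < (l ^ 2)⁻¹ := by positivity
  have hμ1 : (l ^ 2)⁻¹ < 1 := inv_lt_one_of_one_lt₀ hl
  obtain ⟨t, u, htu⟩ := exists_eq_mobius_of_scaling (α := fun t => ω (γ t)) (hωc.comp hγ)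
    (fun t => hωim _) hμ0 hμ1 (fun t => by rw [hh, hequi])
    (x := p₁ * (c 1 0 * q₁ + c 1 1 * q₂) - p₂ * (c 0 0 * q₁ + c 0 1 * q₂))
    (y := -(p₁ * (c 1 0 * p₁ + c 1 1 * p₂) - p₂ * (c 0 0 * p₁ + c 0 1 * p₂)))
    (x' := q₁ * (c 1 0 * q₁ + c 1 1 * q₂) - q₂ * (c 0 0 * q₁ + c 0 1 * q₂))
    (y' := -(q₁ * (c 1 0 * p₁ + c 1 1 * p₂) - q₂ * (c 0 0 * p₁ + c 0 1 * p₂)))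
    (by
      have h1 : ((c 0 0 : ℝ) * c 1 1 - c 0 1 * c 1 0) = 1 := by exact_mod_cast sl_det_eq c
      have h2 : 0 < (p₁ * q₂ - p₂ * q₁) ^ 2 * ((c 0 0 : ℝ) * c 1 1 - c 0 1 * c 1 0) := by
        rw [h1]; positivity
      linarith)
    (by linarith)
  refine ⟨t, u, hinj _ _ (htu.trans ?_)⟩
  have hd := sl_denom_ne_zero c (γ u)
  have hpq' : ((p₁ * q₂ - p₂ * q₁ : ℝ) : ℂ) ≠ 0 := by exact_mod_cast hpq.ne'
  have g1 := hden (γ u)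
  have g2 := hden (c • γ u)
  rw [sl_coe_smul] at g2
  rw [hω]
  simp only
  rw [sl_coe_smul]
  set z : ℂ := (γ u : ℂ)
  have n1 : (p₂ : ℂ) * ((c 0 0 * z + c 0 1) / (c 1 0 * z + c 1 1)) - p₁ =
    (p₂ * (c 0 0 * z + c 0 1) - p₁ * (c 1 0 * z + c 1 1)) / (c 1 0 * z + c 1 1) := by
    rw [eq_div_iff hd, sub_mul, mul_assoc, div_mul_cancel₀ _ hd]
  have n2 : (q₂ : ℂ) * ((c 0 0 * z + c 0 1) / (c 1 0 * z + c 1 1)) - q₁ =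
    (q₂ * (c 0 0 * z + c 0 1) - q₁ * (c 1 0 * z + c 1 1)) / (c 1 0 * z + c 1 1) := by
    rw [eq_div_iff hd, sub_mul, mul_assoc, div_mul_cancel₀ _ hd]
  have n3 : (q₂ * (c 0 0 * z + c 0 1) - q₁ * (c 1 0 * z + c 1 1) : ℂ) ≠ 0 := by
    rw [n2] at g2
    exact fun h => g2 (by rw [h, zero_div])
  rw [n1, n2, div_div_div_cancel_right₀ hd]
  have n4 : ((p₁ * (c 1 0 * q₁ + c 1 1 * q₂) - p₂ * (c 0 0 * q₁ + c 0 1 * q₂) : ℝ) : ℂ) *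
      ((p₂ * z - p₁) / (q₂ * z - q₁)) +
      ((-(p₁ * (c 1 0 * p₁ + c 1 1 * p₂) - p₂ * (c 0 0 * p₁ + c 0 1 * p₂)) : ℝ) : ℂ) =
      ((p₁ * q₂ - p₂ * q₁ : ℝ) : ℂ) * (p₂ * (c 0 0 * z + c 0 1) - p₁ * (c 1 0 * z + c 1 1)) /
        (q₂ * z - q₁) := by
    rw [eq_div_iff g1, add_mul, mul_assoc, div_mul_cancel₀ _ g1]
    push_cast
    ring
  have n5 : ((q₁ * (c 1 0 * q₁ + c 1 1 * q₂) - q₂ * (c 0 0 * q₁ + c 0 1 * q₂) : ℝ) : ℂ) *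
      ((p₂ * z - p₁) / (q₂ * z - q₁)) +
      ((-(q₁ * (c 1 0 * p₁ + c 1 1 * p₂) - q₂ * (c 0 0 * p₁ + c 0 1 * p₂)) : ℝ) : ℂ) =
      ((p₁ * q₂ - p₂ * q₁ : ℝ) : ℂ) * (q₂ * (c 0 0 * z + c 0 1) - q₁ * (c 1 0 * z + c 1 1)) /
        (q₂ * z - q₁) := by
    rw [eq_div_iff g1, add_mul, mul_assoc, div_mul_cancel₀ _ g1]
    push_cast
    ring
  rw [n4, n5, div_div_div_cancel_right₀ g1, mul_div_mul_left _ _ hpq']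

/-- A curve invariant under a hyperbolic element meets its translate by `c` as soon as the axis of
the element and its translate by `c` are linked. -/
theorem exists_eq_smul_of_linked {γ : ℝ → ℍ} (hγ : Continuous γ) {h : SL(2, ℤ)}
    (hh : ∀ t, γ (t + 1) = h • γ t) (c : SL(2, ℤ)) {p₁ p₂ q₁ q₂ l : ℝ} (hl : 1 < l ^ 2)
    (hp₁ : h 0 0 * p₁ + h 0 1 * p₂ = l * p₁) (hp₂ : h 1 0 * p₁ + h 1 1 * p₂ = l * p₂)
    (hq₁ : l * (h 0 0 * q₁ + h 0 1 * q₂) = q₁) (hq₂ : l * (h 1 0 * q₁ + h 1 1 * q₂) = q₂)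
    (hpq : p₁ * q₂ - p₂ * q₁ ≠ 0)
    (hlink : (p₁ * (c 1 0 * p₁ + c 1 1 * p₂) - p₂ * (c 0 0 * p₁ + c 0 1 * p₂)) *
      (p₁ * (c 1 0 * q₁ + c 1 1 * q₂) - p₂ * (c 0 0 * q₁ + c 0 1 * q₂)) *
      (q₁ * (c 1 0 * p₁ + c 1 1 * p₂) - q₂ * (c 0 0 * p₁ + c 0 1 * p₂)) *
      (q₁ * (c 1 0 * q₁ + c 1 1 * q₂) - q₂ * (c 0 0 * q₁ + c 0 1 * q₂)) < 0) :
    ∃ t u, γ t = c • γ u := by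
  rcases hpq.lt_or_gt with h0 | h0
  · refine exists_eq_smul_of_linked_aux hγ hh c (p₁ := -p₁) (p₂ := -p₂) hl ?_ ?_ hq₁ hq₂ ?_ ?_
    · linarith
    · linarith
    · linarith
    · exact lt_of_eq_of_lt (by ring) hlink
  · exact exists_eq_smul_of_linked_aux hγ hh c hl hp₁ hp₂ hq₁ hq₂ h0 hlink

end

section

open scoped MatrixGroups UpperHalfPlane

/-- The standard fundamental domain of `Γ(2)`: the ideal quadrilateral with vertices
`∞, -1, 0, 1`. -/
def gammaTwoDomain : Set ℍ := {z | |z.re| ≤ 1 ∧ |z.re| ≤ z.re ^ 2 + z.im ^ 2}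

/-- The function vanishing on the two half circles bounding `gammaTwoDomain`. -/
noncomputable def gammaTwoHeight (z : ℍ) : ℝ := z.re ^ 2 + z.im ^ 2 - |z.re|

/-- A map from `gammaTwoDomain` onto the plane without `(1, 0)` and `(-1, 0)`, in elliptic
coordinates, gluing the sides of the quadrilateral. -/
noncomputable def gammaTwoFold (z : ℍ) : ℝ × ℝ :=
  ((2 * |z.re| - 1) * (1 + gammaTwoHeight z),
    if 0 ≤ z.re then
      √(4 * |z.re| * (1 - |z.re|) * (gammaTwoHeight z * (gammaTwoHeight z + 2)))
    else -√(4 * |z.re| * (1 - |z.re|) * (gammaTwoHeight z * (gammaTwoHeight z + 2))))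

theorem isClosed_gammaTwoDomain : IsClosed gammaTwoDomain := by
  have h1 := UpperHalfPlane.continuous_re
  have h2 := UpperHalfPlane.continuous_im
  exact (isClosed_le h1.abs continuous_const).inter
    (isClosed_le h1.abs ((h1.pow 2).add (h2.pow 2)))

theorem continuous_gammaTwoHeight : Continuous gammaTwoHeight :=
  ((UpperHalfPlane.continuous_re.pow 2).add (UpperHalfPlane.continuous_im.pow 2)).sub
    UpperHalfPlane.continuous_re.abs

theorem continuous_gammaTwoFold : Continuous gammaTwoFold := by
  have h1 := UpperHalfPlane.continuous_re
  have h3 := continuous_gammaTwoHeight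
  unfold gammaTwoFold
  refine Continuous.prodMk (by fun_prop) ?_
  refine Continuous.if_le (by fun_prop) (by fun_prop) continuous_const h1 ?_
  intro z hz
  simp [← hz]

theorem gammaTwoFold_snd_sq {z : ℍ} (hz : z ∈ gammaTwoDomain) :
    (gammaTwoFold z).2 ^ 2 =
      4 * |z.re| * (1 - |z.re|) * (gammaTwoHeight z * (gammaTwoHeight z + 2)) := by
  have h0 := abs_nonneg z.re
  have h1 : 0 ≤ gammaTwoHeight z := sub_nonneg.2 hz.2
  have h2 : 0 ≤ 1 - |z.re| := sub_nonneg.2 hz.1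
  have h3 : 0 ≤ 4 * |z.re| * (1 - |z.re|) * (gammaTwoHeight z * (gammaTwoHeight z + 2)) := by
    positivity
  unfold gammaTwoFold
  dsimp only
  split_ifs
  · exact Real.sq_sqrt h3
  · rw [neg_sq]
    exact Real.sq_sqrt h3

theorem gammaTwo_pos {z : ℍ} (hz : z ∈ gammaTwoDomain) :
    0 < gammaTwoHeight z + 2 * |z.re| ∧ 0 < gammaTwoHeight z + 2 - 2 * |z.re| := by
  have h0 := abs_nonneg z.re
  have h1 : 0 ≤ gammaTwoHeight z := sub_nonneg.2 hz.2
  have h2 : 0 < z.im ^ 2 := pow_pos z.im_pos 2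
  have h3 := hz.1
  have h4 : gammaTwoHeight z = |z.re| ^ 2 + z.im ^ 2 - |z.re| := by
    rw [sq_abs]; rfl
  constructor <;> nlinarith

theorem sqrt_gammaTwoFold_add {z : ℍ} (hz : z ∈ gammaTwoDomain) :
    √(((gammaTwoFold z).1 + 1) ^ 2 + (gammaTwoFold z).2 ^ 2) =
      gammaTwoHeight z + 2 * |z.re| := by
  rw [Real.sqrt_eq_iff_mul_self_eq_of_pos (gammaTwo_pos hz).1, gammaTwoFold_snd_sq hz]
  simp only [gammaTwoFold]
  ring

theorem sqrt_gammaTwoFold_sub {z : ℍ} (hz : z ∈ gammaTwoDomain) :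
    √(((gammaTwoFold z).1 - 1) ^ 2 + (gammaTwoFold z).2 ^ 2) =
      gammaTwoHeight z + 2 - 2 * |z.re| := by
  rw [Real.sqrt_eq_iff_mul_self_eq_of_pos (gammaTwo_pos hz).2, gammaTwoFold_snd_sq hz]
  simp only [gammaTwoFold]
  ring

/-- The plane without the two points `(1, 0)` and `(-1, 0)`. -/
def twicePuncturedPlane : Set (ℝ × ℝ) := {w | w ≠ (1, 0) ∧ w ≠ (-1, 0)}

theorem gammaTwoFold_mem {z : ℍ} (hz : z ∈ gammaTwoDomain) :
    gammaTwoFold z ∈ twicePuncturedPlane := by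
  constructor
  · intro h
    have := sqrt_gammaTwoFold_sub hz
    simp [h] at this
    linarith [gammaTwo_pos hz]
  · intro h
    have := sqrt_gammaTwoFold_add hz
    simp [h] at this
    linarith [gammaTwo_pos hz]

/-- The real part of the section of `gammaTwoFold`. -/
noncomputable def gammaTwoSectionRe (w : ℝ × ℝ) : ℝ :=
  (1 + (√((w.1 + 1) ^ 2 + w.2 ^ 2) - √((w.1 - 1) ^ 2 + w.2 ^ 2)) / 2) / 2

/-- The square of the imaginary part of the section of `gammaTwoFold`. -/
noncomputable def gammaTwoSectionImSq (w : ℝ × ℝ) : ℝ :=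
  (√((w.1 + 1) ^ 2 + w.2 ^ 2) + √((w.1 - 1) ^ 2 + w.2 ^ 2)) / 2 - 1 + gammaTwoSectionRe w -
    gammaTwoSectionRe w ^ 2

theorem continuous_gammaTwoSectionRe : Continuous gammaTwoSectionRe := by
  unfold gammaTwoSectionRe; fun_prop

theorem continuous_gammaTwoSectionImSq : Continuous gammaTwoSectionImSq := by
  have := continuous_gammaTwoSectionRe
  unfold gammaTwoSectionImSq; fun_prop

theorem gammaTwoSection_spec {w : ℝ × ℝ} (hw : w ∈ twicePuncturedPlane) :
    0 ≤ gammaTwoSectionRe w ∧ gammaTwoSectionRe w ≤ 1 ∧ 0 < gammaTwoSectionImSq w ∧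
    0 ≤ gammaTwoSectionRe w ^ 2 + gammaTwoSectionImSq w - gammaTwoSectionRe w ∧
    (2 * gammaTwoSectionRe w - 1) *
      (1 + (gammaTwoSectionRe w ^ 2 + gammaTwoSectionImSq w - gammaTwoSectionRe w)) = w.1 ∧
    4 * gammaTwoSectionRe w * (1 - gammaTwoSectionRe w) *
      ((gammaTwoSectionRe w ^ 2 + gammaTwoSectionImSq w - gammaTwoSectionRe w) *
      (gammaTwoSectionRe w ^ 2 + gammaTwoSectionImSq w - gammaTwoSectionRe w + 2)) = w.2 ^ 2 := by
  obtain ⟨u, v⟩ := w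
  have hv := sq_nonneg v
  have e1 := Real.sq_sqrt (show 0 ≤ (u + 1) ^ 2 + v ^ 2 by positivity)
  have e2 := Real.sq_sqrt (show 0 ≤ (u - 1) ^ 2 + v ^ 2 by positivity)
  have p1 : 0 ≤ √((u + 1) ^ 2 + v ^ 2) := Real.sqrt_nonneg _
  have p2 : 0 ≤ √((u - 1) ^ 2 + v ^ 2) := Real.sqrt_nonneg _
  have a1 : |u + 1| ≤ √((u + 1) ^ 2 + v ^ 2) := Real.abs_le_sqrt (by linarith)
  have a2 : |u - 1| ≤ √((u - 1) ^ 2 + v ^ 2) := Real.abs_le_sqrt (by linarith)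
  have q1 : 0 < √((u + 1) ^ 2 + v ^ 2) := by
    refine p1.lt_of_ne' fun h => hw.2 ?_
    rw [h] at e1
    have : u + 1 = 0 := by nlinarith [sq_nonneg (u + 1)]
    have : v = 0 := by nlinarith [sq_nonneg (u + 1)]
    ext <;> simp <;> linarith
  have q2 : 0 < √((u - 1) ^ 2 + v ^ 2) := by
    refine p2.lt_of_ne' fun h => hw.1 ?_
    rw [h] at e2
    have : u - 1 = 0 := by nlinarith [sq_nonneg (u - 1)]
    have : v = 0 := by nlinarith [sq_nonneg (u - 1)]
    ext <;> simp <;> linarith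
  unfold gammaTwoSectionImSq gammaTwoSectionRe
  dsimp only
  set s₁ := √((u + 1) ^ 2 + v ^ 2)
  set s₂ := √((u - 1) ^ 2 + v ^ 2)
  have b1 := le_abs_self (u + 1)
  have b2 := neg_abs_le (u + 1)
  have b3 := le_abs_self (u - 1)
  have b4 := neg_abs_le (u - 1)
  have c1 : 2 ≤ s₁ + s₂ := by linarith
  have c2 : s₁ - s₂ ≤ 2 := by nlinarith
  have c3 : s₂ - s₁ ≤ 2 := by nlinarith
  refine ⟨by linarith, by linarith, ?_, by linarith, ?_, ?_⟩
  · rcases c1.eq_or_lt with h | h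
    · have : s₂ = 2 - s₁ := by linarith
      rw [this]
      nlinarith
    · nlinarith
  · linear_combination (e1 - e2) / 4
  · have hu : s₁ ^ 2 - s₂ ^ 2 = 4 * u := by linarith
    have : v ^ 2 = (s₁ ^ 2 + s₂ ^ 2) / 2 - 1 - u ^ 2 := by linarith
    rw [this]
    linear_combination (-(s₁ ^ 2 - s₂ ^ 2 + 4 * u) / 16) * hu

/-- A continuous section of `gammaTwoFold` over the closed upper half plane. -/
noncomputable def gammaTwoSection (w : twicePuncturedPlane) : ℍ :=
  ⟨⟨gammaTwoSectionRe w, √(gammaTwoSectionImSq w)⟩,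
    Real.sqrt_pos.2 (gammaTwoSection_spec w.2).2.2.1⟩

/-- A continuous section of `gammaTwoFold` over the closed lower half plane. -/
noncomputable def gammaTwoSection' (w : twicePuncturedPlane) : ℍ :=
  ⟨⟨-gammaTwoSectionRe w, √(gammaTwoSectionImSq w)⟩,
    Real.sqrt_pos.2 (gammaTwoSection_spec w.2).2.2.1⟩

theorem continuous_gammaTwoSection : Continuous gammaTwoSection := by
  refine UpperHalfPlane.isEmbedding_coe.continuous_iff.2 ?_
  have h1 := continuous_gammaTwoSectionRe
  have h2 := continuous_gammaTwoSectionImSq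
  have : (UpperHalfPlane.coe ∘ gammaTwoSection) = fun w : twicePuncturedPlane =>
      (gammaTwoSectionRe w : ℂ) + (√(gammaTwoSectionImSq w) : ℝ) * Complex.I := by
    ext w
    exact (Complex.mk_eq_add_mul_I _ _)
  rw [this]
  fun_prop

theorem continuous_gammaTwoSection' : Continuous gammaTwoSection' := by
  refine UpperHalfPlane.isEmbedding_coe.continuous_iff.2 ?_
  have h1 := continuous_gammaTwoSectionRe
  have h2 := continuous_gammaTwoSectionImSq
  have : (UpperHalfPlane.coe ∘ gammaTwoSection') = fun w : twicePuncturedPlane =>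
      ((-gammaTwoSectionRe w : ℝ) : ℂ) + (√(gammaTwoSectionImSq w) : ℝ) * Complex.I := by
    ext w
    exact (Complex.mk_eq_add_mul_I _ _)
  rw [this]
  fun_prop

theorem gammaTwoSection_mem (w : twicePuncturedPlane) : gammaTwoSection w ∈ gammaTwoDomain := by
  obtain ⟨h1, h2, h3, h4, -, -⟩ := gammaTwoSection_spec w.2
  have e1 : (gammaTwoSection w).re = gammaTwoSectionRe w := rfl
  have e2 : (gammaTwoSection w).im = √(gammaTwoSectionImSq w) := rfl
  refine ⟨?_, ?_⟩
  · rwa [e1, abs_of_nonneg h1]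
  · rw [e1, e2, abs_of_nonneg h1, Real.sq_sqrt h3.le]; linarith

theorem gammaTwoSection'_mem (w : twicePuncturedPlane) :
    gammaTwoSection' w ∈ gammaTwoDomain := by
  obtain ⟨h1, h2, h3, h4, -, -⟩ := gammaTwoSection_spec w.2
  have e1 : (gammaTwoSection' w).re = -gammaTwoSectionRe w := rfl
  have e2 : (gammaTwoSection' w).im = √(gammaTwoSectionImSq w) := rfl
  refine ⟨?_, ?_⟩
  · rwa [e1, abs_neg, abs_of_nonneg h1]
  · rw [e1, e2, abs_neg, neg_sq, abs_of_nonneg h1, Real.sq_sqrt h3.le]; linarith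

theorem gammaTwoFold_gammaTwoSection (w : twicePuncturedPlane) (hw : 0 ≤ w.1.2) :
    gammaTwoFold (gammaTwoSection w) = w := by
  obtain ⟨h1, h2, h3, h4, h5, h6⟩ := gammaTwoSection_spec w.2
  have e1 : (gammaTwoSection w).re = gammaTwoSectionRe w := rfl
  have e2 : (gammaTwoSection w).im = √(gammaTwoSectionImSq w) := rfl
  have e3 : gammaTwoHeight (gammaTwoSection w) =
      gammaTwoSectionRe w ^ 2 + gammaTwoSectionImSq w - gammaTwoSectionRe w := by
    rw [gammaTwoHeight, e1, e2, abs_of_nonneg h1, Real.sq_sqrt h3.le]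
  unfold gammaTwoFold
  rw [e3, e1, abs_of_nonneg h1, h6, if_pos h1, h5, Real.sqrt_sq hw]

theorem gammaTwoFold_gammaTwoSection' (w : twicePuncturedPlane) (hw : w.1.2 ≤ 0) :
    gammaTwoFold (gammaTwoSection' w) = w := by
  obtain ⟨h1, h2, h3, h4, h5, h6⟩ := gammaTwoSection_spec w.2
  have e1 : (gammaTwoSection' w).re = -gammaTwoSectionRe w := rfl
  have e2 : (gammaTwoSection' w).im = √(gammaTwoSectionImSq w) := rfl
  have e3 : gammaTwoHeight (gammaTwoSection' w) =
      gammaTwoSectionRe w ^ 2 + gammaTwoSectionImSq w - gammaTwoSectionRe w := by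
    rw [gammaTwoHeight, e1, e2, abs_neg, neg_sq, abs_of_nonneg h1, Real.sq_sqrt h3.le]
  have e4 : √(w.1.2 ^ 2) = -w.1.2 := by rw [Real.sqrt_sq_eq_abs, abs_of_nonpos hw]
  unfold gammaTwoFold
  rw [e3, e1, abs_neg, abs_of_nonneg h1, h6, h5, e4]
  ext
  · rfl
  · dsimp only
    split_ifs with h
    · have : gammaTwoSectionRe w = 0 := by linarith
      rw [this] at h6
      have : w.1.2 = 0 := by simpa using h6.symm
      simp [this]
    · simp

theorem abs_re_eq_of_gammaTwoFold_eq {z z' : ℍ} (hz : z ∈ gammaTwoDomain)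
    (hz' : z' ∈ gammaTwoDomain) (h : gammaTwoFold z = gammaTwoFold z') :
    |z.re| = |z'.re| ∧ z.im = z'.im := by
  have a1 := sqrt_gammaTwoFold_add hz
  have a2 := sqrt_gammaTwoFold_sub hz
  rw [h, sqrt_gammaTwoFold_add hz'] at a1
  rw [h, sqrt_gammaTwoFold_sub hz'] at a2
  have a3 : |z.re| = |z'.re| := by linarith
  have a4 : gammaTwoHeight z = gammaTwoHeight z' := by linarith
  refine ⟨a3, ?_⟩
  have a5 : z.re ^ 2 = z'.re ^ 2 := by rw [← sq_abs, a3, sq_abs]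
  rw [gammaTwoHeight, gammaTwoHeight, a3, a5] at a4
  have a6 : z.im ^ 2 = z'.im ^ 2 := by linarith
  exact (pow_left_inj₀ z.im_pos.le z'.im_pos.le two_ne_zero).1 a6

end

section

open scoped MatrixGroups UpperHalfPlane
open CongruenceSubgroup

theorem mem_gamma_two_iff (g : SL(2, ℤ)) :
    g ∈ Gamma 2 ↔ Odd (g 0 0) ∧ Even (g 0 1) ∧ Even (g 1 0) ∧ Odd (g 1 1) := by
  rw [Gamma_mem]
  have h1 := fun a : ℤ => ZMod.intCast_eq_one_iff_odd (n := a)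
  have h2 := fun a : ℤ => ZMod.intCast_eq_zero_iff_even (n := a)
  push_cast [h1, h2]
  rfl

/-- The squared modulus of the denominator of a Möbius transformation. -/
def slDenomSq (g : SL(2, ℤ)) (z : ℍ) : ℝ :=
  (g 1 0 * z.re + g 1 1) ^ 2 + (g 1 0 * z.im) ^ 2

theorem slDenomSq_pos (g : SL(2, ℤ)) (z : ℍ) : 0 < slDenomSq g z := by
  have h := sl_denom_ne_zero g z
  have := Complex.normSq_pos.2 h
  rw [Complex.normSq_apply] at this
  simp at this
  unfold slDenomSq
  nlinarith

theorem sl_smul_re_im (g : SL(2, ℤ)) (z : ℍ) :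
    slDenomSq g z * (g • z).im = z.im ∧
    slDenomSq g z * (g • z).re = (g 0 0 * z.re + g 0 1) * (g 1 0 * z.re + g 1 1) +
      g 0 0 * g 1 0 * z.im ^ 2 := by
  have h := sl_coe_smul g z
  rw [eq_div_iff (sl_denom_ne_zero g z)] at h
  have h1 := congrArg Complex.re h
  have h2 := congrArg Complex.im h
  have hd : ((g 0 0 : ℤ) : ℝ) * g 1 1 - g 0 1 * g 1 0 = 1 := by exact_mod_cast sl_det_eq g
  generalize g • z = w at h1 h2 ⊢
  simp at h1 h2
  unfold slDenomSq
  constructor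
  · linear_combination (g 1 0 * z.re + g 1 1) * h2 - g 1 0 * z.im * h1 + z.im * hd
  · linear_combination (g 1 0 * z.re + g 1 1) * h1 + g 1 0 * z.im * h2

theorem sl_smul_normSq (g : SL(2, ℤ)) (z : ℍ) :
    slDenomSq g z * ((g • z).re ^ 2 + (g • z).im ^ 2) =
      (g 0 0 * z.re + g 0 1) ^ 2 + (g 0 0 * z.im) ^ 2 := by
  obtain ⟨h2, h1⟩ := sl_smul_re_im g z
  have hp := slDenomSq_pos g z
  have hd : ((g 0 0 : ℤ) : ℝ) * g 1 1 - g 0 1 * g 1 0 = 1 := by exact_mod_cast sl_det_eq g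
  have : slDenomSq g z * (slDenomSq g z * ((g • z).re ^ 2 + (g • z).im ^ 2)) =
      slDenomSq g z * ((g 0 0 * z.re + g 0 1) ^ 2 + (g 0 0 * z.im) ^ 2) := by
    have e : slDenomSq g z * (slDenomSq g z * ((g • z).re ^ 2 + (g • z).im ^ 2)) =
      (slDenomSq g z * (g • z).re) ^ 2 + (slDenomSq g z * (g • z).im) ^ 2 := by ring
    rw [e, h1, h2]
    unfold slDenomSq
    linear_combination (-(z.im ^ 2) * (1 + (g 0 0 * g 1 1 - g 0 1 * g 1 0))) * hd
  exact mul_left_cancel₀ hp.ne' this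

theorem gammaTwoDomain_of_re_im {z w : ℍ} (hz : z ∈ gammaTwoDomain) (h : |w.re| = 1 - |z.re|)
    (h2 : w.im = z.im) : w ∈ gammaTwoDomain := by
  have h0 := abs_nonneg z.re
  have h3 := hz.1
  have h4 := hz.2
  rw [← sq_abs] at h4
  refine ⟨by linarith, ?_⟩
  rw [← sq_abs, h, h2]
  linarith

theorem S_smul_mem_gammaTwoDomain {z : ℍ} (hz : z ∈ gammaTwoDomain) :
    ModularGroup.S • z ∈ gammaTwoDomain := by
  obtain ⟨h2, h1⟩ := sl_smul_re_im ModularGroup.S z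
  have h3 := sl_smul_normSq ModularGroup.S z
  have hp := slDenomSq_pos ModularGroup.S z
  simp [ModularGroup.S, slDenomSq] at h1 h2 h3 hp
  have h4 : |z.re ^ 2 + z.im ^ 2| * |(ModularGroup.S • z).re| = |z.re| := by
    rw [← abs_mul, ← abs_neg z.re]
    exact congrArg _ h1
  rw [abs_of_pos hp] at h4
  have h5 := hz.1
  have h6 := hz.2
  constructor
  · by_contra! h
    nlinarith
  · have h3' : (z.re ^ 2 + z.im ^ 2) *
      ((ModularGroup.S • z).re ^ 2 + (ModularGroup.S • z).im ^ 2) = 1 := h3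
    by_contra! h
    nlinarith

/-- The reduction of `S` modulo two. -/
def slTwoS : SL(2, ZMod 2) := ⟨!![0, 1; 1, 0], by decide⟩

/-- The reduction of `T` modulo two. -/
def slTwoT : SL(2, ZMod 2) := ⟨!![1, 1; 0, 1], by decide⟩

theorem map_S_zmod_two :
    Matrix.SpecialLinearGroup.map (Int.castRingHom (ZMod 2)) ModularGroup.S = slTwoS := by
  ext i j; fin_cases i <;> fin_cases j <;> decide

theorem map_T_zmod_two :
    Matrix.SpecialLinearGroup.map (Int.castRingHom (ZMod 2)) ModularGroup.T = slTwoT := by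
  ext i j; fin_cases i <;> fin_cases j <;> decide

theorem slTwoT_inv : slTwoT⁻¹ = slTwoT := by decide

theorem exists_smul_mem_gammaTwoDomain_aux (σ : SL(2, ZMod 2)) (z : ℍ)
    (hz : z ∈ gammaTwoDomain) : ∃ h : SL(2, ℤ),
      h • z ∈ gammaTwoDomain ∧ Matrix.SpecialLinearGroup.map (Int.castRingHom (ZMod 2)) h = σ := by
  set R : SL(2, ℤ) →* SL(2, ZMod 2) :=
    Matrix.SpecialLinearGroup.map (Int.castRingHom (ZMod 2)) with hR
  have hS : R ModularGroup.S = slTwoS := map_S_zmod_two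
  have hT : R ModularGroup.T = slTwoT := map_T_zmod_two
  have hT' : R ModularGroup.T⁻¹ = slTwoT := by rw [map_inv, hT, slTwoT_inv]
  let Q : SL(2, ZMod 2) → Prop := fun σ => ∀ z ∈ gammaTwoDomain, ∃ h : SL(2, ℤ),
      h • z ∈ gammaTwoDomain ∧ R h = σ
  have q1 : Q 1 := fun z hz => ⟨1, by simpa using hz, map_one _⟩
  have qS : ∀ σ, Q σ → Q (slTwoS * σ) := by
    intro σ hσ z hz
    obtain ⟨h, h1, h2⟩ := hσ z hz
    exact ⟨ModularGroup.S * h, by rw [mul_smul]; exact S_smul_mem_gammaTwoDomain h1,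
      by rw [map_mul, hS, h2]⟩
  have qT : ∀ σ, Q σ → Q (slTwoT * σ) := by
    intro σ hσ z hz
    obtain ⟨h, h1, h2⟩ := hσ z hz
    have h3 := h1.1
    rcases le_total 0 (h • z).re with h0 | h0
    · refine ⟨ModularGroup.T⁻¹ * h, ?_, by rw [map_mul, hT', h2]⟩
      rw [mul_smul]
      refine gammaTwoDomain_of_re_im h1 ?_ (ModularGroup.im_T_inv_smul _)
      rw [abs_of_nonneg h0] at h3 ⊢
      rw [ModularGroup.re_T_inv_smul, abs_of_nonpos (by linarith)]
      ring
    · refine ⟨ModularGroup.T * h, ?_, by rw [map_mul, hT, h2]⟩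
      rw [mul_smul]
      refine gammaTwoDomain_of_re_im h1 ?_ (ModularGroup.im_T_smul _)
      rw [abs_of_nonpos h0] at h3 ⊢
      rw [ModularGroup.re_T_smul, abs_of_nonneg (by linarith)]
      ring
  have key : ∀ σ : SL(2, ZMod 2), σ = 1 ∨ σ = slTwoS * 1 ∨ σ = slTwoT * 1 ∨ σ = slTwoS * (slTwoT * 1) ∨
      σ = slTwoT * (slTwoS * 1) ∨ σ = slTwoS * (slTwoT * (slTwoS * 1)) := by decide
  have : Q σ := by
    rcases key σ with h | h | h | h | h | h <;> rw [h]
    exacts [q1, qS _ q1, qT _ q1, qS _ (qT _ q1), qT _ (qS _ q1), qS _ (qT _ (qS _ q1))]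
  exact this z hz

theorem exists_smul_mem_gammaTwoDomain (z : ℍ) : ∃ g ∈ Gamma 2, g • z ∈ gammaTwoDomain := by
  obtain ⟨g, hg⟩ := ModularGroup.exists_smul_mem_fd z
  have hg' : g • z ∈ gammaTwoDomain := by
    have h1 := hg.1
    have h2 := hg.2
    rw [Complex.normSq_apply] at h1
    simp only [UpperHalfPlane.coe_re, UpperHalfPlane.coe_im] at h1
    constructor
    · linarith
    · nlinarith
  obtain ⟨h, h1, h2⟩ := exists_smul_mem_gammaTwoDomain_aux
    (Matrix.SpecialLinearGroup.map (Int.castRingHom (ZMod 2)) g⁻¹) _ hg'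
  refine ⟨h * g, ?_, by rwa [mul_smul]⟩
  rw [Gamma_mem', map_mul, h2, ← map_mul, inv_mul_cancel, map_one]

end

section

open scoped MatrixGroups UpperHalfPlane
open CongruenceSubgroup

theorem gammaTwoFold_eq_of_neg {z w : ℍ} (h1 : w.re = -z.re) (h2 : w.im = z.im)
    (h : |z.re| = 1 ∨ gammaTwoHeight z = 0) : gammaTwoFold w = gammaTwoFold z := by
  have h3 : |w.re| = |z.re| := by rw [h1, abs_neg]
  have h4 : gammaTwoHeight w = gammaTwoHeight z := by
    rw [gammaTwoHeight, h3, h1, h2, neg_sq]; rfl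
  have h5 : 4 * |z.re| * (1 - |z.re|) * (gammaTwoHeight z * (gammaTwoHeight z + 2)) = 0 := by
    rcases h with h | h <;> simp [h]
  unfold gammaTwoFold
  rw [h3, h4, h5]
  simp

theorem one_le_sq_of_odd {n : ℤ} (h : Odd n) : (1 : ℝ) ≤ (n : ℝ) ^ 2 := by
  have : n ≠ 0 := by rintro rfl; simp at h
  have h2 : 1 ≤ n ^ 2 := by nlinarith [sq_nonneg n, mul_self_pos.2 this]
  exact_mod_cast h2

theorem gammaTwo_slDenomSq_ge {g : SL(2, ℤ)} (hg : g ∈ Gamma 2) {z : ℍ}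
    (hz : z ∈ gammaTwoDomain) :
    |z.re| * (((|g 1 0| - |g 1 1| : ℤ) : ℝ) ^ 2 - 1) + (1 - |z.re|) * ((g 1 1 : ℝ) ^ 2 - 1)
      + (g 1 0) ^ 2 * gammaTwoHeight z
      + 2 * ((g 1 0 : ℝ) * g 1 1 * z.re + |(g 1 0 : ℝ) * g 1 1 * z.re|) = slDenomSq g z - 1 ∧
    0 ≤ |z.re| * (((|g 1 0| - |g 1 1| : ℤ) : ℝ) ^ 2 - 1) ∧
    0 ≤ (1 - |z.re|) * ((g 1 1 : ℝ) ^ 2 - 1) ∧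
    0 ≤ (g 1 0 : ℝ) ^ 2 * gammaTwoHeight z ∧
    0 ≤ (g 1 0 : ℝ) * g 1 1 * z.re + |(g 1 0 : ℝ) * g 1 1 * z.re| := by
  obtain ⟨ha, hb, hc, hd⟩ := (mem_gamma_two_iff g).1 hg
  have o1 : Odd (|g 1 0| - |g 1 1|) := Even.sub_odd (even_abs.2 hc) (odd_abs.2 hd)
  have s1 := one_le_sq_of_odd o1
  have s2 := one_le_sq_of_odd hd
  have h0 := abs_nonneg z.re
  have h1 : 0 ≤ 1 - |z.re| := sub_nonneg.2 hz.1
  have h2 : 0 ≤ gammaTwoHeight z := sub_nonneg.2 hz.2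
  refine ⟨?_, mul_nonneg h0 (by linarith), mul_nonneg h1 (by linarith), by positivity,
    by linarith [neg_abs_le ((g 1 0 : ℝ) * g 1 1 * z.re)]⟩
  rw [abs_mul, abs_mul, slDenomSq, gammaTwoHeight]
  push_cast
  have e1 := sq_abs (g 1 0 : ℝ)
  have e2 := sq_abs (g 1 1 : ℝ)
  linear_combination |z.re| * e1 + |z.re| * e2

theorem gammaTwo_one_le_slDenomSq {g : SL(2, ℤ)} (hg : g ∈ Gamma 2) {z : ℍ}
    (hz : z ∈ gammaTwoDomain) : 1 ≤ slDenomSq g z := by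
  obtain ⟨h, h1, h2, h3, h4⟩ := gammaTwo_slDenomSq_ge hg hz
  linarith

theorem gammaTwo_im_le {g : SL(2, ℤ)} (hg : g ∈ Gamma 2) {z : ℍ}
    (hz : z ∈ gammaTwoDomain) : (g • z).im ≤ z.im := by
  have h1 := gammaTwo_one_le_slDenomSq hg hz
  have h2 := (sl_smul_re_im g z).1
  have h3 := (g • z).im_pos
  nlinarith

theorem gammaTwo_slDenomSq_eq_one {g : SL(2, ℤ)} (hg : g ∈ Gamma 2) {z : ℍ}
    (hz : z ∈ gammaTwoDomain) (hgz : g • z ∈ gammaTwoDomain) :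
    (g • z).im = z.im ∧ slDenomSq g z = 1 := by
  have h1 := gammaTwo_im_le hg hz
  have h2 := gammaTwo_im_le (inv_mem hg) hgz
  rw [inv_smul_smul] at h2
  have h3 := le_antisymm h1 h2
  have h4 := (sl_smul_re_im g z).1
  rw [h3] at h4
  exact ⟨h3, mul_right_cancel₀ z.im_ne_zero (h4.trans (one_mul _).symm)⟩

theorem gammaTwo_boundary {g : SL(2, ℤ)} (hg : g ∈ Gamma 2) {z : ℍ}
    (hz : z ∈ gammaTwoDomain) (hN : slDenomSq g z = 1) (h0 : g 1 0 ≠ 0) :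
    gammaTwoHeight z = 0 ∧ 0 < |z.re| ∧ (g 1 1) ^ 2 = 1 ∧ (g 1 0) ^ 2 = 4 ∧
      (g 1 0 : ℝ) * g 1 1 * z.re + |(g 1 0 : ℝ) * g 1 1 * z.re| = 0 := by
  obtain ⟨ha, hb, hc, hd⟩ := (mem_gamma_two_iff g).1 hg
  obtain ⟨k, k1, k2, k3, k4⟩ := gammaTwo_slDenomSq_ge hg hz
  rw [hN, sub_self] at k
  have hc2 : (0 : ℝ) < (g 1 0 : ℝ) ^ 2 := by positivity
  have hD : gammaTwoHeight z = 0 := by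
    have : (g 1 0 : ℝ) ^ 2 * gammaTwoHeight z = 0 := by linarith
    exact (mul_eq_zero.1 this).resolve_left hc2.ne'
  have hD2 : z.im ^ 2 = |z.re| - |z.re| ^ 2 := by
    rw [gammaTwoHeight] at hD; rw [sq_abs]; linarith
  have hy : 0 < z.im ^ 2 := pow_pos z.im_pos 2
  have hab := abs_nonneg z.re
  have x0 : 0 < |z.re| := by nlinarith only [hab, hy, hD2]
  have x1 : 0 < 1 - |z.re| := by nlinarith only [x0, hy, hD2]
  have c1 : (((|g 1 0| - |g 1 1| : ℤ) : ℝ) ^ 2 - 1) = 0 := by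
    have : |z.re| * (((|g 1 0| - |g 1 1| : ℤ) : ℝ) ^ 2 - 1) = 0 := by linarith
    exact (mul_eq_zero.1 this).resolve_left x0.ne'
  have c2 : ((g 1 1 : ℝ) ^ 2 - 1) = 0 := by
    have : (1 - |z.re|) * ((g 1 1 : ℝ) ^ 2 - 1) = 0 := by linarith
    exact (mul_eq_zero.1 this).resolve_left x1.ne'
  have c4 : (g 1 0 : ℝ) * g 1 1 * z.re + |(g 1 0 : ℝ) * g 1 1 * z.re| = 0 := by linarith
  have c1' : (|g 1 0| - |g 1 1|) ^ 2 = 1 := by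
    have : ((|g 1 0| - |g 1 1| : ℤ) : ℝ) ^ 2 = 1 := by linarith
    exact_mod_cast this
  have c2' : (g 1 1) ^ 2 = 1 := by
    have : (g 1 1 : ℝ) ^ 2 = 1 := by linarith
    exact_mod_cast this
  refine ⟨hD, x0, c2', ?_, c4⟩
  have d1 : |g 1 1| = 1 := by
    rcases sq_eq_one_iff.1 c2' with h | h <;> simp [h]
  rw [d1] at c1'
  have h2 : |g 1 0| = 2 := by
    have := abs_pos.2 h0
    nlinarith
  rw [← sq_abs, h2]
  norm_num

theorem gammaTwoFold_smul {g : SL(2, ℤ)} (hg : g ∈ Gamma 2) {z : ℍ}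
    (hz : z ∈ gammaTwoDomain) (hgz : g • z ∈ gammaTwoDomain) :
    gammaTwoFold (g • z) = gammaTwoFold z := by
  obtain ⟨him, hN⟩ := gammaTwo_slDenomSq_eq_one hg hz hgz
  obtain ⟨him', hN'⟩ := gammaTwo_slDenomSq_eq_one (inv_mem hg) hgz (by rwa [inv_smul_smul])
  have hre := (sl_smul_re_im g z).2
  rw [hN, one_mul] at hre
  obtain ⟨ha, hb, hc, hd⟩ := (mem_gamma_two_iff g).1 hg
  have hdet := sl_det_eq g
  have hx := hz.1
  have hx' := hgz.1
  by_cases h0 : g 1 0 = 0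
  · have had : g 0 0 * g 1 1 = 1 := by rw [h0] at hdet; linarith
    have e : (g • z).re = z.re + ((g 0 1 * g 1 1 : ℤ) : ℝ) := by
      rw [hre, h0]
      have : (g 0 0 : ℝ) * g 1 1 = 1 := by exact_mod_cast had
      push_cast
      linear_combination z.re * this
    have hev : Even (g 0 1 * g 1 1) := hb.mul_right _
    obtain ⟨m, hm⟩ := hev
    rw [hm] at e
    push_cast at e
    rw [abs_le] at hx hx'
    have m1 : m ≤ 1 := by
      have : (m : ℝ) ≤ 1 := by linarith
      exact_mod_cast this
    have m2 : -1 ≤ m := by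
      have : (-1 : ℝ) ≤ m := by linarith
      exact_mod_cast this
    obtain rfl | rfl | rfl : m = 0 ∨ m = 1 ∨ m = -1 := by omega
    · have : g • z = z := by
        apply UpperHalfPlane.ext
        apply Complex.ext
        · simpa using e
        · exact him
      rw [this]
    · push_cast at e
      have e1 : z.re = -1 := by linarith
      have e2 : (g • z).re = 1 := by linarith
      exact gammaTwoFold_eq_of_neg (by rw [e1, e2]; norm_num) him (Or.inl (by simp [e1]))
    · push_cast at e
      have e1 : z.re = 1 := by linarith
      have e2 : (g • z).re = -1 := by linarith
      exact gammaTwoFold_eq_of_neg (by rw [e1, e2]) him (Or.inl (by simp [e1]))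
  · have hinv : (g⁻¹ : SL(2, ℤ)) 1 1 = g 0 0 ∧ (g⁻¹ : SL(2, ℤ)) 1 0 = - g 1 0 := by
      rw [Matrix.SpecialLinearGroup.SL2_inv_expl]; simp
    obtain ⟨hD, x0, d2, c2, hs⟩ := gammaTwo_boundary hg hz hN h0
    obtain ⟨-, -, a2, -, -⟩ := gammaTwo_boundary (inv_mem hg) hgz hN'
      (by rw [hinv.2]; exact neg_ne_zero.2 h0)
    rw [hinv.1] at a2
    have hb0 : g 0 1 = 0 := by
      obtain ⟨m, hm⟩ := hb
      obtain ⟨n, hn⟩ := hc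
      rw [hm, hn] at hdet
      rw [hn] at c2
      have hn1 : n ^ 2 = 1 := by linarith
      rw [hm]
      have hn0 : n ≠ 0 := by rintro rfl; simp at hn1
      have e : g 0 0 * g 1 1 = 1 + 4 * (m * n) := by linarith
      have : (g 0 0 * g 1 1) ^ 2 = 1 := by rw [mul_pow, a2, d2, one_mul]
      rcases sq_eq_one_iff.1 this with h1 | h1
      · have : m * n = 0 := by omega
        simp [(mul_eq_zero.1 this).resolve_right hn0]
      · omega
    rw [hb0, zero_mul, sub_zero] at hdet
    have hre' : (g • z).re = z.re + g 0 0 * g 1 0 * |z.re| := by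
      have hr : z.re ^ 2 + z.im ^ 2 = |z.re| := sub_eq_zero.1 hD
      have had : (g 0 0 : ℝ) * g 1 1 = 1 := by exact_mod_cast hdet
      rw [hre, hb0]
      push_cast
      linear_combination z.re * had + g 0 0 * g 1 0 * hr
    have had : g 0 0 = g 1 1 := by nlinarith
    refine gammaTwoFold_eq_of_neg ?_ him (Or.inr hD)
    rw [hre', had]
    rw [abs_mul] at hs
    have hcd : ((g 1 0 : ℝ) * g 1 1) ^ 2 = 4 := by
      have : ((g 1 0) * g 1 1) ^ 2 = 4 := by rw [mul_pow, c2, d2]; norm_num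
      exact_mod_cast this
    have hcd' : |(g 1 0 : ℝ) * g 1 1| = 2 := by
      rw [show (4 : ℝ) = 2 ^ 2 by norm_num, sq_eq_sq_iff_abs_eq_abs] at hcd
      simpa using hcd
    rw [hcd'] at hs
    have : (g 1 0 : ℝ) * g 1 1 * ((g 1 0 : ℝ) * g 1 1 * z.re + 2 * |z.re|) = 0 := by
      rw [hs, mul_zero]
    linear_combination this / 2 - z.re / 2 * hcd

/-- The lower triangular unipotent matrices. -/
def slLower (n : ℤ) : SL(2, ℤ) := ⟨!![1, 0; n, 1], by simp⟩

theorem slLower_coe (n : ℤ) : (slLower n : Matrix (Fin 2) (Fin 2) ℤ) = !![1, 0; n, 1] := rfl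

theorem exists_smul_eq_of_gammaTwoFold_eq {z w : ℍ} (hz : z ∈ gammaTwoDomain)
    (hw : w ∈ gammaTwoDomain) (h : gammaTwoFold z = gammaTwoFold w) :
    ∃ g ∈ Gamma 2, g • z = w := by
  obtain ⟨h1, h2⟩ := abs_re_eq_of_gammaTwoFold_eq hz hw h
  have hsame : ∀ g : SL(2, ℤ), (g • z).im = z.im → (g • z).re = w.re → g • z = w := by
    intro g a b
    apply UpperHalfPlane.ext
    apply Complex.ext
    · exact b
    · exact a.trans h2
  rcases abs_eq_abs.1 h1 with h3 | h3
  · exact ⟨1, one_mem _, by rw [hsame] <;> simp [h3]⟩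
  · by_cases hx0 : z.re = 0
    · exact ⟨1, one_mem _, by rw [hsame] <;> simp; linarith⟩
    have hHt : gammaTwoHeight w = gammaTwoHeight z := by
      rw [gammaTwoHeight, gammaTwoHeight, h1, h2, h3, neg_sq]
    have hA : 4 * |z.re| * (1 - |z.re|) * (gammaTwoHeight z * (gammaTwoHeight z + 2)) = 0 := by
      have hs := congrArg Prod.snd h
      have hn := gammaTwoFold_snd_sq hz
      simp only [gammaTwoFold, hHt, ← h1] at hs
      have : (gammaTwoFold z).2 = 0 := by
        rcases lt_or_gt_of_ne hx0 with hl | hl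
        · rw [if_neg (by linarith), if_pos (by linarith)] at hs
          simp only [gammaTwoFold]
          rw [if_neg (by linarith)]
          linarith
        · rw [if_pos (by linarith), if_neg (by linarith)] at hs
          simp only [gammaTwoFold]
          rw [if_pos (by linarith)]
          linarith
      rw [← hn, this]
      norm_num
    have hH0 : 0 ≤ gammaTwoHeight z := sub_nonneg.2 hz.2
    have hA' : (1 - |z.re|) * gammaTwoHeight z = 0 := by
      have : 4 * |z.re| * (gammaTwoHeight z + 2) ≠ 0 := by positivity
      refine (mul_eq_zero.1 (?_ : 4 * |z.re| * (gammaTwoHeight z + 2) * _ = 0)).resolve_left this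
      linarith
    rcases mul_eq_zero.1 hA' with hA' | hA'
    · have hx1 : |z.re| = 1 := by linarith
      rcases eq_or_eq_neg_of_abs_eq hx1 with e | e
      · refine ⟨ModularGroup.T ^ (-2 : ℤ), ?_, hsame _ (ModularGroup.im_T_zpow_smul _ _) ?_⟩
        · rw [mem_gamma_two_iff, ModularGroup.coe_T_zpow]; simp
        · rw [ModularGroup.re_T_zpow_smul]; push_cast; linarith
      · refine ⟨ModularGroup.T ^ (2 : ℤ), ?_, hsame _ (ModularGroup.im_T_zpow_smul _ _) ?_⟩
        · rw [mem_gamma_two_iff, ModularGroup.coe_T_zpow]; simp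
        · rw [ModularGroup.re_T_zpow_smul]; push_cast; linarith
    · have hr : z.re ^ 2 + z.im ^ 2 = |z.re| := sub_eq_zero.1 hA'
      have key : ∀ n : ℤ, n * |z.re| = -2 * z.re → (n : ℝ) ^ 2 = 4 →
          slDenomSq (slLower n) z = 1 := by
        intro n hn hn2
        simp [slDenomSq, slLower_coe]
        linear_combination n ^ 2 * hr + n * hn
      have key2 : ∀ n : ℤ, n * |z.re| = -2 * z.re → (n : ℝ) ^ 2 = 4 →
          (slLower n) • z = w := by
        intro n hn hn2
        have k := key n hn hn2
        obtain ⟨k1, k2⟩ := sl_smul_re_im (slLower n) z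
        rw [k, one_mul] at k1 k2
        refine hsame _ k1 ?_
        rw [k2]
        simp [slLower_coe]
        linear_combination n * hr + hn - h3
      rcases le_total 0 z.re with hx | hx
      · refine ⟨_, ?_, key2 (-2) ?_ (by norm_num)⟩
        · rw [mem_gamma_two_iff, slLower_coe]; simp
        · rw [abs_of_nonneg hx]; norm_num
      · refine ⟨_, ?_, key2 2 ?_ (by norm_num)⟩
        · rw [mem_gamma_two_iff, slLower_coe]; simp
        · rw [abs_of_nonpos hx]; norm_num

end

section

open scoped MatrixGroups UpperHalfPlane Topology
open CongruenceSubgroup Filter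

theorem slLower_mem_gamma_two {n : ℤ} (hn : Even n) : slLower n ∈ Gamma 2 := by
  rw [mem_gamma_two_iff, slLower_coe]
  simpa using hn

theorem T_zpow_mem_gamma_two {n : ℤ} (hn : Even n) : ModularGroup.T ^ n ∈ Gamma 2 := by
  rw [mem_gamma_two_iff, ModularGroup.coe_T_zpow]
  simpa using hn

theorem slLower_smul_mem_gammaTwoDomain {n : ℤ} {z : ℍ}
    (h1 : |z.re + n * (z.re ^ 2 + z.im ^ 2)| ≤ z.re ^ 2 + z.im ^ 2)
    (h2 : z.re ^ 2 + z.im ^ 2 ≤ slDenomSq (slLower n) z) : slLower n • z ∈ gammaTwoDomain := by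
  obtain ⟨-, k2⟩ := sl_smul_re_im (slLower n) z
  have k3 := sl_smul_normSq (slLower n) z
  have hp := slDenomSq_pos (slLower n) z
  set N := slDenomSq (slLower n) z
  simp [slLower_coe] at k2 k3
  have k4 : N * |(slLower n • z).re| = |z.re + n * (z.re ^ 2 + z.im ^ 2)| := by
    have e : N * |(slLower n • z).re| = |N * (slLower n • z).re| := by
      rw [abs_mul, abs_of_pos hp]
    rw [e]
    congr 1
    refine k2.trans ?_
    ring
  have k3' : N * ((slLower n • z).re ^ 2 + (slLower n • z).im ^ 2) = z.re ^ 2 + z.im ^ 2 := k3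
  constructor
  · refine le_of_mul_le_mul_left ?_ hp
    linarith
  · refine le_of_mul_le_mul_left ?_ hp
    linarith

theorem exists_finset_smul_mem_gammaTwoDomain_aux {z₀ : ℍ} (hz₀ : z₀ ∈ gammaTwoDomain) :
    ∃ A : Finset SL(2, ℤ), (∀ g ∈ A, g ∈ Gamma 2) ∧
      ∀ᶠ z in 𝓝 z₀, ∃ g ∈ A, g • z ∈ gammaTwoDomain := by
  have cr := UpperHalfPlane.continuous_re
  have ci := UpperHalfPlane.continuous_im
  have lt_ev : ∀ {f g : ℍ → ℝ}, Continuous f → Continuous g → f z₀ < g z₀ →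
      ∀ᶠ z in 𝓝 z₀, f z < g z := fun hf hg h => hf.continuousAt.eventually_lt hg.continuousAt h
  have hy0 := pow_pos z₀.im_pos 2
  have hF : ∀ z : ℍ, z ∈ gammaTwoDomain → (1 : SL(2, ℤ)) • z ∈ gammaTwoDomain := by simp
  rcases hz₀.1.eq_or_lt with hx | hx
  · refine ⟨{1, ModularGroup.T ^ (-2 : ℤ), ModularGroup.T ^ (2 : ℤ)}, ?_, ?_⟩
    · simp only [Finset.mem_insert, Finset.mem_singleton]
      rintro g (rfl | rfl | rfl)
      exacts [one_mem _, T_zpow_mem_gamma_two (by decide), T_zpow_mem_gamma_two (by decide)]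
    · have e1 := lt_ev (f := fun z => |z.re|) (g := fun z => z.re ^ 2 + z.im ^ 2) (by fun_prop)
        (by fun_prop) (by rw [hx, ← sq_abs, hx]; linarith)
      have e2 := lt_ev (f := fun z => |z.re|) (g := fun _ => 2) (by fun_prop)
        (by fun_prop) (by rw [hx]; norm_num)
      have e3 := lt_ev (f := fun _ => 0) (g := fun z => (2 - |z.re|) ^ 2 + z.im ^ 2 - (2 - |z.re|))
        (by fun_prop) (by fun_prop) (by rw [hx]; linarith)
      filter_upwards [e1, e2, e3] with z h1 h2 h3
      rcases le_or_gt |z.re| 1 with h | h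
      · exact ⟨1, by simp, hF z ⟨h, h1.le⟩⟩
      · rcases le_total 0 z.re with hs | hs
        · refine ⟨ModularGroup.T ^ (-2 : ℤ), by simp, ?_⟩
          rw [abs_of_nonneg hs] at h h1 h2 h3
          constructor
          · rw [ModularGroup.re_T_zpow_smul, abs_le]; push_cast; constructor <;> linarith
          · rw [ModularGroup.re_T_zpow_smul, ModularGroup.im_T_zpow_smul, abs_of_nonpos] <;>
              push_cast <;> nlinarith
        · refine ⟨ModularGroup.T ^ (2 : ℤ), by simp, ?_⟩
          rw [abs_of_nonpos hs] at h h1 h2 h3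
          constructor
          · rw [ModularGroup.re_T_zpow_smul, abs_le]; push_cast; constructor <;> linarith
          · rw [ModularGroup.re_T_zpow_smul, ModularGroup.im_T_zpow_smul, abs_of_nonneg] <;>
              push_cast <;> nlinarith
  · have e0 := lt_ev (f := fun z => |z.re|) (g := fun _ => 1) (by fun_prop) (by fun_prop) hx
    rcases hz₀.2.eq_or_lt with hD | hD
    · refine ⟨{1, slLower (-2), slLower 2}, ?_, ?_⟩
      · simp only [Finset.mem_insert, Finset.mem_singleton]
        rintro g (rfl | rfl | rfl)
        exacts [one_mem _, slLower_mem_gamma_two (by decide), slLower_mem_gamma_two (by decide)]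
      · have hx0 : 0 < |z₀.re| := by nlinarith [sq_nonneg z₀.re]
        have e1 := lt_ev (f := fun z => |z.re|) (g := fun z => 2 * (z.re ^ 2 + z.im ^ 2))
          (by fun_prop) (by fun_prop) (by linarith)
        have e2 := lt_ev (f := fun z => z.re ^ 2 + z.im ^ 2)
          (g := fun z => 1 - 4 * |z.re| + 4 * (z.re ^ 2 + z.im ^ 2))
          (by fun_prop) (by fun_prop) (by linarith)
        filter_upwards [e0, e1, e2] with z h0 h1 h2
        rcases le_or_gt |z.re| (z.re ^ 2 + z.im ^ 2) with h | h
        · exact ⟨1, by simp, hF z ⟨h0.le, h⟩⟩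
        · rcases le_total 0 z.re with hs | hs
          · refine ⟨slLower (-2), by simp, ?_⟩
            rw [abs_of_nonneg hs] at h h1 h2
            apply slLower_smul_mem_gammaTwoDomain
            · rw [abs_le]; push_cast; constructor <;> linarith
            · simp [slDenomSq, slLower_coe]; linarith
          · refine ⟨slLower 2, by simp, ?_⟩
            rw [abs_of_nonpos hs] at h h1 h2
            apply slLower_smul_mem_gammaTwoDomain
            · rw [abs_le]; push_cast; constructor <;> linarith
            · simp [slDenomSq, slLower_coe]; linarith
    · refine ⟨{1}, by simp, ?_⟩
      have e1 := lt_ev (f := fun z => |z.re|) (g := fun z => z.re ^ 2 + z.im ^ 2) (by fun_prop)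
        (by fun_prop) hD
      filter_upwards [e0, e1] with z h0 h1
      exact ⟨1, by simp, hF z ⟨h0.le, h1.le⟩⟩

theorem continuous_sl_smul (g : SL(2, ℤ)) : Continuous fun z : ℍ => g • z := by
  have : (fun z : ℍ => g • z) =
    fun z : ℍ => (Matrix.SpecialLinearGroup.map (Int.castRingHom ℝ) g : SL(2, ℝ)) • z := rfl
  rw [this]
  exact continuous_const_smul _

theorem exists_finset_smul_mem_gammaTwoDomain (z₀ : ℍ) :
    ∃ A : Finset SL(2, ℤ), (∀ g ∈ A, g ∈ Gamma 2) ∧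
      ∀ᶠ z in 𝓝 z₀, ∃ g ∈ A, g • z ∈ gammaTwoDomain := by
  obtain ⟨h, hh, hz⟩ := exists_smul_mem_gammaTwoDomain z₀
  obtain ⟨A, hA, hA2⟩ := exists_finset_smul_mem_gammaTwoDomain_aux hz
  refine ⟨A.image (· * h), ?_, ?_⟩
  · simp only [Finset.mem_image]
    rintro _ ⟨g, hg, rfl⟩
    exact mul_mem (hA g hg) hh
  · filter_upwards [(continuous_sl_smul h).continuousAt.eventually hA2] with z ⟨g, hg, hg2⟩
    exact ⟨g * h, Finset.mem_image_of_mem _ hg, by rwa [mul_smul]⟩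

/-- An explicit universal covering map of the plane without `(1, 0)` and `(-1, 0)`. -/
noncomputable def gammaTwoMap (z : ℍ) : ℝ × ℝ :=
  gammaTwoFold ((exists_smul_mem_gammaTwoDomain z).choose • z)

theorem gammaTwoMap_eq {z : ℍ} {g : SL(2, ℤ)} (hg : g ∈ Gamma 2)
    (hgz : g • z ∈ gammaTwoDomain) : gammaTwoMap z = gammaTwoFold (g • z) := by
  obtain ⟨h, hz⟩ := (exists_smul_mem_gammaTwoDomain z).choose_spec
  unfold gammaTwoMap
  set h' := (exists_smul_mem_gammaTwoDomain z).choose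
  have : h' • z = (h' * g⁻¹) • (g • z) := by rw [smul_smul, inv_mul_cancel_right]
  rw [this]
  exact gammaTwoFold_smul (mul_mem h (inv_mem hg)) hgz (by rwa [← this])

theorem gammaTwoMap_mem (z : ℍ) : gammaTwoMap z ∈ twicePuncturedPlane :=
  gammaTwoFold_mem (exists_smul_mem_gammaTwoDomain z).choose_spec.2

theorem gammaTwoMap_eq_iff {z w : ℍ} :
    gammaTwoMap z = gammaTwoMap w ↔ ∃ g ∈ Gamma 2, g • z = w := by
  obtain ⟨h, hh, hz⟩ := exists_smul_mem_gammaTwoDomain z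
  obtain ⟨k, hk, hw⟩ := exists_smul_mem_gammaTwoDomain w
  constructor
  · intro e
    rw [gammaTwoMap_eq hh hz, gammaTwoMap_eq hk hw] at e
    obtain ⟨g, hg, hg2⟩ := exists_smul_eq_of_gammaTwoFold_eq hz hw e
    refine ⟨k⁻¹ * (g * h), mul_mem (inv_mem hk) (mul_mem hg hh), ?_⟩
    rw [mul_smul, mul_smul, hg2, inv_smul_smul]
  · rintro ⟨g, hg, rfl⟩
    have : h • z = (h * g⁻¹) • g • z := by rw [smul_smul, inv_mul_cancel_right]
    rw [gammaTwoMap_eq hh hz, this]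
    exact (gammaTwoMap_eq (mul_mem hh (inv_mem hg)) (by rwa [← this])).symm

theorem continuous_gammaTwoMap : Continuous gammaTwoMap := by
  rw [continuous_iff_continuousAt]
  intro z₀
  obtain ⟨A, hA, hev⟩ := exists_finset_smul_mem_gammaTwoDomain z₀
  have hev' : (⋃ g ∈ A, (fun z : ℍ => g • z) ⁻¹' gammaTwoDomain) ∈ 𝓝 z₀ := by
    filter_upwards [hev] with z hz
    simpa using hz
  have key : ContinuousWithinAt gammaTwoMap
      (⋃ g ∈ A, (fun z : ℍ => g • z) ⁻¹' gammaTwoDomain) z₀ := by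
    unfold ContinuousWithinAt
    have hU := nhdsWithin_biUnion A.finite_toSet
      (fun g => (fun z : ℍ => g • z) ⁻¹' gammaTwoDomain) z₀
    simp only [Finset.mem_coe] at hU
    rw [hU]
    simp only [tendsto_iSup]
    intro g hg
    by_cases hz : g • z₀ ∈ gammaTwoDomain
    · have h1 : ContinuousWithinAt (fun z => gammaTwoFold (g • z))
        ((fun z : ℍ => g • z) ⁻¹' gammaTwoDomain) z₀ :=
        (continuous_gammaTwoFold.comp (continuous_sl_smul g)).continuousWithinAt
      exact h1.congr (fun z hz => gammaTwoMap_eq (hA g hg) hz) (gammaTwoMap_eq (hA g hg) hz)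
    · have h2 : IsClosed ((fun z : ℍ => g • z) ⁻¹' gammaTwoDomain) :=
        isClosed_gammaTwoDomain.preimage (continuous_sl_smul g)
      have h3 : z₀ ∉ closure ((fun z : ℍ => g • z) ⁻¹' gammaTwoDomain) := by
        rwa [h2.closure_eq]
      rw [notMem_closure_iff_nhdsWithin_eq_bot.1 h3]
      exact tendsto_bot
  exact key.continuousAt hev'

end

section

open scoped MatrixGroups UpperHalfPlane Topology
open CongruenceSubgroup Filter

theorem eq_one_or_eq_neg_one_of_entries {g : SL(2, ℤ)} (hb : g 0 1 = 0) (hc : g 1 0 = 0) :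
    g = 1 ∨ g = -1 := by
  have hd := sl_det_eq g
  rw [hb, zero_mul, sub_zero] at hd
  rcases Int.mul_eq_one_iff_eq_one_or_neg_one.1 hd with ⟨h1, h2⟩ | ⟨h1, h2⟩
  · left
    ext i j; fin_cases i <;> fin_cases j <;> simp [h1, h2, hb, hc]
  · right
    ext i j; fin_cases i <;> fin_cases j <;> simp [h1, h2, hb, hc]

theorem gammaTwo_eq_of_smul_eq {g : SL(2, ℤ)} (hg : g ∈ Gamma 2) {z : ℍ} (h : g • z = z) :
    g = 1 ∨ g = -1 := by
  obtain ⟨h1, h2, h3, h4⟩ := (mem_gamma_two_iff g).1 hg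
  have hd := sl_det_eq g
  have e := sl_coe_smul g z
  rw [h, eq_div_iff (sl_denom_ne_zero g z)] at e
  have e1 := congrArg Complex.re e
  have e2 := congrArg Complex.im e
  simp at e1 e2
  have hy := z.im_pos
  have e3 : 2 * g 1 0 * z.re + g 1 1 = (g 0 0 : ℝ) := by
    refine mul_right_cancel₀ hy.ne' ?_
    linear_combination e2
  by_cases hc : g 1 0 = 0
  · simp [hc] at e1 e3
    have hb : (g 0 1 : ℝ) = 0 := by rw [e3] at e1; linarith
    exact eq_one_or_eq_neg_one_of_entries (by exact_mod_cast hb) hc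
  · exfalso
    have hc' : (0 : ℝ) < (g 1 0 : ℝ) ^ 2 * z.im ^ 2 := by positivity
    have hlt : ((g 0 0 : ℝ) + g 1 1) ^ 2 < 4 := by
      have hd' : (g 0 0 : ℝ) * g 1 1 - g 0 1 * g 1 0 = 1 := by exact_mod_cast hd
      have : ((g 0 0 : ℝ) + g 1 1) ^ 2 - 4 = -4 * ((g 1 0 : ℝ) ^ 2 * z.im ^ 2) := by
        linear_combination 4 * hd' - 4 * g 1 0 * e1 + (2 * g 1 0 * z.re + g 1 1 - g 0 0) * e3
      linarith
    have hlt' : (g 0 0 + g 1 1) ^ 2 < 4 := by exact_mod_cast hlt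
    obtain ⟨a, ha⟩ := h1
    obtain ⟨b, hb⟩ := h2
    obtain ⟨c, hc⟩ := h3
    obtain ⟨d, hd2⟩ := h4
    have hs : g 0 0 + g 1 1 = 0 := by
      have : g 0 0 + g 1 1 < 2 := by nlinarith
      have : -2 < g 0 0 + g 1 1 := by nlinarith
      omega
    have hs2 : g 1 1 = - g 0 0 := by linarith
    rw [hs2, ha, hb, hc] at hd
    have : 4 * (a * a + a + b * c) = -2 := by linarith
    omega

/-- The subgroup of `Γ(2)` of matrices with diagonal entries congruent to one modulo four. It
acts freely on the upper half plane. -/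
def gammaTwoFree : Subgroup SL(2, ℤ) where
  carrier := {g | g 0 0 % 4 = 1 ∧ g 1 1 % 4 = 1 ∧ Even (g 0 1) ∧ Even (g 1 0)}
  one_mem' := by simp
  mul_mem' := by
    rintro g h ⟨g1, g2, ⟨b, hb⟩, ⟨c, hc⟩⟩ ⟨h1, h2, ⟨b', hb'⟩, ⟨c', hc'⟩⟩
    have e : ∀ i j, (g * h) i j = g i 0 * h 0 j + g i 1 * h 1 j := by
      intro i j
      rw [Matrix.SpecialLinearGroup.coe_mul, Matrix.mul_apply, Fin.sum_univ_two]
    simp only [Set.mem_ofPred_eq, e, hb, hc, hb', hc']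
    refine ⟨?_, ?_, ?_, ?_⟩
    · have : (b + b) * (c' + c') = 4 * (b * c') := by ring
      rw [this, Int.add_mul_emod_self_left, Int.mul_emod, g1, h1]; rfl
    · have : (c + c) * (b' + b') = 4 * (c * b') := by ring
      rw [this, Int.mul_add_emod_self_left, Int.mul_emod, g2, h2]; rfl
    · exact ⟨g 0 0 * b' + b * h 1 1, by ring⟩
    · exact ⟨c * h 0 0 + g 1 1 * c', by ring⟩
  inv_mem' := by
    rintro g ⟨g1, g2, hb, hc⟩
    have e1 : g⁻¹ 0 0 = g 1 1 := by rw [Matrix.SpecialLinearGroup.SL2_inv_expl]; simp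
    have e2 : g⁻¹ 0 1 = - g 0 1 := by rw [Matrix.SpecialLinearGroup.SL2_inv_expl]; simp
    have e3 : g⁻¹ 1 0 = - g 1 0 := by rw [Matrix.SpecialLinearGroup.SL2_inv_expl]; simp
    have e4 : g⁻¹ 1 1 = g 0 0 := by rw [Matrix.SpecialLinearGroup.SL2_inv_expl]; simp
    exact ⟨by rw [e1]; exact g2, by rw [e4]; exact g1, by rw [e2]; exact hb.neg,
      by rw [e3]; exact hc.neg⟩

theorem gammaTwoFree_le : gammaTwoFree ≤ Gamma 2 := by
  rintro g ⟨h1, h2, h3, h4⟩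
  rw [mem_gamma_two_iff]
  exact ⟨Int.odd_iff.2 (by omega), h3, h4, Int.odd_iff.2 (by omega)⟩

theorem mem_gammaTwoFree_or_neg_mem {g : SL(2, ℤ)} (hg : g ∈ Gamma 2) :
    g ∈ gammaTwoFree ∨ -g ∈ gammaTwoFree := by
  obtain ⟨⟨a, ha⟩, hb, hc, ⟨d, hd⟩⟩ := (mem_gamma_two_iff g).1 hg
  have hdet := sl_det_eq g
  obtain ⟨b, hb'⟩ := id hb
  obtain ⟨c, hc'⟩ := id hc
  rw [ha, hb', hc', hd] at hdet
  have e : 2 * (a * d) + a + d = 2 * (b * c) := by linarith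
  rcases Int.even_or_odd' a with ⟨k, hk⟩
  have hn : ∀ i j, (-g) i j = - g i j := fun i j => by simp
  rcases hk with hk | hk
  · left
    refine ⟨?_, ?_, hb, hc⟩ <;> omega
  · right
    refine ⟨?_, ?_, ?_, ?_⟩
    · simp only [hn]; omega
    · simp only [hn]; omega
    · simpa [hn] using hb
    · simpa [hn] using hc

instance : ContinuousConstSMul gammaTwoFree ℍ := ⟨fun g => continuous_sl_smul g⟩

instance : ProperlyDiscontinuousSMul gammaTwoFree ℍ := by
  refine ⟨fun {K L} hK hL => ?_⟩
  have h := ProperlyDiscontinuousSMul.finite_disjoint_inter_image (Γ := 𝒮ℒ) hK hL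
  let F : gammaTwoFree → 𝒮ℒ := fun g => ⟨Matrix.SpecialLinearGroup.mapGL ℝ g.1, g.1, rfl⟩
  have hF : Function.Injective F := by
    intro g g' e
    have := congrArg Subtype.val e
    exact Subtype.ext (Matrix.SpecialLinearGroup.mapGL_injective this)
  exact Set.Finite.preimage (f := F) hF.injOn h

instance : IsCancelSMul gammaTwoFree ℍ := by
  rw [isCancelSMul_iff_eq_one_of_smul_eq]
  rintro ⟨g, hg⟩ z h
  have h' : g • z = z := h
  rcases gammaTwo_eq_of_smul_eq (gammaTwoFree_le hg) h' with rfl | rfl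
  · rfl
  · have := hg.1
    simp at this

/-- `gammaTwoMap` as a map to the twice punctured plane. -/
noncomputable def gammaTwoCover (z : ℍ) : twicePuncturedPlane := ⟨gammaTwoMap z, gammaTwoMap_mem z⟩

theorem continuous_gammaTwoCover : Continuous gammaTwoCover :=
  continuous_gammaTwoMap.subtype_mk _

theorem gammaTwoCover_section (w : twicePuncturedPlane) (hw : 0 ≤ w.1.2) :
    gammaTwoCover (gammaTwoSection w) = w := by
  have h : (1 : SL(2, ℤ)) • gammaTwoSection w ∈ gammaTwoDomain := by
    simpa using gammaTwoSection_mem w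
  refine Subtype.ext ((gammaTwoMap_eq (one_mem _) h).trans ?_)
  rw [one_smul, gammaTwoFold_gammaTwoSection w hw]

theorem gammaTwoCover_section' (w : twicePuncturedPlane) (hw : w.1.2 ≤ 0) :
    gammaTwoCover (gammaTwoSection' w) = w := by
  have h : (1 : SL(2, ℤ)) • gammaTwoSection' w ∈ gammaTwoDomain := by
    simpa using gammaTwoSection'_mem w
  refine Subtype.ext ((gammaTwoMap_eq (one_mem _) h).trans ?_)
  rw [one_smul, gammaTwoFold_gammaTwoSection' w hw]

theorem isQuotientMap_gammaTwoCover : Topology.IsQuotientMap gammaTwoCover := by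
  rw [Topology.isQuotientMap_iff_isClosed]
  refine ⟨fun w => ?_, fun C => ⟨fun h => h.preimage continuous_gammaTwoCover, fun h => ?_⟩⟩
  · rcases le_total 0 w.1.2 with hw | hw
    exacts [⟨_, gammaTwoCover_section w hw⟩, ⟨_, gammaTwoCover_section' w hw⟩]
  · have c : Continuous fun w : twicePuncturedPlane => w.1.2 := by fun_prop
    have e : C = ({w | 0 ≤ w.1.2} ∩ gammaTwoSection ⁻¹' (gammaTwoCover ⁻¹' C)) ∪
        ({w | w.1.2 ≤ 0} ∩ gammaTwoSection' ⁻¹' (gammaTwoCover ⁻¹' C)) := by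
      ext w
      simp only [Set.mem_union, Set.mem_inter_iff, Set.mem_ofPred_eq, Set.mem_preimage]
      constructor
      · intro hw
        rcases le_total 0 w.1.2 with h0 | h0
        · left; exact ⟨h0, by rwa [gammaTwoCover_section w h0]⟩
        · right; exact ⟨h0, by rwa [gammaTwoCover_section' w h0]⟩
      · rintro (⟨h0, h1⟩ | ⟨h0, h1⟩)
        · rwa [gammaTwoCover_section w h0] at h1
        · rwa [gammaTwoCover_section' w h0] at h1
    rw [e]
    exact ((isClosed_le continuous_const c).inter (h.preimage continuous_gammaTwoSection)).union
      ((isClosed_le c continuous_const).inter (h.preimage continuous_gammaTwoSection'))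

theorem isCoveringMap_gammaTwoCover : IsCoveringMap gammaTwoCover := by
  refine (isQuotientMap_gammaTwoCover.isQuotientCoveringMap_of_properlyDiscontinuousSMul
    (G := gammaTwoFree) ?_).isCoveringMap
  intro z w
  rw [MulAction.mem_orbit_iff]
  have h : gammaTwoCover z = gammaTwoCover w ↔ gammaTwoMap w = gammaTwoMap z := by
    rw [eq_comm, gammaTwoCover, gammaTwoCover, Subtype.mk.injEq]
  rw [h, gammaTwoMap_eq_iff]
  constructor
  · rintro ⟨g, hg, e⟩
    rcases mem_gammaTwoFree_or_neg_mem hg with h | h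
    · exact ⟨⟨g, h⟩, e⟩
    · refine ⟨⟨-g, h⟩, ?_⟩
      rw [← e]
      exact ModularGroup.SL_neg_smul g w
  · rintro ⟨g, e⟩
    exact ⟨g, gammaTwoFree_le g.2, e⟩

/-- The affine map sending `(1, 0)` to `a` and `(-1, 0)` to `b`. -/
noncomputable def planeMap (a b w : ℝ × ℝ) : ℝ × ℝ :=
  ((a.1 + b.1) / 2 + (w.1 * (a.1 - b.1) - w.2 * (a.2 - b.2)) / 2,
    (a.2 + b.2) / 2 + (w.1 * (a.2 - b.2) + w.2 * (a.1 - b.1)) / 2)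

/-- The inverse of `planeMap`. -/
noncomputable def planeMapInv (a b v : ℝ × ℝ) : ℝ × ℝ :=
  (((2 * v.1 - (a.1 + b.1)) * (a.1 - b.1) + (2 * v.2 - (a.2 + b.2)) * (a.2 - b.2)) /
    ((a.1 - b.1) ^ 2 + (a.2 - b.2) ^ 2),
   ((2 * v.2 - (a.2 + b.2)) * (a.1 - b.1) - (2 * v.1 - (a.1 + b.1)) * (a.2 - b.2)) /
    ((a.1 - b.1) ^ 2 + (a.2 - b.2) ^ 2))

theorem sq_add_sq_ne_zero_of_ne {a b : ℝ × ℝ} (h : a ≠ b) :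
    (a.1 - b.1) ^ 2 + (a.2 - b.2) ^ 2 ≠ 0 := by
  intro h0
  apply h
  ext <;> nlinarith [sq_nonneg (a.1 - b.1), sq_nonneg (a.2 - b.2)]

theorem planeMap_planeMapInv {a b : ℝ × ℝ} (h : a ≠ b) (v : ℝ × ℝ) :
    planeMap a b (planeMapInv a b v) = v := by
  have := sq_add_sq_ne_zero_of_ne h
  ext <;> simp only [planeMap, planeMapInv] <;> field_simp <;> ring

theorem planeMapInv_planeMap {a b : ℝ × ℝ} (h : a ≠ b) (w : ℝ × ℝ) :
    planeMapInv a b (planeMap a b w) = w := by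
  have := sq_add_sq_ne_zero_of_ne h
  ext <;> simp only [planeMap, planeMapInv] <;> field_simp <;> ring

theorem exists_cover {a b : ℝ × ℝ} (hab : a ≠ b) : ∃ p : ℍ → ℝ × ℝ, Continuous p ∧
    (∀ z, p z ≠ a ∧ p z ≠ b) ∧ (∀ z w, p z = p w ↔ ∃ g ∈ Gamma 2, g • z = w) ∧
    (∀ x, x ≠ a → x ≠ b → ∃ z, p z = x) ∧
    (∀ f : ℝ → ℝ × ℝ, ContinuousOn f (Set.Icc 0 1) →
      (∀ t ∈ Set.Icc (0 : ℝ) 1, f t ≠ a ∧ f t ≠ b) → ∀ z, p z = f 0 →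
      ∃ F : ℝ → ℍ, Continuous F ∧ F 0 = z ∧ ∀ t ∈ Set.Icc (0 : ℝ) 1, p (F t) = f t) := by
  have ea : planeMap a b (1, 0) = a := by ext <;> simp [planeMap] <;> ring
  have eb : planeMap a b (-1, 0) = b := by ext <;> simp [planeMap] <;> ring
  have c1 : Continuous (planeMap a b) := by unfold planeMap; fun_prop
  have c2 : Continuous (planeMapInv a b) := by unfold planeMapInv; fun_prop
  have hl : Function.LeftInverse (planeMapInv a b) (planeMap a b) := planeMapInv_planeMap hab
  have hmem : ∀ v, v ≠ a → v ≠ b → planeMapInv a b v ∈ twicePuncturedPlane := by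
    intro v h1 h2
    constructor
    · intro h
      exact h1 (by rw [← planeMap_planeMapInv hab v, h, ea])
    · intro h
      exact h2 (by rw [← planeMap_planeMapInv hab v, h, eb])
  refine ⟨fun z => planeMap a b (gammaTwoMap z), c1.comp continuous_gammaTwoMap, fun z => ⟨?_, ?_⟩,
    fun z w => ?_, fun x h1 h2 => ?_, fun f hf hfab z hz => ?_⟩
  · intro h
    exact (gammaTwoMap_mem z).1 (hl.injective (h.trans ea.symm))
  · intro h
    exact (gammaTwoMap_mem z).2 (hl.injective (h.trans eb.symm))
  · rw [hl.injective.eq_iff, gammaTwoMap_eq_iff]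
  · obtain ⟨z, hz⟩ := isQuotientMap_gammaTwoCover.surjective ⟨_, hmem x h1 h2⟩
    refine ⟨z, ?_⟩
    have : gammaTwoMap z = planeMapInv a b x := congrArg Subtype.val hz
    change planeMap a b (gammaTwoMap z) = x
    rw [this, planeMap_planeMapInv hab]
  · let γ : C(unitInterval, twicePuncturedPlane) :=
      ⟨fun t => ⟨planeMapInv a b (f t), hmem _ (hfab t t.2).1 (hfab t t.2).2⟩,
        (c2.comp (continuousOn_iff_continuous_domRestrict.1 hf)).subtype_mk _⟩
    have h0 : γ 0 = gammaTwoCover z := by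
      apply Subtype.ext
      change planeMapInv a b (f 0) = gammaTwoMap z
      rw [← hz, hl]
    obtain ⟨G, hG, hG0⟩ := isCoveringMap_gammaTwoCover.exists_path_lifts γ z h0
    refine ⟨Set.IccExtend zero_le_one G, G.continuous.Icc_extend', ?_, ?_⟩
    · rw [Set.IccExtend_left]; exact hG0
    · intro t ht
      rw [Set.IccExtend_of_mem _ _ ht]
      have : gammaTwoMap (G ⟨t, ht⟩) = planeMapInv a b (f t) :=
        congrArg Subtype.val (congrFun hG ⟨t, ht⟩)
      change planeMap a b (gammaTwoMap (G ⟨t, ht⟩)) = f t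
      rw [this, planeMap_planeMapInv hab]

end

section

open scoped MatrixGroups UpperHalfPlane
open CongruenceSubgroup

theorem sl_mul_apply (g h : SL(2, ℤ)) (i j : Fin 2) :
    (g * h) i j = g i 0 * h 0 j + g i 1 * h 1 j := by
  rw [Matrix.SpecialLinearGroup.coe_mul, Matrix.mul_apply, Fin.sum_univ_two]

theorem sl_neg_apply (g : SL(2, ℤ)) (i j : Fin 2) : (-g) i j = - g i j := by simp

theorem sl_inv_apply (g : SL(2, ℤ)) :
    g⁻¹ 0 0 = g 1 1 ∧ g⁻¹ 0 1 = - g 0 1 ∧ g⁻¹ 1 0 = - g 1 0 ∧ g⁻¹ 1 1 = g 0 0 := by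
  refine ⟨?_, ?_, ?_, ?_⟩ <;> rw [Matrix.SpecialLinearGroup.SL2_inv_expl] <;> simp

theorem sl_ext {g h : SL(2, ℤ)} (h1 : g 0 0 = h 0 0) (h2 : g 0 1 = h 0 1) (h3 : g 1 0 = h 1 0)
    (h4 : g 1 1 = h 1 1) : g = h := by
  ext i j; fin_cases i <;> fin_cases j <;> assumption

theorem sl_one_apply : (1 : SL(2, ℤ)) 0 0 = 1 ∧ (1 : SL(2, ℤ)) 0 1 = 0 ∧
    (1 : SL(2, ℤ)) 1 0 = 0 ∧ (1 : SL(2, ℤ)) 1 1 = 1 := by simp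

theorem sl_S_apply : ModularGroup.S 0 0 = 0 ∧ ModularGroup.S 0 1 = -1 ∧
    ModularGroup.S 1 0 = 1 ∧ ModularGroup.S 1 1 = 0 := by simp [ModularGroup.S]

/-- The elementary matrices: upper triangular for `true`, lower triangular for `false`. -/
def slLetter (b : Bool) : SL(2, ℤ) := if b then ModularGroup.T else slLower 1

theorem slLetter_true_apply : slLetter true 0 0 = 1 ∧ slLetter true 0 1 = 1 ∧
    slLetter true 1 0 = 0 ∧ slLetter true 1 1 = 1 := by simp [slLetter, ModularGroup.T]

theorem slLetter_false_apply : slLetter false 0 0 = 1 ∧ slLetter false 0 1 = 0 ∧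
    slLetter false 1 0 = 1 ∧ slLetter false 1 1 = 1 := by simp [slLetter, slLower]

/-- A bi-infinite product `G` of elementary matrices prescribed by the sequence `w`. -/
def IsLetterProduct (w : ℤ → Bool) (G : ℤ → SL(2, ℤ)) : Prop :=
  ∀ s, G (s + 1) = G s * slLetter (w s)

/-- Nonnegativity of all entries. -/
def SLNonneg (g : SL(2, ℤ)) : Prop := 0 ≤ g 0 0 ∧ 0 ≤ g 0 1 ∧ 0 ≤ g 1 0 ∧ 0 ≤ g 1 1

namespace IsLetterProduct

variable {w : ℤ → Bool} {G : ℤ → SL(2, ℤ)} (hG : IsLetterProduct w G)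
include hG

theorem inv_mul_succ (s t : ℤ) : (G s)⁻¹ * G (t + 1) = (G s)⁻¹ * G t * slLetter (w t) := by
  rw [hG t, mul_assoc]

theorem inv_mul_eq (s t : ℤ) : (G s)⁻¹ * G t = slLetter (w s) * ((G (s + 1))⁻¹ * G t) := by
  rw [hG s, mul_inv_rev]; group

theorem nonneg_aux (s : ℤ) (n : ℕ) : SLNonneg ((G s)⁻¹ * G (s + n)) := by
  induction n with
  | zero => simp [SLNonneg]
  | succ n ih =>
    have e : s + ((n + 1 : ℕ) : ℤ) = s + n + 1 := by push_cast; ring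
    rw [e, hG.inv_mul_succ]
    generalize (G s)⁻¹ * G (s + n) = M at ih
    obtain ⟨h1, h2, h3, h4⟩ := ih
    unfold SLNonneg
    simp only [sl_mul_apply]
    cases w (s + n)
    · obtain ⟨a, b, c, d⟩ := slLetter_false_apply
      rw [a, b, c, d]
      refine ⟨?_, ?_, ?_, ?_⟩ <;> linarith
    · obtain ⟨a, b, c, d⟩ := slLetter_true_apply
      rw [a, b, c, d]
      refine ⟨?_, ?_, ?_, ?_⟩ <;> linarith

theorem nonneg {s t : ℤ} (h : s ≤ t) : SLNonneg ((G s)⁻¹ * G t) := by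
  have := hG.nonneg_aux s (t - s).toNat
  rwa [Int.toNat_of_nonneg (by linarith), add_sub_cancel] at this

theorem row_le_of_true {s t : ℤ} (h : s < t) (hs : w s = true) :
    ((G s)⁻¹ * G t) 1 0 ≤ ((G s)⁻¹ * G t) 0 0 ∧ ((G s)⁻¹ * G t) 1 1 ≤ ((G s)⁻¹ * G t) 0 1 := by
  obtain ⟨h1, h2, h3, h4⟩ := hG.nonneg (s := s + 1) (t := t) (by omega)
  rw [hG.inv_mul_eq s t, hs]
  obtain ⟨a, b, c, d⟩ := slLetter_true_apply
  simp only [sl_mul_apply (slLetter true), a, b, c, d]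
  constructor <;> linarith

theorem row_le_of_false {s t : ℤ} (h : s < t) (hs : w s = false) :
    ((G s)⁻¹ * G t) 0 0 ≤ ((G s)⁻¹ * G t) 1 0 ∧ ((G s)⁻¹ * G t) 0 1 ≤ ((G s)⁻¹ * G t) 1 1 := by
  obtain ⟨h1, h2, h3, h4⟩ := hG.nonneg (s := s + 1) (t := t) (by omega)
  rw [hG.inv_mul_eq s t, hs]
  obtain ⟨a, b, c, d⟩ := slLetter_false_apply
  simp only [sl_mul_apply (slLetter false), a, b, c, d]
  constructor <;> linarith

theorem col_le_of_true {s t : ℤ} (h : s < t) (hs : w (t - 1) = true) :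
    ((G s)⁻¹ * G t) 0 0 ≤ ((G s)⁻¹ * G t) 0 1 ∧ ((G s)⁻¹ * G t) 1 0 ≤ ((G s)⁻¹ * G t) 1 1 := by
  obtain ⟨h1, h2, h3, h4⟩ := hG.nonneg (s := s) (t := t - 1) (by omega)
  have e : t - 1 + 1 = t := by ring
  have := hG.inv_mul_succ s (t - 1)
  rw [e, hs] at this
  rw [this]
  obtain ⟨a, b, c, d⟩ := slLetter_true_apply
  simp only [sl_mul_apply _ (slLetter true), a, b, c, d]
  constructor <;> linarith

theorem ne_one {s t : ℤ} (h : s < t) : (G s)⁻¹ * G t ≠ 1 := by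
  intro e
  obtain ⟨a, b, c, d⟩ := sl_one_apply
  cases hs : w s
  · have := hG.row_le_of_false h hs
    rw [e, a, b, c, d] at this
    omega
  · have := hG.row_le_of_true h hs
    rw [e, a, b, c, d] at this
    omega

end IsLetterProduct

theorem SLNonneg.ne_neg {g h : SL(2, ℤ)} (hg : SLNonneg g) (hh : SLNonneg h) : g ≠ -h := by
  intro e
  obtain ⟨a, b, c, d⟩ := hg
  obtain ⟨a', b', c', d'⟩ := hh
  have hd := sl_det_eq h
  rw [e] at a b c d
  simp only [sl_neg_apply] at a b c d
  have h1 : h 0 0 = 0 := by linarith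
  have h2 : h 0 1 = 0 := by linarith
  rw [h1, h2] at hd
  omega

theorem slNonneg_one : SLNonneg 1 := by simp [SLNonneg]

theorem SLNonneg.eq_one_of_inv {g : SL(2, ℤ)} (hg : SLNonneg g) (h : SLNonneg g⁻¹) : g = 1 := by
  obtain ⟨a, b, c, d⟩ := hg
  obtain ⟨a', b', c', d'⟩ := h
  obtain ⟨e1, e2, e3, e4⟩ := sl_inv_apply g
  rw [e2] at b'
  rw [e3] at c'
  rcases eq_one_or_eq_neg_one_of_entries (g := g) (by linarith) (by linarith) with h | h
  · exact h
  · rw [h, sl_neg_apply] at a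
    simp at a

namespace IsLetterProduct

variable {w : ℤ → Bool} {G : ℤ → SL(2, ℤ)} (hG : IsLetterProduct w G)
include hG

theorem eq_of_eq_or_neg {s t : ℤ} (h : G s = G t ∨ G s = -G t) : s = t := by
  by_contra hne
  wlog hlt : s < t generalizing s t
  · refine this ?_ (Ne.symm hne) (by omega)
    rcases h with h | h
    · exact Or.inl h.symm
    · right; rw [h, neg_neg]
  rcases h with h | h
  · exact hG.ne_one hlt (by rw [h]; simp)
  · refine (hG.nonneg hlt.le).ne_neg slNonneg_one ?_
    have e : G t = -G s := by rw [h, neg_neg]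
    rw [e, mul_neg, inv_mul_cancel]

end IsLetterProduct

theorem inv_mul_eq_of_mul_inv_eq {g : Type*} [Group g] {a b c d : g} (h : a * b⁻¹ = c * d⁻¹) :
    a⁻¹ * c = b⁻¹ * d := by
  have e : c = a * b⁻¹ * d := by rw [h]; group
  rw [e]; group

theorem sl_inv_mul_eq_of_mul_inv_eq {a b c d : SL(2, ℤ)}
    (h : a * b⁻¹ = c * d⁻¹ ∨ a * b⁻¹ = -(c * d⁻¹)) :
    a⁻¹ * c = b⁻¹ * d ∨ a⁻¹ * c = -(b⁻¹ * d) := by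
  rcases h with h | h
  · exact Or.inl (inv_mul_eq_of_mul_inv_eq h)
  · right
    rw [← neg_mul] at h
    have := inv_mul_eq_of_mul_inv_eq h
    rw [← this, mul_neg, neg_neg]

theorem SLNonneg.mul {g h : SL(2, ℤ)} (hg : SLNonneg g) (hh : SLNonneg h) : SLNonneg (g * h) := by
  obtain ⟨a, b, c, d⟩ := hg
  obtain ⟨a', b', c', d'⟩ := hh
  simp only [SLNonneg, sl_mul_apply]
  exact ⟨by positivity, by positivity, by positivity, by positivity⟩

theorem sl_rows_ne (g : SL(2, ℤ)) : ¬ (g 0 0 = g 1 0 ∧ g 0 1 = g 1 1) := by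
  rintro ⟨h1, h2⟩
  have hd := sl_det_eq g
  rw [h1, h2] at hd
  linarith

namespace IsLetterProduct

variable {w : ℤ → Bool} {G : ℤ → SL(2, ℤ)} (hG : IsLetterProduct w G)
include hG

/-- Crossings of parallel strands are determined by the relative position. -/
theorem parallel_unique {s t s' t' : ℤ} (h1 : w s ≠ w t) (h2 : w s' ≠ w t')
    (h : G s * (G t)⁻¹ = G s' * (G t')⁻¹ ∨ G s * (G t)⁻¹ = -(G s' * (G t')⁻¹)) :
    s = s' ∧ t = t' := by
  wlog hle : s ≤ s' generalizing s t s' t'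
  · refine (this h2 h1 ?_ (by omega)).imp Eq.symm Eq.symm
    rcases h with h | h
    · exact Or.inl h.symm
    · right; rw [h, neg_neg]
  have key := sl_inv_mul_eq_of_mul_inv_eq h
  have hN := hG.nonneg hle
  rcases lt_trichotomy t t' with htt | htt | htt
  · have hN' := hG.nonneg htt.le
    rcases key with key | key
    · exfalso
      rcases hle.eq_or_lt with rfl | hlt
      · rw [inv_mul_cancel] at key
        exact hG.ne_one htt key.symm
      · cases hs : w s
        · have ht : w t = true := by simpa [hs] using h1
          have a1 := hG.row_le_of_false hlt hs
          have a2 := hG.row_le_of_true htt ht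
          rw [← key] at a2
          exact sl_rows_ne _ ⟨a1.1.antisymm a2.1, a1.2.antisymm a2.2⟩
        · have ht : w t = false := by simpa [hs] using h1
          have a1 := hG.row_le_of_true hlt hs
          have a2 := hG.row_le_of_false htt ht
          rw [← key] at a2
          exact sl_rows_ne _ ⟨a2.1.antisymm a1.1, a2.2.antisymm a1.2⟩
    · exact absurd key (hN.ne_neg hN')
  · subst htt
    rw [inv_mul_cancel] at key
    refine ⟨hG.eq_of_eq_or_neg ?_, rfl⟩
    rcases key with key | key
    · left; rwa [inv_mul_eq_one] at key
    · right; rw [inv_mul_eq_iff_eq_mul] at key; rw [key]; simp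
  · have hN' := hG.nonneg htt.le
    exfalso
    have e : (G t)⁻¹ * G t' = ((G t')⁻¹ * G t)⁻¹ := by group
    rw [e] at key
    rcases key with key | key
    · rw [key] at hN
      exact hG.ne_one htt (hN'.eq_one_of_inv hN)
    · have h3 := hN.mul hN'
      rw [key, neg_mul, inv_mul_cancel] at h3
      exact h3.ne_neg slNonneg_one rfl

/-- Crossings of antiparallel strands are determined by the relative position. -/
theorem antiparallel_unique {s t s' t' : ℤ} (hs : w s = true) (ht : w (t - 1) = true)
    (hs' : w s' = true) (ht' : w (t' - 1) = true)
    (h : G s * ModularGroup.S * (G t)⁻¹ = G s' * ModularGroup.S * (G t')⁻¹ ∨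
      G s * ModularGroup.S * (G t)⁻¹ = -(G s' * ModularGroup.S * (G t')⁻¹)) :
    s = s' ∧ t = t' := by
  wlog hle : s ≤ s' generalizing s t s' t'
  · refine (this hs' ht' hs ht ?_ (by omega)).imp Eq.symm Eq.symm
    rcases h with h | h
    · exact Or.inl h.symm
    · right; rw [h, neg_neg]
  have key := sl_inv_mul_eq_of_mul_inv_eq h
  have hN := hG.nonneg hle
  have key' : ((G s)⁻¹ * G s' * ModularGroup.S = ModularGroup.S * ((G t)⁻¹ * G t')) ∨
      ((G s)⁻¹ * G s' * ModularGroup.S = -(ModularGroup.S * ((G t)⁻¹ * G t'))) := by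
    rcases key with key | key
    · left
      rw [← key]; group
    · right
      rw [← mul_neg, ← key]; group
  obtain ⟨S1, S2, S3, S4⟩ := sl_S_apply
  have key2 : ∃ e : ℤ, (e = 1 ∨ e = -1) ∧
      ((G s)⁻¹ * G s') 0 1 = - e * ((G t)⁻¹ * G t') 1 0 ∧
      ((G s)⁻¹ * G s') 0 0 = e * ((G t)⁻¹ * G t') 1 1 ∧
      ((G s)⁻¹ * G s') 1 1 = e * ((G t)⁻¹ * G t') 0 0 ∧
      ((G s)⁻¹ * G s') 1 0 = - e * ((G t)⁻¹ * G t') 0 1 := by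
    have H : ∀ e : ℤ, (∀ i j, ((G s)⁻¹ * G s' * ModularGroup.S) i j =
        e * (ModularGroup.S * ((G t)⁻¹ * G t')) i j) → 
      ((G s)⁻¹ * G s') 0 1 = - e * ((G t)⁻¹ * G t') 1 0 ∧
      ((G s)⁻¹ * G s') 0 0 = e * ((G t)⁻¹ * G t') 1 1 ∧
      ((G s)⁻¹ * G s') 1 1 = e * ((G t)⁻¹ * G t') 0 0 ∧
      ((G s)⁻¹ * G s') 1 0 = - e * ((G t)⁻¹ * G t') 0 1 := by
      intro e he
      simp only [sl_mul_apply _ ModularGroup.S, sl_mul_apply ModularGroup.S] at he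
      have a1 := he 0 0
      have a2 := he 0 1
      have a3 := he 1 0
      have a4 := he 1 1
      simp only [S1, S2, S3, S4] at a1 a2 a3 a4
      refine ⟨?_, ?_, ?_, ?_⟩ <;> linarith
    rcases key' with k | k
    · exact ⟨1, Or.inl rfl, H 1 fun i j => by rw [k, one_mul]⟩
    · exact ⟨-1, Or.inr rfl, H (-1) fun i j => by rw [k, sl_neg_apply]; ring⟩
  obtain ⟨e, he, b1, b2, b3, b4⟩ := key2
  have hd := sl_det_eq ((G s)⁻¹ * G s')
  have hd' := sl_det_eq ((G t)⁻¹ * G t')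
  have hfin : ((G s)⁻¹ * G s') = 1 → ((G t)⁻¹ * G t') = 1 ∨ ((G t)⁻¹ * G t') = -1 := by
    intro h1
    apply eq_one_or_eq_neg_one_of_entries
    · rw [h1, sl_one_apply.2.2.1] at b4; rcases he with rfl | rfl <;> linarith
    · rw [h1, sl_one_apply.2.1] at b1; rcases he with rfl | rfl <;> linarith
  have hfin' : ((G s)⁻¹ * G s') = 1 → s = s' ∧ t = t' := by
    intro h1
    refine ⟨hG.eq_of_eq_or_neg (Or.inl (inv_mul_eq_one.1 h1)), (hG.eq_of_eq_or_neg ?_).symm⟩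
    rcases hfin h1 with h2 | h2
    · left; exact (inv_mul_eq_one.1 h2).symm
    · right; rw [inv_mul_eq_iff_eq_mul] at h2; rw [h2]; simp
  obtain ⟨n1, n2, n3, n4⟩ := hN
  rcases le_or_gt t t' with htt | htt
  · obtain ⟨m1, m2, m3, m4⟩ := hG.nonneg htt
    apply hfin'
    rcases he with rfl | rfl
    · rcases eq_one_or_eq_neg_one_of_entries (g := (G s)⁻¹ * G s') (by linarith) (by linarith)
        with h1 | h1
      · exact h1
      · rw [h1] at n1; simp at n1
    · exfalso
      have z1 : ((G s)⁻¹ * G s') 0 0 = 0 := by linarith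
      rw [z1] at hd
      nlinarith
  · obtain ⟨m1, m2, m3, m4⟩ := hG.nonneg htt.le
    have hcol := hG.col_le_of_true htt ht
    have hinv : (G t)⁻¹ * G t' = ((G t')⁻¹ * G t)⁻¹ := by group
    obtain ⟨i1, i2, i3, i4⟩ := sl_inv_apply ((G t')⁻¹ * G t)
    rw [hinv] at b1 b2 b3 b4
    rw [i3] at b1
    rw [i4] at b2
    rw [i1] at b3
    rw [i2] at b4
    rcases he with rfl | rfl
    · rcases hle.eq_or_lt with rfl | hlt
      · exact hfin' (by simp)
      · exfalso
        have hrow := hG.row_le_of_true hlt hs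
        exact sl_rows_ne ((G s)⁻¹ * G s') ⟨by linarith, by linarith⟩
    · exfalso
      have z1 : ((G s)⁻¹ * G s') 0 0 = 0 := by linarith
      have z2 : ((G s)⁻¹ * G s') 0 1 = 0 := by linarith
      rw [z1, z2] at hd
      omega

/-- The relative position of antiparallel strands is not a translation of the word. -/
theorem mul_S_ne {s t : ℤ} (h : G s * ModularGroup.S = G t ∨ G s * ModularGroup.S = -G t) :
    False := by
  obtain ⟨S1, S2, S3, S4⟩ := sl_S_apply
  have hN : SLNonneg ModularGroup.S⁻¹ ∨ SLNonneg (-ModularGroup.S) ∨ SLNonneg ModularGroup.S ∨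
    SLNonneg (-ModularGroup.S⁻¹) := by
    rcases le_total s t with hst | hst
    · have := hG.nonneg hst
      rcases h with h | h
      · right; right; left
        rwa [← h, inv_mul_cancel_left] at this
      · right; left
        rwa [show G t = -(G s * ModularGroup.S) by rw [h, neg_neg], mul_neg,
          inv_mul_cancel_left] at this
    · have := hG.nonneg hst
      rcases h with h | h
      · left
        rw [← h] at this
        have e : (G s * ModularGroup.S)⁻¹ * G s = ModularGroup.S⁻¹ := by group
        rwa [e] at this
      · right; right; right
        have e : (G t)⁻¹ * G s = -ModularGroup.S⁻¹ := by
          rw [inv_mul_eq_iff_eq_mul, mul_neg, ← neg_mul, ← h]; group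
        rwa [e] at this
  obtain ⟨i1, i2, i3, i4⟩ := sl_inv_apply ModularGroup.S
  rcases hN with ⟨_, a, b, _⟩ | ⟨_, a, b, _⟩ | ⟨_, a, b, _⟩ | ⟨_, a, b, _⟩
  · rw [i3, S3] at b; omega
  · rw [sl_neg_apply, S3] at b; omega
  · rw [S2] at a; omega
  · rw [sl_neg_apply, i2, S2] at a; omega

end IsLetterProduct

end

section

open scoped MatrixGroups UpperHalfPlane
open CongruenceSubgroup

/-- The linear action of an integral matrix on the real plane. -/
def slVec (g : SL(2, ℤ)) (v : ℝ × ℝ) : ℝ × ℝ :=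
  (g 0 0 * v.1 + g 0 1 * v.2, g 1 0 * v.1 + g 1 1 * v.2)

/-- The cross product of two plane vectors. -/
def planeCross (u v : ℝ × ℝ) : ℝ := u.1 * v.2 - u.2 * v.1

theorem slVec_mul (g h : SL(2, ℤ)) (v : ℝ × ℝ) : slVec (g * h) v = slVec g (slVec h v) := by
  ext <;> simp only [slVec, sl_mul_apply] <;> push_cast <;> ring

theorem slVec_one (v : ℝ × ℝ) : slVec 1 v = v := by simp [slVec]

theorem slVec_smul (g : SL(2, ℤ)) (r : ℝ) (v : ℝ × ℝ) : slVec g (r • v) = r • slVec g v := by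
  ext <;> simp [slVec] <;> ring

theorem planeCross_slVec (g : SL(2, ℤ)) (u v : ℝ × ℝ) :
    planeCross (slVec g u) (slVec g v) = planeCross u v := by
  have hd : (g 0 0 : ℝ) * g 1 1 - g 0 1 * g 1 0 = 1 := by exact_mod_cast sl_det_eq g
  simp only [planeCross, slVec]
  linear_combination (u.1 * v.2 - u.2 * v.1) * hd

theorem exists_eigenvectors {M : SL(2, ℤ)} (h1 : 0 < M 0 0) (h2 : 0 < M 0 1) (h3 : 0 < M 1 0)
    (h4 : 0 < M 1 1) : ∃ (l : ℝ) (p q : ℝ × ℝ), 1 < l ∧ (0 < p.1 ∧ 0 < p.2) ∧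
      (0 < q.1 ∧ q.2 < 0) ∧ slVec M p = l • p ∧ l • slVec M q = q := by
  have hd : (M 0 0 : ℝ) * M 1 1 - M 0 1 * M 1 0 = 1 := by exact_mod_cast sl_det_eq M
  have h1' : (1 : ℝ) ≤ M 0 0 := by exact_mod_cast h1
  have h2' : (1 : ℝ) ≤ M 0 1 := by exact_mod_cast h2
  have h3' : (1 : ℝ) ≤ M 1 0 := by exact_mod_cast h3
  have h4' : (1 : ℝ) ≤ M 1 1 := by exact_mod_cast h4
  simp only [slVec]
  generalize (M 0 0 : ℝ) = a at *
  generalize (M 0 1 : ℝ) = b at *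
  generalize (M 1 0 : ℝ) = c at *
  generalize (M 1 1 : ℝ) = d at *
  have hbc : 1 ≤ b * c := by nlinarith
  have hpos : (a - d) ^ 2 < (a + d) ^ 2 - 4 := by nlinarith
  obtain ⟨s, hs0, hs⟩ : ∃ s : ℝ, 0 ≤ s ∧ s ^ 2 = (a + d) ^ 2 - 4 :=
    ⟨√((a + d) ^ 2 - 4), Real.sqrt_nonneg _, Real.sq_sqrt (by nlinarith [sq_nonneg (a - d)])⟩
  obtain ⟨g1, g2⟩ := abs_lt_of_sq_lt_sq' (hs ▸ hpos) hs0
  have ht : 2 < a + d := by nlinarith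
  refine ⟨(a + d + s) / 2, (b, (a + d + s) / 2 - a), (b, (a + d - s) / 2 - a), by linarith,
    ⟨by simp; linarith, by simp; linarith⟩, ⟨by simp; linarith, by simp; linarith⟩, ?_, ?_⟩
  · ext
    · simp; ring
    · simp; linear_combination - hd - hs / 4
  · ext
    · simp; linear_combination - b / 4 * hs
    · simp; linear_combination (-(a + d + s) / 2) * hd - d / 4 * hs

namespace IsLetterProduct

variable {w : ℤ → Bool} {G : ℤ → SL(2, ℤ)} (hG : IsLetterProduct w G)
include hG

theorem slVec_inv (s : ℤ) (v : ℝ × ℝ) :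
    slVec (G s)⁻¹ v = slVec (slLetter (w s)) (slVec (G (s + 1))⁻¹ v) := by
  rw [← slVec_mul, hG s, mul_inv_rev, mul_inv_cancel_left]

theorem fst_of_true {s : ℤ} (hs : w s = true) (v : ℝ × ℝ) :
    (slVec (G s)⁻¹ v).1 = (slVec (G (s + 1))⁻¹ v).1 + (slVec (G (s + 1))⁻¹ v).2 ∧
    (slVec (G s)⁻¹ v).2 = (slVec (G (s + 1))⁻¹ v).2 := by
  obtain ⟨a, b, c, d⟩ := slLetter_true_apply
  rw [hG.slVec_inv s, hs]
  generalize slVec (G (s + 1))⁻¹ v = u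
  simp only [slVec, a, b, c, d]
  constructor <;> push_cast <;> ring

theorem fst_of_false {s : ℤ} (hs : w s = false) (v : ℝ × ℝ) :
    (slVec (G s)⁻¹ v).1 = (slVec (G (s + 1))⁻¹ v).1 ∧
    (slVec (G s)⁻¹ v).2 = (slVec (G (s + 1))⁻¹ v).1 + (slVec (G (s + 1))⁻¹ v).2 := by
  obtain ⟨a, b, c, d⟩ := slLetter_false_apply
  rw [hG.slVec_inv s, hs]
  generalize slVec (G (s + 1))⁻¹ v = u
  simp only [slVec, a, b, c, d]
  constructor <;> push_cast <;> ring

/-- A periodic letter product containing both letters has an axis whose endpoints are separated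
in each frame. -/
theorem exists_axis {h : SL(2, ℤ)} {N : ℕ} (hN : 0 < N) (hp : ∀ s, G (s + N) = h * G s)
    (hpos : ∀ i j, 0 < ((G 0)⁻¹ * h * G 0) i j) :
    ∃ (l : ℝ) (p q : ℝ × ℝ), 1 < l ∧ slVec h p = l • p ∧ l • slVec h q = q ∧
      (∀ s, 0 < (slVec (G s)⁻¹ p).1 ∧ 0 < (slVec (G s)⁻¹ p).2) ∧
      (∀ s, 0 < (slVec (G s)⁻¹ q).1 ∧ (slVec (G s)⁻¹ q).2 < 0) := by
  obtain ⟨l, p, q, hl, hp0, hq0, hMp, hMq⟩ := exists_eigenvectors (hpos 0 0) (hpos 0 1) (hpos 1 0)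
    (hpos 1 1)
  have e0 : ∀ v, slVec (G 0)⁻¹ (slVec (G 0) v) = v := fun v => by
    rw [← slVec_mul, inv_mul_cancel, slVec_one]
  have eh : ∀ v, slVec h (slVec (G 0) v) = slVec (G 0) (slVec ((G 0)⁻¹ * h * G 0) v) := fun v => by
    rw [← slVec_mul, ← slVec_mul]; congr 1; group
  have hP : slVec h (slVec (G 0) p) = l • slVec (G 0) p := by rw [eh, hMp, slVec_smul]
  have hQ : l • slVec h (slVec (G 0) q) = slVec (G 0) q := by rw [eh, ← slVec_smul, hMq]
  have hl0 : 0 < l := by linarith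
  refine ⟨l, slVec (G 0) p, slVec (G 0) q, hl, hP, hQ, ?_, ?_⟩
  · have hb : 0 < (slVec (G 0)⁻¹ (slVec (G 0) p)).1 ∧ 0 < (slVec (G 0)⁻¹ (slVec (G 0) p)).2 := by
      rw [e0]; exact hp0
    generalize slVec (G 0) p = P at *
    have down : ∀ n : ℕ, 0 < (slVec (G (-n))⁻¹ P).1 ∧ 0 < (slVec (G (-n))⁻¹ P).2 := by
      intro n
      induction n with
      | zero => simpa using hb
      | succ n ih =>
        have e : -((n + 1 : ℕ) : ℤ) + 1 = -n := by push_cast; ring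
        cases hw : w (-((n + 1 : ℕ) : ℤ))
        · obtain ⟨h1, h2⟩ := hG.fst_of_false hw P
          rw [e] at h1 h2
          rw [h1, h2]
          exact ⟨ih.1, add_pos ih.1 ih.2⟩
        · obtain ⟨h1, h2⟩ := hG.fst_of_true hw P
          rw [e] at h1 h2
          rw [h1, h2]
          exact ⟨add_pos ih.1 ih.2, ih.2⟩
    have per : ∀ s, slVec (G s)⁻¹ P = l • slVec (G (s + N))⁻¹ P := by
      intro s
      rw [← slVec_smul, ← hP, ← slVec_mul, hp]; congr 1; group
    have pern : ∀ (n : ℕ) s, slVec (G (s - n * N))⁻¹ P = l ^ n • slVec (G s)⁻¹ P := by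
      intro n
      induction n with
      | zero => simp
      | succ n ih => 
        intro s
        have := per (s - (n + 1 : ℕ) * N)
        rw [this, show s - (n + 1 : ℕ) * (N : ℤ) + N = s - n * N by push_cast; ring, ih, smul_smul,
          pow_succ']
    intro s
    have h1 := pern s.toNat s
    have hle : s - s.toNat * N ≤ 0 := by nlinarith [Int.self_le_toNat s]
    have h2 := down (-(s - s.toNat * N)).toNat
    rw [Int.toNat_of_nonneg (by linarith), neg_neg, h1] at h2
    have hlp : 0 < l ^ s.toNat := by positivity
    simpa [hlp] using h2
  · have hb : 0 < (slVec (G 0)⁻¹ (slVec (G 0) q)).1 ∧ (slVec (G 0)⁻¹ (slVec (G 0) q)).2 < 0 := by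
      rw [e0]; exact hq0
    generalize slVec (G 0) q = Q at *
    have up : ∀ n : ℕ, 0 < (slVec (G n)⁻¹ Q).1 ∧ (slVec (G n)⁻¹ Q).2 < 0 := by
      intro n
      induction n with
      | zero => simpa using hb
      | succ n ih =>
        cases hw : w n
        · obtain ⟨h1, h2⟩ := hG.fst_of_false hw Q
          push_cast
          constructor <;> linarith
        · obtain ⟨h1, h2⟩ := hG.fst_of_true hw Q
          push_cast
          constructor <;> linarith
    have per : ∀ s, l • slVec (G s)⁻¹ Q = slVec (G (s + N))⁻¹ Q := by
      intro s
      rw [hp, mul_inv_rev, slVec_mul, ← slVec_smul]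
      congr 1
      have k := congrArg (slVec h⁻¹) hQ
      rwa [slVec_smul, ← slVec_mul, inv_mul_cancel, slVec_one] at k
    have pern : ∀ (n : ℕ) s, slVec (G (s + n * N))⁻¹ Q = l ^ n • slVec (G s)⁻¹ Q := by
      intro n
      induction n with
      | zero => simp
      | succ n ih => 
        intro s
        have := per (s + n * N)
        rw [ih] at this
        rw [show s + (n + 1 : ℕ) * (N : ℤ) = s + n * N + N by push_cast; ring, ← this, smul_smul,
          pow_succ']
    intro s
    have h1 := pern (-s).toNat s
    have hle : 0 ≤ s + (-s).toNat * N := by nlinarith [Int.self_le_toNat (-s)]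
    have h2 := up (s + (-s).toNat * N).toNat
    rw [Int.toNat_of_nonneg (by linarith), h1] at h2
    have hlp : 0 < l ^ (-s).toNat := by positivity
    simpa [hlp, mul_neg_iff, hlp.le, hlp.not_gt] using h2

end IsLetterProduct

end

section

open scoped MatrixGroups UpperHalfPlane
open CongruenceSubgroup

/-- The curve `γ` is invariant under `h` and crosses its translates by `Γ(2)` in at most `K` ways
modulo the action of `h`. -/
structure CrossBound (γ : ℝ → ℍ) (h : SL(2, ℤ)) (K : ℕ) : Prop where
  continuous : Continuous γ
  mem : h ∈ Gamma 2
  map_add_one : ∀ t, γ (t + 1) = h • γ t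
  card_le : ∀ (F : Finset (ℤ × ℤ)) (c : ℤ × ℤ → SL(2, ℤ)), (∀ i ∈ F, c i ∈ Gamma 2) →
    (∀ i ∈ F, ∃ t u, γ t = c i • γ u) →
    (∀ i ∈ F, ∀ a : ℤ, c i ≠ h ^ a ∧ c i ≠ -h ^ a) →
    (∀ i ∈ F, ∀ j ∈ F, ∀ a b : ℤ, c i = h ^ a * c j * h ^ b ∨ c i = -(h ^ a * c j * h ^ b) →
      i = j) → F.card ≤ K

/-- The strands at positions `s` and `t` part at that place, on different sides than the ones
where they met. -/
def ParallelCross (w : ℤ → Bool) (s t : ℤ) : Prop :=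
  w s ≠ w t ∧ ∃ q : ℕ, (∀ i : ℕ, i < q → w (s - 1 - i) = w (t - 1 - i)) ∧
    w (s - 1 - q) = w t ∧ w (t - 1 - q) = w s

/-- The strands at positions `s` and `t` cross in opposite directions. -/
def AntiparallelCross (w : ℤ → Bool) (s t : ℤ) : Prop :=
  w s = true ∧ w (s - 1) = false ∧ w t = false ∧ w (t - 1) = true

theorem planeCross_slVec_conj (a x b : SL(2, ℤ)) (u v : ℝ × ℝ) :
    planeCross u (slVec (a * x * b⁻¹) v) = planeCross (slVec a⁻¹ u) (slVec x (slVec b⁻¹ v)) := by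
  rw [← planeCross_slVec a⁻¹, ← slVec_mul, ← slVec_mul]
  congr 2
  group

theorem planeCross_swap (u v : ℝ × ℝ) : planeCross u v = - planeCross v u := by
  simp only [planeCross]; ring

theorem slVec_S (v : ℝ × ℝ) : slVec ModularGroup.S v = (-v.2, v.1) := by
  obtain ⟨S1, S2, S3, S4⟩ := sl_S_apply
  simp [slVec, S1, S2, S3, S4]

namespace IsLetterProduct

variable {w : ℤ → Bool} {G : ℤ → SL(2, ℤ)} (hG : IsLetterProduct w G)
include hG

omit hG in
theorem zpow_period {h : SL(2, ℤ)} {N : ℕ} (hp : ∀ s, G (s + N) = h * G s) (s a : ℤ) :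
    G (s + a * N) = h ^ a * G s := by
  induction a using Int.induction_on with
  | zero => simp
  | succ n ih =>
    rw [show s + ((n : ℤ) + 1) * N = s + n * N + N by ring, hp, ih, ← mul_assoc, zpow_add_one,
      (Commute.refl h).zpow_right n |>.eq]
  | pred n ih =>
    have := hp (s + (-(n : ℤ) - 1) * N)
    rw [show s + (-(n : ℤ) - 1) * N + N = s + -n * N by ring, ih] at this
    rw [← inv_mul_eq_iff_eq_mul] at this
    rw [← this, zpow_sub_one, ← mul_assoc, ((Commute.refl h).inv_left.zpow_right (-(n : ℤ))).eq]

theorem period_letter {h : SL(2, ℤ)} {N : ℕ} (hp : ∀ s, G (s + N) = h * G s) (s a : ℤ) :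
    w (s + a * N) = w s := by
  have h1 := hG (s + a * N)
  have e : s + a * N + 1 = s + 1 + a * N := by ring
  rw [e, zpow_period hp, zpow_period hp, hG s, mul_assoc, mul_right_inj, mul_right_inj] at h1
  have h2 := congrArg (fun g : SL(2, ℤ) => g 0 1) h1
  obtain ⟨_, b, _, _⟩ := slLetter_true_apply
  obtain ⟨_, b', _, _⟩ := slLetter_false_apply
  cases h3 : w s <;> cases h4 : w (s + a * N) <;> simp_all

theorem planeCross_back {s t : ℤ} (q : ℕ) (h : ∀ i : ℕ, i < q → w (s - 1 - i) = w (t - 1 - i))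
    (u v : ℝ × ℝ) : planeCross (slVec (G s)⁻¹ u) (slVec (G t)⁻¹ v) =
      planeCross (slVec (G (s - q))⁻¹ u) (slVec (G (t - q))⁻¹ v) := by
  induction q with
  | zero => simp
  | succ n ih =>
    rw [ih fun i hi => h i (by omega)]
    have h1 := h n (by omega)
    rw [hG.slVec_inv (s - (n + 1 : ℕ)), hG.slVec_inv (t - (n + 1 : ℕ)),
      show s - ((n + 1 : ℕ) : ℤ) = s - 1 - n by push_cast; ring,
      show t - ((n + 1 : ℕ) : ℤ) = t - 1 - n by push_cast; ring, h1, planeCross_slVec]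
    congr 5 <;> ring

variable {h : SL(2, ℤ)} {p q : ℝ × ℝ}
  (hP : ∀ s, 0 < (slVec (G s)⁻¹ p).1 ∧ 0 < (slVec (G s)⁻¹ p).2)
  (hQ : ∀ s, 0 < (slVec (G s)⁻¹ q).1 ∧ (slVec (G s)⁻¹ q).2 < 0)
include hP hQ

theorem parallel_cross_sign {s t : ℤ} (hst : ParallelCross w s t) :
    0 < planeCross (slVec (G s)⁻¹ p) (slVec (G t)⁻¹ p) *
      planeCross (slVec (G s)⁻¹ q) (slVec (G t)⁻¹ q) := by
  obtain ⟨hne, n, hn, h1, h2⟩ := hst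
  wlog hs : w s = true generalizing s t
  · rw [planeCross_swap _ (slVec (G t)⁻¹ p), planeCross_swap _ (slVec (G t)⁻¹ q), neg_mul_neg]
    refine this hne.symm (fun i hi => (hn i hi).symm) h2 h1 ?_
    cases ht : w t
    · simp_all
    · rfl
  have ht : w t = false := by simpa [hs] using hne
  rw [hG.planeCross_back n hn q q]
  have hP1 := hP (s + 1)
  have hP2 := hP (t + 1)
  have hQ1 := hQ (s - 1 - n)
  have hQ2 := hQ (t - 1 - n)
  have hQ3 := hQ (s - n)
  have hQ4 := hQ (t - n)
  have e1 : s - 1 - n + 1 = s - n := by ring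
  have e2 : t - 1 - n + 1 = t - n := by ring
  rw [hs] at h2
  rw [ht] at h1
  obtain ⟨a1, a2⟩ := hG.fst_of_true hs p
  obtain ⟨b1, b2⟩ := hG.fst_of_false ht p
  obtain ⟨c1, c2⟩ := hG.fst_of_false h1 q
  obtain ⟨d1, d2⟩ := hG.fst_of_true h2 q
  rw [e1] at c1 c2
  rw [e2] at d1 d2
  rw [c1, c2] at hQ1
  rw [d1, d2] at hQ2
  apply mul_pos
  · simp only [planeCross, a1, a2, b1, b2]
    nlinarith only [mul_pos hP1.1 hP2.1, mul_pos hP1.1 hP2.2, mul_pos hP1.2 hP2.2]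
  · simp only [planeCross]
    nlinarith only [mul_pos hQ3.1 hQ2.1, mul_pos hQ4.1 (neg_pos.2 hQ1.2)]

theorem antiparallel_cross_sign {s t : ℤ} (hst : AntiparallelCross w s t) :
    0 < planeCross (slVec (G s)⁻¹ p) (slVec ModularGroup.S (slVec (G t)⁻¹ p)) ∧
    0 < planeCross (slVec (G s)⁻¹ q) (slVec ModularGroup.S (slVec (G t)⁻¹ q)) ∧
    0 < planeCross (slVec (G s)⁻¹ p) (slVec ModularGroup.S (slVec (G t)⁻¹ q)) ∧
    planeCross (slVec (G s)⁻¹ q) (slVec ModularGroup.S (slVec (G t)⁻¹ p)) < 0 := by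
  obtain ⟨hs, hs', ht, ht'⟩ := hst
  have hP1 := hP (s + 1)
  have hP2 := hP (t + 1)
  have hQ1 := hQ (s - 1)
  have hQ2 := hQ (t - 1)
  have hP3 := hP s
  have hP4 := hP t
  have hQ3 := hQ s
  have hQ4 := hQ t
  obtain ⟨a1, a2⟩ := hG.fst_of_true hs p
  obtain ⟨b1, b2⟩ := hG.fst_of_false ht p
  obtain ⟨c1, c2⟩ := hG.fst_of_false hs' q
  obtain ⟨d1, d2⟩ := hG.fst_of_true ht' q
  rw [sub_add_cancel] at c1 c2 d1 d2
  simp only [planeCross, slVec_S]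
  generalize slVec (G s)⁻¹ p = ps at *
  generalize slVec (G t)⁻¹ p = pt at *
  generalize slVec (G s)⁻¹ q = qs at *
  generalize slVec (G t)⁻¹ q = qt at *
  have k1 : ps.2 < ps.1 := by linarith
  have k2 : pt.1 < pt.2 := by linarith
  have k3 : 0 < -(qs.1 + qs.2) := by linarith
  have k4 : 0 < qt.1 + qt.2 := by linarith
  refine ⟨?_, ?_, ?_, ?_⟩
  · nlinarith only [mul_pos hP3.1 hP4.1, mul_pos hP3.2 hP4.2]
  · nlinarith only [mul_pos hQ3.1 hQ4.1, mul_pos_of_neg_of_neg hQ3.2 hQ4.2]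
  · nlinarith only [mul_pos (sub_pos.2 k1) hQ4.1, mul_pos hP3.1 k4, mul_pos hP3.2 k4]
  · nlinarith only [mul_pos hQ3.1 (sub_pos.2 k2), mul_pos k3 hP4.2, mul_pos k3 hP4.1]

omit hG hP hQ in
/-- A crossing axis condition forces the curve to meet its translate. -/
theorem exists_meet {K : ℕ} {γ : ℝ → ℍ} (hγ : CrossBound γ h K) {l : ℝ} (hl : 1 < l)
    (hp : slVec h p = l • p) (hq : l • slVec h q = q) (hpq : planeCross p q ≠ 0)
    (c : SL(2, ℤ)) (hc : planeCross p (slVec c p) * planeCross p (slVec c q) *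
      planeCross q (slVec c p) * planeCross q (slVec c q) < 0) :
    ∃ t u, γ t = c • γ u :=
  exists_eq_smul_of_linked hγ.continuous hγ.map_add_one c (l := l) (by nlinarith)
    (congrArg Prod.fst hp) (congrArg Prod.snd hp) (congrArg Prod.fst hq) (congrArg Prod.snd hq)
    hpq hc

omit hP hQ

variable {K N : ℕ} {γ : ℝ → ℍ} (hγ : CrossBound γ h K) (hN : 0 < N)
  (hp : ∀ s, G (s + N) = h * G s) (hpos : ∀ i j, 0 < ((G 0)⁻¹ * h * G 0) i j)
include hγ hN hp hpos

theorem card_parallel_le (F : Finset (ℤ × ℤ))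
    (hF : ∀ x ∈ F, ParallelCross w x.1 x.2 ∧ G x.1 * (G x.2)⁻¹ ∈ Gamma 2)
    (hinj : ∀ x ∈ F, ∀ y ∈ F, (N : ℤ) ∣ x.1 - y.1 → (N : ℤ) ∣ x.2 - y.2 → x = y) :
    F.card ≤ K := by
  obtain ⟨l, p, q, hl, hp1, hq1, hP, hQ⟩ := hG.exists_axis hN hp hpos
  have hpq : planeCross p q < 0 := by
    rw [← planeCross_slVec (G 0)⁻¹, planeCross]
    nlinarith [mul_pos (hP 0).1 (neg_pos.2 (hQ 0).2), mul_pos (hP 0).2 (hQ 0).1]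
  refine hγ.card_le F (fun x => G x.1 * (G x.2)⁻¹) (fun x hx => (hF x hx).2) (fun x hx => ?_)
    (fun x hx a => ?_) (fun x hx y hy a b e => ?_)
  · refine exists_meet hγ hl hp1 hq1 hpq.ne _ ?_
    have h1 := hG.parallel_cross_sign hP hQ (hF x hx).1
    have k : ∀ u v, planeCross u (slVec (G x.1 * (G x.2)⁻¹) v) =
        planeCross (slVec (G x.1)⁻¹ u) (slVec (G x.2)⁻¹ v) := by
      intro u v
      have := planeCross_slVec_conj (G x.1) 1 (G x.2) u v
      rwa [mul_one, slVec_one] at this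
    rw [k, k, k, k]
    have h2 : planeCross (slVec (G x.1)⁻¹ p) (slVec (G x.2)⁻¹ q) < 0 := by
      rw [planeCross]
      nlinarith only [mul_pos (hP x.1).1 (neg_pos.2 (hQ x.2).2), mul_pos (hP x.1).2 (hQ x.2).1]
    have h3 : 0 < planeCross (slVec (G x.1)⁻¹ q) (slVec (G x.2)⁻¹ p) := by
      rw [planeCross]
      nlinarith only [mul_pos (hP x.2).1 (neg_pos.2 (hQ x.1).2), mul_pos (hP x.2).2 (hQ x.1).1]
    nlinarith only [mul_pos h1 (mul_pos (neg_pos.2 h2) h3)]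
  · have key : ∀ b : ℤ, ¬ (G x.1 = G (x.2 + b * N) ∨ G x.1 = - G (x.2 + b * N)) := by
      intro b hb
      have := hG.eq_of_eq_or_neg hb
      apply (hF x hx).1.1
      rw [this, hG.period_letter hp]
    have := key a
    rw [zpow_period hp, ← mul_inv_eq_iff_eq_mul, ← neg_mul, ← mul_inv_eq_iff_eq_mul] at this
    tauto
  · have e' : G x.1 * (G x.2)⁻¹ = G (y.1 + a * N) * (G (y.2 + (-b) * N))⁻¹ ∨
        G x.1 * (G x.2)⁻¹ = -(G (y.1 + a * N) * (G (y.2 + (-b) * N))⁻¹) := by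
      rw [zpow_period hp, zpow_period hp]
      have e2 : h ^ a * G y.1 * (h ^ (-b) * G y.2)⁻¹ = h ^ a * (G y.1 * (G y.2)⁻¹) * h ^ b := by
        group
      rwa [e2]
    obtain ⟨h1, h2⟩ := hG.parallel_unique (hF x hx).1.1
      (by rw [hG.period_letter hp, hG.period_letter hp]; exact (hF y hy).1.1) e'
    exact hinj x hx y hy ⟨a, by rw [h1]; ring⟩ ⟨-b, by rw [h2]; ring⟩

theorem card_antiparallel_le (F : Finset (ℤ × ℤ))
    (hF : ∀ x ∈ F, AntiparallelCross w x.1 x.2 ∧ G x.1 * ModularGroup.S * (G x.2)⁻¹ ∈ Gamma 2)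
    (hinj : ∀ x ∈ F, ∀ y ∈ F, (N : ℤ) ∣ x.1 - y.1 → (N : ℤ) ∣ x.2 - y.2 → x = y) :
    F.card ≤ K := by
  obtain ⟨l, p, q, hl, hp1, hq1, hP, hQ⟩ := hG.exists_axis hN hp hpos
  have hpq : planeCross p q < 0 := by
    rw [← planeCross_slVec (G 0)⁻¹, planeCross]
    nlinarith [mul_pos (hP 0).1 (neg_pos.2 (hQ 0).2), mul_pos (hP 0).2 (hQ 0).1]
  refine hγ.card_le F (fun x => G x.1 * ModularGroup.S * (G x.2)⁻¹) (fun x hx => (hF x hx).2)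
    (fun x hx => ?_) (fun x hx a => ?_) (fun x hx y hy a b e => ?_)
  · refine exists_meet hγ hl hp1 hq1 hpq.ne _ ?_
    obtain ⟨h1, h2, h3, h4⟩ := hG.antiparallel_cross_sign hP hQ (hF x hx).1
    simp only [planeCross_slVec_conj]
    nlinarith only [mul_pos (mul_pos h1 h2) (mul_pos h3 (neg_pos.2 h4))]
  · have key := fun b : ℤ => hG.mul_S_ne (s := x.1) (t := x.2 + b * N)
    have := key a
    rw [zpow_period hp, ← mul_inv_eq_iff_eq_mul, ← neg_mul, ← mul_inv_eq_iff_eq_mul] at this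
    tauto
  · have e' : G x.1 * ModularGroup.S * (G x.2)⁻¹ =
          G (y.1 + a * N) * ModularGroup.S * (G (y.2 + (-b) * N))⁻¹ ∨
        G x.1 * ModularGroup.S * (G x.2)⁻¹ =
          -(G (y.1 + a * N) * ModularGroup.S * (G (y.2 + (-b) * N))⁻¹) := by
      rw [zpow_period hp, zpow_period hp]
      have e2 : h ^ a * G y.1 * ModularGroup.S * (h ^ (-b) * G y.2)⁻¹ =
          h ^ a * (G y.1 * ModularGroup.S * (G y.2)⁻¹) * h ^ b := by
        group
      rwa [e2]
    have hy' := (hF y hy).1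
    have e3 : y.2 + -b * N - 1 = y.2 - 1 + -b * N := by ring
    obtain ⟨h1, h2⟩ := hG.antiparallel_unique (hF x hx).1.1 (hF x hx).1.2.2.2
      (by rw [hG.period_letter hp]; exact hy'.1)
      (by rw [e3, hG.period_letter hp]; exact hy'.2.2.2) e'
    exact hinj x hx y hy ⟨a, by rw [h1]; ring⟩ ⟨-b, by rw [h2]; ring⟩

end IsLetterProduct

end

theorem sum_one_div_sq_le_two (M : ℕ) : ∑ t ∈ Finset.range M, 1 / ((t : ℝ) + 1) ^ 2 ≤ 2 - 1 / (M : ℝ) := by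
  induction M with
  | zero => simp
  | succ n ih =>
    rw [Finset.sum_range_succ]
    rcases Nat.eq_zero_or_pos n with rfl | hn
    · norm_num
    · have hn' : (0 : ℝ) < n := by exact_mod_cast hn
      have : 1 / ((n : ℝ) + 1) ^ 2 ≤ 1 / n - 1 / ((n + 1 : ℕ) : ℝ) := by
        push_cast
        rw [div_sub_div _ _ hn'.ne' (by positivity), div_le_div_iff₀ (by positivity) (by positivity)]
        nlinarith
      linarith

theorem log_one_add_le_sum (b : ℕ) :
    Real.log (1 + b) ≤ ∑ t ∈ Finset.range b, 1 / ((t : ℝ) + 1) := by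
  have h := log_add_one_le_harmonic b
  rw [harmonic] at h
  push_cast at h
  simpa [add_comm] using h

/-- A family of logarithms is controlled by the sum of all pairwise minima. -/
theorem sum_log_one_add_le {ι : Type*} (I : Finset ι) (b : ι → ℕ) {K : ℕ} (hK : 1 ≤ K)
    (h : ∑ i ∈ I, ∑ j ∈ I, min (b i) (b j) ≤ K) :
    ∑ i ∈ I, Real.log (1 + b i) ≤ 2 * √K := by
  have hs : 0 < √(K : ℝ) := Real.sqrt_pos.2 (by exact_mod_cast hK)
  set M := I.sup b with hM
  have hbM : ∀ i ∈ I, b i ≤ M := fun i hi => Finset.le_sup hi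
  let c : ι → ℕ → ℝ := fun i t => if t < b i then 1 else 0
  have e1 : ∀ i ∈ I, ∑ t ∈ Finset.range (b i), 1 / ((t : ℝ) + 1) =
      ∑ t ∈ Finset.range M, c i t * (1 / ((t : ℝ) + 1)) := by
    intro i hi
    simp only [c, ite_mul, one_mul, zero_mul]
    rw [← Finset.sum_filter]
    congr 1
    ext t
    have := hbM i hi
    simp only [Finset.mem_range, Finset.mem_filter]
    omega
  have e2 : ∀ i ∈ I, ∀ j ∈ I, ∑ t ∈ Finset.range M, c i t * c j t = ((min (b i) (b j) : ℕ) : ℝ) := by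
    intro i hi j hj
    have : ∀ t, c i t * c j t = if t < min (b i) (b j) then 1 else 0 := by
      intro t
      simp only [c, lt_min_iff]
      split_ifs <;> simp_all
    simp only [this]
    rw [← Finset.sum_filter, Finset.sum_const, nsmul_eq_mul, mul_one]
    congr 1
    have hr : {t ∈ Finset.range M | t < min (b i) (b j)} = Finset.range (min (b i) (b j)) := by
      ext t
      have := hbM i hi
      simp only [Finset.mem_range, Finset.mem_filter]
      omega
    rw [hr, Finset.card_range]
  have e3 : ∑ t ∈ Finset.range M, (∑ i ∈ I, c i t) ^ 2 ≤ K := by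
    have : ∑ t ∈ Finset.range M, (∑ i ∈ I, c i t) ^ 2 =
        ((∑ i ∈ I, ∑ j ∈ I, min (b i) (b j) : ℕ) : ℝ) := by
      simp only [sq, Finset.sum_mul_sum]
      rw [Finset.sum_comm]
      push_cast
      refine Finset.sum_congr rfl fun i hi => ?_
      rw [Finset.sum_comm]
      refine Finset.sum_congr rfl fun j hj => ?_
      rw [e2 i hi j hj]; push_cast; rfl
    rw [this]
    exact_mod_cast h
  calc ∑ i ∈ I, Real.log (1 + b i)
      ≤ ∑ i ∈ I, ∑ t ∈ Finset.range M, c i t * (1 / ((t : ℝ) + 1)) :=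
        Finset.sum_le_sum fun i hi => (log_one_add_le_sum (b i)).trans_eq (e1 i hi)
    _ = ∑ t ∈ Finset.range M, (∑ i ∈ I, c i t) * (1 / ((t : ℝ) + 1)) := by
        rw [Finset.sum_comm]
        simp only [Finset.sum_mul]
    _ ≤ ∑ t ∈ Finset.range M, ((∑ i ∈ I, c i t) ^ 2 * (1 / (2 * √K)) +
          √K / 2 * (1 / ((t : ℝ) + 1) ^ 2)) := by
        refine Finset.sum_le_sum fun t _ => ?_
        generalize ∑ i ∈ I, c i t = x
        have ht : (0 : ℝ) < t + 1 := by positivity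
        have := sq_nonneg (x / √K - 1 / (t + 1))
        have e : x ^ 2 * (1 / (2 * √K)) + √K / 2 * (1 / ((t : ℝ) + 1) ^ 2) -
            x * (1 / ((t : ℝ) + 1)) = √K / 2 * (x / √K - 1 / (t + 1)) ^ 2 := by
          field_simp
          ring
        nlinarith [mul_nonneg hs.le this]
    _ ≤ 2 * √K := by
        rw [Finset.sum_add_distrib, ← Finset.sum_mul, ← Finset.mul_sum]
        have h1 := sum_one_div_sq_le_two M
        have h2 : (0 : ℝ) ≤ 1 / M := by positivity
        have h3 : (∑ t ∈ Finset.range M, (∑ i ∈ I, c i t) ^ 2) * (1 / (2 * √K)) ≤ √K / 2 := by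
          rw [mul_one_div, div_le_iff₀ (by positivity)]
          calc _ ≤ (K : ℝ) := e3
            _ = √K / 2 * (2 * √K) := by
              have := Real.mul_self_sqrt (Nat.cast_nonneg (α := ℝ) K)
              linarith
        nlinarith

section

open scoped MatrixGroups UpperHalfPlane
open CongruenceSubgroup

/-- Reduction modulo two. -/
def modTwo : SL(2, ℤ) →* SL(2, ZMod 2) :=
  Matrix.SpecialLinearGroup.map (Int.castRingHom (ZMod 2))

theorem mul_inv_mem_gamma_two_iff {g h : SL(2, ℤ)} :
    g * h⁻¹ ∈ Gamma 2 ↔ modTwo g = modTwo h := by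
  rw [Gamma_mem', ← mul_inv_eq_one (a := modTwo g), ← map_inv, ← map_mul]
  rfl

theorem modTwo_slLetter_false : modTwo (slLetter false) = slTwoS * slTwoT * slTwoS := by
  ext i j; fin_cases i <;> fin_cases j <;> decide

theorem modTwo_slLetter_true : modTwo (slLetter true) = slTwoT := map_T_zmod_two

theorem modTwo_S : modTwo ModularGroup.S = slTwoS := map_S_zmod_two

theorem modTwo_slLetter_sq (b : Bool) : modTwo (slLetter b) ^ 2 = 1 := by
  cases b
  · rw [modTwo_slLetter_false]; decide
  · rw [modTwo_slLetter_true]; decide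

theorem modTwo_slLetter_mul_mul :
    modTwo (slLetter true) * modTwo (slLetter false) * modTwo (slLetter true) = slTwoS := by
  rw [modTwo_slLetter_false, modTwo_slLetter_true]; decide

/-- The length of the block of equal letters which ends at boundary `s`, counted from boundary
`0`. -/
def runLen (w : ℤ → Bool) : ℕ → ℕ
  | 0 => 0
  | s + 1 => if w s = w (s - 1) then runLen w s + 1 else 1

theorem runLen_spec {w : ℤ → Bool} (h0 : w 0 ≠ w (-1)) (s : ℕ) :
    1 ≤ runLen w (s + 1) ∧ runLen w (s + 1) ≤ s + 1 ∧
    (∀ i : ℤ, 0 ≤ i → i < runLen w (s + 1) → w (s - i) = w s) ∧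
    w (s - runLen w (s + 1)) ≠ w s := by
  induction s with
  | zero =>
    have : runLen w (0 + 1) = 1 := by
      rw [runLen, if_neg]; simpa using h0
    rw [this]
    refine ⟨le_rfl, le_rfl, fun i hi hi' => ?_, by simpa using h0.symm⟩
    have : i = 0 := by push_cast at hi'; omega
    simp [this]
  | succ s ih =>
    rw [runLen]
    have e : (((s + 1 : ℕ) : ℤ) - 1) = s := by push_cast; ring
    split_ifs with h
    · rw [e] at h
      obtain ⟨a1, a2, a3, a4⟩ := ih
      refine ⟨by omega, by omega, fun i hi hi' => ?_, ?_⟩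
      · rcases hi.eq_or_lt with rfl | hi
        · simp
        · rw [h, ← a3 (i - 1) (by omega) (by push_cast at hi'; omega)]
          congr 1; push_cast; ring
      · rw [h]
        convert a4 using 2
        push_cast; ring
    · rw [e] at h
      refine ⟨le_rfl, by omega, fun i hi hi' => ?_, ?_⟩
      · have : i = 0 := by push_cast at hi'; omega
        simp [this]
      · rw [Nat.cast_one, e]; exact fun e => h e.symm

/-- The boundaries in one period at which a block of letters `x` ends. -/
def runEnds (w : ℤ → Bool) (N : ℕ) (x : Bool) : Finset ℕ :=
  (Finset.Icc 1 N).filter fun v => w (v - 1) = x ∧ w v ≠ x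

section runs

variable {w : ℤ → Bool} {N : ℕ} {x : Bool} (h0 : w 0 ≠ w (-1))
include h0

theorem mem_runEnds_spec {v : ℕ} (hv : v ∈ runEnds w N x) :
    1 ≤ v ∧ v ≤ N ∧ w (v - 1) = x ∧ w v ≠ x ∧ 1 ≤ runLen w v ∧ runLen w v ≤ v ∧
    (∀ p : ℤ, v - runLen w v ≤ p → p < v → w p = x) ∧ w (v - runLen w v - 1) ≠ x := by
  simp only [runEnds, Finset.mem_filter, Finset.mem_Icc] at hv
  obtain ⟨⟨h1, h2⟩, h3, h4⟩ := hv
  obtain ⟨s, rfl⟩ : ∃ s, v = s + 1 := ⟨v - 1, by omega⟩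
  have e : (((s + 1 : ℕ) : ℤ) - 1) = s := by push_cast; ring
  rw [e] at h3
  obtain ⟨a1, a2, a3, a4⟩ := runLen_spec h0 s
  rw [h3] at a3 a4
  refine ⟨h1, h2, by rw [e, h3], h4, a1, a2, fun p hp hp' => ?_, ?_⟩
  · rw [← a3 (s - p) (by push_cast at hp'; omega) (by push_cast at hp; omega)]
    congr 1; ring
  · convert a4 using 2
    push_cast; ring

theorem runEnds_unique {v v' : ℕ} (hv : v ∈ runEnds w N x) (hv' : v' ∈ runEnds w N x) {p : ℤ}
    (h1 : v - runLen w v ≤ p) (h2 : p < v) (h3 : v' - runLen w v' ≤ p) (h4 : p < v') : v = v' := by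
  obtain ⟨-, -, -, a, -, -, b, -⟩ := mem_runEnds_spec h0 hv
  obtain ⟨-, -, -, a', -, -, b', -⟩ := mem_runEnds_spec h0 hv'
  rcases lt_trichotomy v v' with h | h | h
  · exact absurd (b' v (by omega) (by omega)) a
  · exact h
  · exact absurd (b v' (by omega) (by omega)) a'

theorem sub_runLen_injOn : Set.InjOn (fun v => v - runLen w v) (runEnds w N x) := by
  intro v hv v' hv' h
  have a := mem_runEnds_spec h0 hv
  have a' := mem_runEnds_spec h0 hv'
  simp only at h
  exact runEnds_unique h0 hv hv' (p := (v - runLen w v : ℕ)) (by omega) (by omega) (by omega)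
    (by omega)

theorem sub_runLen_mem {v : ℕ} (hv : v ∈ runEnds w N x) (h : v - runLen w v ≠ 0) :
    v - runLen w v ∈ runEnds w N (!x) := by
  obtain ⟨a1, a2, a3, a4, a5, a6, a7, a8⟩ := mem_runEnds_spec h0 hv
  simp only [runEnds, Finset.mem_filter, Finset.mem_Icc]
  have e : ((v - runLen w v : ℕ) : ℤ) = v - runLen w v := by omega
  rw [e]
  refine ⟨by omega, ?_, ?_⟩
  · cases x <;> simpa using a8
  · rw [a7 _ le_rfl (by omega)]; simp

end runs

namespace IsLetterProduct

variable {w : ℤ → Bool} {G : ℤ → SL(2, ℤ)} (hG : IsLetterProduct w G)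
include hG

theorem modTwo_run (s : ℤ) (x : Bool) (n : ℕ) (h : ∀ p : ℤ, s ≤ p → p < s + n → w p = x) :
    modTwo (G (s + n)) = modTwo (G s) * modTwo (slLetter x) ^ n := by
  induction n with
  | zero => simp
  | succ n ih =>
    rw [Nat.cast_succ, ← add_assoc, hG, map_mul, ih fun p h1 h2 => h p h1 (by push_cast; omega),
      h (s + n) (by omega) (by push_cast; omega), pow_succ, mul_assoc]

theorem modTwo_run_even {s t : ℤ} {x : Bool} (hst : s ≤ t) (he : Even (t - s))
    (h : ∀ p : ℤ, s ≤ p → p < t → w p = x) : modTwo (G s) = modTwo (G t) := by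
  obtain ⟨n, hn⟩ := he
  obtain ⟨m, rfl⟩ : ∃ m : ℕ, n = m := ⟨n.toNat, by omega⟩
  have e : t = s + (2 * m : ℕ) := by push_cast; omega
  rw [e, hG.modTwo_run s x (2 * m) (by rwa [← e]), pow_mul, modTwo_slLetter_sq, one_pow, mul_one]

theorem modTwo_run_odd {s t : ℤ} {x : Bool} (hst : s ≤ t) (he : Odd (t - s))
    (h : ∀ p : ℤ, s ≤ p → p < t → w p = x) :
    modTwo (G t) = modTwo (G s) * modTwo (slLetter x) := by
  obtain ⟨n, hn⟩ := he
  obtain ⟨m, rfl⟩ : ∃ m : ℕ, n = m := ⟨n.toNat, by omega⟩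
  have e : t = s + (2 * m + 1 : ℕ) := by push_cast; omega
  rw [e, hG.modTwo_run s x (2 * m + 1) (by rwa [← e]), pow_succ, pow_mul, modTwo_slLetter_sq,
    one_pow, one_mul]

/-- The product of the lengths of the blocks which end in `[1, s]`, each increased by one. -/
def runProd (w : ℤ → Bool) (s : ℕ) : ℕ :=
  ∏ e ∈ Finset.range s, if w ((e : ℤ) + 1) ≠ w e then 1 + runLen w (e + 1) else 1

omit hG in
theorem runProd_succ (s : ℕ) : runProd w (s + 1) =
    runProd w s * if w ((s : ℤ) + 1) ≠ w s then 1 + runLen w (s + 1) else 1 := by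
  rw [runProd, Finset.prod_range_succ]; rfl

theorem columns_le (h0 : w (-1) = false) (h1 : w 0 = true) (s : ℕ) :
    (if w s then ((G 0)⁻¹ * G (s + 1)) 0 0 + ((G 0)⁻¹ * G (s + 1)) 1 0
      else ((G 0)⁻¹ * G (s + 1)) 0 1 + ((G 0)⁻¹ * G (s + 1)) 1 1) ≤ runProd w s ∧
    (if w s then ((G 0)⁻¹ * G (s + 1)) 0 1 + ((G 0)⁻¹ * G (s + 1)) 1 1
      else ((G 0)⁻¹ * G (s + 1)) 0 0 + ((G 0)⁻¹ * G (s + 1)) 1 0) ≤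
      runProd w s * (1 + runLen w (s + 1)) := by
  obtain ⟨T1, T2, T3, T4⟩ := slLetter_true_apply
  obtain ⟨L1, L2, L3, L4⟩ := slLetter_false_apply
  induction s with
  | zero =>
    have := hG.inv_mul_succ 0 0
    simp only [inv_mul_cancel, one_mul, h1] at this
    rw [Nat.cast_zero, this, h1, if_pos rfl, if_pos rfl, T1, T2, T3, T4]
    simp [h1, runProd, runLen, h0]
  | succ s ih =>
    have e := hG.inv_mul_succ 0 ((s : ℤ) + 1)
    have hb : runLen w (s + 1 + 1) =
        if w ((s : ℤ) + 1) = w s then runLen w (s + 1) + 1 else 1 := by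
      rw [runLen]; push_cast; simp
    rw [hb, runProd_succ]
    have hPb : (0 : ℤ) ≤ runProd w s * runLen w (s + 1) := by positivity
    push_cast
    generalize (G 0)⁻¹ * G ((s : ℤ) + 1) = M at *
    generalize (G 0)⁻¹ * G ((s : ℤ) + 1 + 1) = M' at *
    generalize (runProd w s : ℤ) = P at *
    generalize (runLen w (s + 1) : ℤ) = b at *
    simp only [e, sl_mul_apply]
    cases h : w s <;> cases h' : w ((s : ℤ) + 1) <;>
      simp only [h, T1, T2, T3, T4, L1, L2, L3, L4, if_true, if_false, Bool.false_eq_true,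
        ne_eq, not_true, not_false_eq_true, reduceCtorEq, mul_one, mul_zero, add_zero, zero_add]
        at ih ⊢ <;>
      constructor <;> push_cast <;> linarith [ih.1, ih.2, hPb]

end IsLetterProduct

end

section

open scoped MatrixGroups UpperHalfPlane
open CongruenceSubgroup

theorem eq_of_dvd_sub_of_Ico {N a b : ℤ} (h : N ∣ a - b) (ha : 0 ≤ a) (ha' : a < N) (hb : 0 ≤ b)
    (hb' : b < N) : a = b := by
  have := Int.eq_zero_of_abs_lt_dvd h (abs_lt.2 ⟨by linarith, by linarith⟩)
  linarith

theorem card_le_of_box {P : ℤ × ℤ → Prop} {K N : ℕ}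
    (hcard : ∀ F : Finset (ℤ × ℤ), (∀ x ∈ F, P x) →
      (∀ x ∈ F, ∀ y ∈ F, (N : ℤ) ∣ x.1 - y.1 → (N : ℤ) ∣ x.2 - y.2 → x = y) → F.card ≤ K)
    {σ : Type*} [Fintype σ] [DecidableEq σ] (U : Finset ℕ) (st : ℕ → σ) (f g : ℕ → ℤ)
    (hf : Set.InjOn f U) (hg : Set.InjOn g U) (hf' : ∀ u ∈ U, 0 ≤ f u ∧ f u < N)
    (hg' : ∀ u ∈ U, 0 < g u ∧ g u ≤ N)
    (h : ∀ i ∈ U, ∀ j ∈ U, st i = st j → P (f i, g j)) :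
    (U.card : ℝ) ≤ Fintype.card σ * √K := by
  classical
  have key : ∀ a : σ, ((U.filter fun u => st u = a).card : ℝ) ≤ √K := by
    intro a
    set B := U.filter fun u => st u = a with hB
    have hBU : ∀ u ∈ B, u ∈ U ∧ st u = a := fun u hu => by simpa [hB] using hu
    apply Real.le_sqrt_of_sq_le
    have := hcard ((B ×ˢ B).image fun x => (f x.1, g x.2)) ?_ ?_
    · rw [Finset.card_image_of_injOn, Finset.card_product, ← sq] at this
      · exact_mod_cast this
      · rintro ⟨a, b⟩ hab ⟨c, d⟩ hcd hh
        simp only [Finset.coe_product, Set.mem_prod, Finset.mem_coe] at hab hcd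
        simp only [Prod.mk.injEq] at hh
        rw [hf (hBU _ hab.1).1 (hBU _ hcd.1).1 hh.1, hg (hBU _ hab.2).1 (hBU _ hcd.2).1 hh.2]
    · intro x hx
      obtain ⟨⟨i, j⟩, hij, rfl⟩ := Finset.mem_image.1 hx
      obtain ⟨hi, hj⟩ := Finset.mem_product.1 hij
      exact h _ (hBU _ hi).1 _ (hBU _ hj).1 ((hBU _ hi).2.trans (hBU _ hj).2.symm)
    · intro x hx y hy
      obtain ⟨⟨i, j⟩, hij, rfl⟩ := Finset.mem_image.1 hx
      obtain ⟨⟨k, l⟩, hkl, rfl⟩ := Finset.mem_image.1 hy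
      obtain ⟨hi, hj⟩ := Finset.mem_product.1 hij
      obtain ⟨hk, hl⟩ := Finset.mem_product.1 hkl
      intro e1 e2
      have a1 := hf' _ (hBU _ hi).1
      have a2 := hf' _ (hBU _ hk).1
      have a3 := hg' _ (hBU _ hj).1
      have a4 := hg' _ (hBU _ hl).1
      simp only at e1 e2 a1 a2 a3 a4
      have e3 := eq_of_dvd_sub_of_Ico e1 a1.1 a1.2 a2.1 a2.2
      have e4 := eq_of_dvd_sub_of_Ico (a := g j - 1) (b := g l - 1) (by simpa using e2)
        (by omega) (by omega) (by omega) (by omega)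
      simp only [Prod.mk.injEq]
      exact ⟨e3, by omega⟩
  rw [Finset.card_eq_sum_card_fiberwise (f := st) (t := Finset.univ) (fun _ _ => by simp)]
  push_cast
  calc _ ≤ ∑ _a : σ, √(K : ℝ) := Finset.sum_le_sum fun a _ => key a
    _ = _ := by simp

namespace IsLetterProduct

variable {w : ℤ → Bool} {G : ℤ → SL(2, ℤ)} (hG : IsLetterProduct w G) {γ : ℝ → ℍ}
  {h : SL(2, ℤ)} {K N : ℕ} (hγ : CrossBound γ h K) (hN : 0 < N) (hp : ∀ s, G (s + N) = h * G s)
  (hpos : ∀ i j, 0 < ((G 0)⁻¹ * h * G 0) i j) (h0 : w (-1) = false) (h1 : w 0 = true)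
include hG hγ hN hp hpos h0 h1

theorem sum_min_runLen_le (x : Bool) (E : Finset ℕ) (hE : E ⊆ runEnds w N x)
    (hst : ∀ u ∈ E, ∀ v ∈ E, modTwo (G u) = modTwo (G v)) :
    ∑ u ∈ E, ∑ v ∈ E, min (runLen w u / 2) (runLen w v / 2) ≤ K := by
  classical
  have h01 : w 0 ≠ w (-1) := by rw [h0, h1]; simp
  set D := (E ×ˢ E).sigma fun y => Finset.range (min (runLen w y.1 / 2) (runLen w y.2 / 2)) with hD
  let φ : (Σ _ : ℕ × ℕ, ℕ) → ℤ × ℤ :=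
    fun y => (y.1.1 - 2 * (runLen w y.1.1 / 2 : ℕ) + 2 * y.2, y.1.2)
  have hmem : ∀ v z k, (⟨(v, z), k⟩ : Σ _ : ℕ × ℕ, ℕ) ∈ D ↔
      v ∈ E ∧ z ∈ E ∧ k < runLen w v / 2 ∧ k < runLen w z / 2 := by
    intro v z k
    simp only [hD, Finset.mem_sigma, Finset.mem_product, Finset.mem_range, lt_min_iff, and_assoc]
  have hinj : Set.InjOn φ D := by
    rintro ⟨⟨v, z⟩, k⟩ hy ⟨⟨v', z'⟩, k'⟩ hy' he
    rw [Finset.mem_coe, hmem] at hy hy'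
    simp only [φ, Prod.mk.injEq, Nat.cast_inj] at he
    obtain ⟨e1, rfl⟩ := he
    have hv : v = v' := runEnds_unique h01 (hE hy.1) (hE hy'.1)
      (p := v - 2 * (runLen w v / 2 : ℕ) + 2 * k) (by omega) (by omega) (by omega) (by omega)
    subst hv
    have : k = k' := by omega
    rw [this]
  have hc : ∑ u ∈ E, ∑ v ∈ E, min (runLen w u / 2) (runLen w v / 2) = (D.image φ).card := by
    rw [Finset.card_image_of_injOn hinj, hD, Finset.card_sigma, Finset.sum_product]
    simp
  rw [hc]
  refine hG.card_parallel_le hγ hN hp hpos (D.image φ) ?_ ?_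
  · intro y hy
    obtain ⟨⟨⟨v, z⟩, k⟩, hyD, rfl⟩ := Finset.mem_image.1 hy
    clear hy; rename' hyD => hy
    rw [hmem] at hy
    obtain ⟨hv, hz, hk1, hk2⟩ := hy
    obtain ⟨a1, a2, a3, a4, a5, a6, a7, a8⟩ := mem_runEnds_spec h01 (hE hv)
    obtain ⟨b1, b2, b3, b4, b5, b6, b7, b8⟩ := mem_runEnds_spec h01 (hE hz)
    simp only [φ]
    refine ⟨⟨?_, runLen w v % 2 + 2 * k, fun i hi => ?_, ?_, ?_⟩, ?_⟩
    · rw [a7 _ (by omega) (by omega)]; exact b4.symm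
    · rw [a7 _ (by omega) (by omega), b7 _ (by omega) (by omega)]
    · have e : (v : ℤ) - 2 * (runLen w v / 2 : ℕ) + 2 * k - 1 - (runLen w v % 2 + 2 * k : ℕ) =
          v - runLen w v - 1 := by omega
      rw [e]
      revert a8 b4
      cases x <;> simp_all
    · exact (b7 _ (by omega) (by omega)).trans (a7 _ (by omega) (by omega)).symm
    · rw [mul_inv_mem_gamma_two_iff, ← hst v hv z hz]
      exact hG.modTwo_run_even (x := x) (by omega) ⟨((runLen w v / 2 : ℕ) : ℤ) - k, by ring⟩
        fun p hp1 hp2 => a7 p (by omega) hp2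
  · intro y hy y' hy' e1 e2
    obtain ⟨⟨⟨v, z⟩, k⟩, hyD, rfl⟩ := Finset.mem_image.1 hy
    clear hy; rename' hyD => hy
    obtain ⟨⟨⟨v', z'⟩, k'⟩, hyD', rfl⟩ := Finset.mem_image.1 hy'
    clear hy'; rename' hyD' => hy'
    rw [hmem] at hy hy'
    have a := mem_runEnds_spec h01 (hE hy.1)
    have b := mem_runEnds_spec h01 (hE hy.2.1)
    have a' := mem_runEnds_spec h01 (hE hy'.1)
    have b' := mem_runEnds_spec h01 (hE hy'.2.1)
    simp only [φ] at e1 e2 ⊢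
    have e3 := eq_of_dvd_sub_of_Ico e1 (by omega) (by omega) (by omega) (by omega)
    have e4 := eq_of_dvd_sub_of_Ico (a := z - 1) (b := z' - 1) (by simpa using e2)
      (by omega) (by omega) (by omega) (by omega)
    simp only [Prod.mk.injEq]
    exact ⟨e3, by omega⟩

end IsLetterProduct

end

section

open scoped MatrixGroups UpperHalfPlane
open CongruenceSubgroup

theorem card_runEnds_false_le {w : ℤ → Bool} {N : ℕ} (h0 : w (-1) = false) (h1 : w 0 = true) :
    (runEnds w N false).card ≤ (runEnds w N true).card := by
  have h01 : w 0 ≠ w (-1) := by rw [h0, h1]; simp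
  refine Finset.card_le_card_of_injOn (fun v => v - runLen w v) (fun v hv => ?_)
    (sub_runLen_injOn h01)
  refine sub_runLen_mem h01 hv fun h => ?_
  obtain ⟨a1, a2, a3, a4, a5, a6, a7, a8⟩ := mem_runEnds_spec h01 hv
  have := a7 0 (by omega) (by omega)
  rw [h1] at this
  exact absurd this (by simp)

namespace IsLetterProduct

variable {w : ℤ → Bool} {G : ℤ → SL(2, ℤ)} (hG : IsLetterProduct w G) {γ : ℝ → ℍ}
  {h : SL(2, ℤ)} {K N : ℕ} (hγ : CrossBound γ h K) (hN : 0 < N) (hp : ∀ s, G (s + N) = h * G s)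
  (hpos : ∀ i j, 0 < ((G 0)⁻¹ * h * G 0) i j) (h0 : w (-1) = false) (h1 : w 0 = true)
include hG hγ hN hp hpos h0 h1

theorem card_runEnds_true_le : ((runEnds w N true).card : ℝ) ≤
    1 + 4 * (Fintype.card SL(2, ZMod 2) * √K) := by
  classical
  have h01 : w 0 ≠ w (-1) := by rw [h0, h1]; simp
  let pv : ℕ → ℕ := fun v => v - runLen w v
  have hpv : ∀ v, pv v = v - runLen w v := fun _ => rfl
  set E := runEnds w N true with hE
  set U := E.filter fun u => pv u ≠ 0 with hU
  have hUE : ∀ u ∈ U, u ∈ E ∧ pv u ∈ runEnds w N false ∧ pv (pv u) ∈ runEnds w N true ∧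
      w (pv (pv (pv u))) = true ∧ w (pv (pv (pv u)) - 1) = false ∧ pv (pv (pv u)) < N := by
    intro u hu
    obtain ⟨hu, hu0⟩ := Finset.mem_filter.1 hu
    have e1 : pv u ∈ runEnds w N (!true) := sub_runLen_mem h01 hu hu0
    have e2 : pv (pv u) ∈ runEnds w N (!!true) := by
      refine sub_runLen_mem h01 e1 fun h => ?_
      obtain ⟨a1, a2, a3, a4, a5, a6, a7, a8⟩ := mem_runEnds_spec h01 e1
      have := a7 0 (by omega) (by omega)
      rw [h1] at this
      exact absurd this (by simp)
    rw [Bool.not_not] at e2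
    obtain ⟨a1, a2, a3, a4, a5, a6, a7, a8⟩ := mem_runEnds_spec h01 e2
    have e : ((pv (pv (pv u)) : ℕ) : ℤ) = pv (pv u) - runLen w (pv (pv u)) := by
      rw [hpv (pv (pv u))]; omega
    refine ⟨hu, e1, e2, ?_, ?_, ?_⟩
    · rw [e]; exact a7 _ le_rfl (by omega)
    · rw [e]; simpa using a8
    · rw [hpv (pv (pv u))]; omega
  have i1 : Set.InjOn pv U := fun u hu v hv =>
    sub_runLen_injOn h01 (hUE u hu).1 (hUE v hv).1
  have i2 : Set.InjOn (fun u => pv (pv u)) U := fun u hu v hv huv =>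
    i1 hu hv (sub_runLen_injOn h01 (hUE u hu).2.1 (hUE v hv).2.1 huv)
  have i3 : Set.InjOn (fun u => pv (pv (pv u))) U := fun u hu v hv huv =>
    i2 hu hv (sub_runLen_injOn h01 (hUE u hu).2.2.1 (hUE v hv).2.2.1 huv)
  have par : ∀ (V : Finset ℕ), V ⊆ U → ∀ f g : ℕ → ℕ, Set.InjOn f U → Set.InjOn g U →
      (∀ u ∈ U, f u < N ∧ w (f u) = true ∧ w (f u - 1) = false) →
      (∀ u ∈ U, g u ∈ runEnds w N true) → (∀ u ∈ V, modTwo (G (f u)) = modTwo (G (g u))) →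
      (V.card : ℝ) ≤ Fintype.card SL(2, ZMod 2) * √K := by
    intro V hV f g hf hg hf' hg' hs
    refine card_le_of_box (P := fun y => ParallelCross w y.1 y.2 ∧ G y.1 * (G y.2)⁻¹ ∈ Gamma 2)
      (fun F hF hinj => hG.card_parallel_le hγ hN hp hpos F hF hinj) V
      (fun u => modTwo (G (g u))) (fun u => f u) (fun u => g u) ?_ ?_ ?_ ?_ ?_
    · exact fun a ha b hb hab => hf (hV ha) (hV hb) (Nat.cast_injective (R := ℤ) hab)
    · exact fun a ha b hb hab => hg (hV ha) (hV hb) (Nat.cast_injective (R := ℤ) hab)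
    · intro u hu
      have := (hf' u (hV hu)).1
      omega
    · intro u hu
      obtain ⟨a1, a2, -⟩ := mem_runEnds_spec h01 (hg' u (hV hu))
      omega
    · intro i hi j hj hij
      obtain ⟨-, c1, c2⟩ := hf' i (hV hi)
      obtain ⟨-, -, c3, c4, -⟩ := mem_runEnds_spec h01 (hg' j (hV hj))
      have c4' : w (g j) = false := by simpa using c4
      refine ⟨⟨by simp only [c1, c4']; simp, 0, by simp, ?_, ?_⟩, ?_⟩
      · simp [c2, c4']
      · simp [c1, c3]
      · rw [mul_inv_mem_gamma_two_iff, hs i hi]; exact hij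
  have fst : ∀ u ∈ U, pv u < N ∧ w (pv u) = true ∧ w (pv u - 1) = false := by
    intro u hu
    obtain ⟨a1, a2, a3, a4, a5, -⟩ := mem_runEnds_spec h01 (hUE u hu).2.1
    obtain ⟨b1, b2, b3, b4, b5, -⟩ := mem_runEnds_spec h01 (hUE u hu).1
    exact ⟨by rw [hpv]; omega, by simpa using a4, a3⟩
  have trd : ∀ u ∈ U, pv (pv (pv u)) < N ∧ w (pv (pv (pv u))) = true ∧
      w (pv (pv (pv u)) - 1) = false := fun u hu =>
    ⟨(hUE u hu).2.2.2.2.2, (hUE u hu).2.2.2.1, (hUE u hu).2.2.2.2.1⟩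
  have even : ∀ (x : Bool) v, v ∈ runEnds w N x → Even (runLen w v) →
      modTwo (G (pv v)) = modTwo (G v) := by
    intro x v hv he
    obtain ⟨a1, a2, a3, a4, a5, a6, a7, a8⟩ := mem_runEnds_spec h01 hv
    rw [show ((pv v : ℕ) : ℤ) = v - runLen w v by rw [hpv]; omega]
    exact hG.modTwo_run_even (x := x) (by omega) (by simpa using he) a7
  have odd : ∀ (x : Bool) v, v ∈ runEnds w N x → ¬ Even (runLen w v) →
      modTwo (G v) = modTwo (G (pv v)) * modTwo (slLetter x) := by
    intro x v hv he
    obtain ⟨a1, a2, a3, a4, a5, a6, a7, a8⟩ := mem_runEnds_spec h01 hv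
    rw [show ((pv v : ℕ) : ℤ) = v - runLen w v by rw [hpv]; omega]
    exact hG.modTwo_run_odd (x := x) (by omega) (by simpa using he) a7
  have k1 := par (U.filter fun u => Even (runLen w u)) (Finset.filter_subset _ _) pv id i1
    (fun _ _ _ _ h => h) fst (fun u hu => (hUE u hu).1)
    (fun u hu => even true u (hUE u (Finset.mem_filter.1 hu).1).1 (Finset.mem_filter.1 hu).2)
  have k2 := par (U.filter fun u => Even (runLen w (pv u))) (Finset.filter_subset _ _) pv
    (fun u => pv (pv u)) i1 i2 fst (fun u hu => (hUE u hu).2.2.1)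
    (fun u hu => (even false _ (hUE u (Finset.mem_filter.1 hu).1).2.1
      (Finset.mem_filter.1 hu).2).symm)
  have k3 := par (U.filter fun u => Even (runLen w (pv (pv u)))) (Finset.filter_subset _ _)
    (fun u => pv (pv (pv u))) (fun u => pv (pv u)) i3 i2 trd (fun u hu => (hUE u hu).2.2.1)
    (fun u hu => even true _ (hUE u (Finset.mem_filter.1 hu).1).2.2.1
      (Finset.mem_filter.1 hu).2)
  have k4 : ((U.filter fun u => ¬ Even (runLen w u) ∧ ¬ Even (runLen w (pv u)) ∧
      ¬ Even (runLen w (pv (pv u)))).card : ℝ) ≤ Fintype.card SL(2, ZMod 2) * √K := by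
    have hV : (U.filter fun u => ¬ Even (runLen w u) ∧ ¬ Even (runLen w (pv u)) ∧
      ¬ Even (runLen w (pv (pv u)))) ⊆ U := Finset.filter_subset _ _
    refine card_le_of_box (P := fun y => AntiparallelCross w y.1 y.2 ∧
        G y.1 * ModularGroup.S * (G y.2)⁻¹ ∈ Gamma 2)
      (fun F hF hinj => hG.card_antiparallel_le hγ hN hp hpos F hF hinj) _
      (fun u => modTwo (G u)) (fun u => pv (pv (pv u))) (fun u => u) ?_ ?_ ?_ ?_ ?_
    · exact fun a ha b hb hab => i3 (hV ha) (hV hb) (Nat.cast_injective (R := ℤ) hab)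
    · exact fun a ha b hb hab => Nat.cast_injective (R := ℤ) hab
    · intro u hu
      have := (trd u (hV hu)).1
      omega
    · intro u hu
      obtain ⟨a1, a2, -⟩ := mem_runEnds_spec h01 (hUE u (hV hu)).1
      omega
    · intro i hi j hj hij
      obtain ⟨-, c1, c2⟩ := trd i (hV hi)
      obtain ⟨-, -, c3, c4, -⟩ := mem_runEnds_spec h01 (hUE j (hV hj)).1
      refine ⟨⟨c1, c2, by simpa using c4, c3⟩, ?_⟩
      obtain ⟨hi', o1, o2, o3⟩ := Finset.mem_filter.1 hi
      rw [mul_inv_mem_gamma_two_iff, map_mul, modTwo_S, ← modTwo_slLetter_mul_mul, ← hij]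
      simp only
      rw [odd true _ (hUE i hi').1 o1, odd false _ (hUE i hi').2.1 o2,
        odd true _ (hUE i hi').2.2.1 o3]
      group
  have hcov : E ⊆ (E.filter fun u => pv u = 0) ∪ ((U.filter fun u => Even (runLen w u)) ∪
      ((U.filter fun u => Even (runLen w (pv u))) ∪ ((U.filter fun u => Even (runLen w (pv (pv u)))) ∪
      U.filter fun u => ¬ Even (runLen w u) ∧ ¬ Even (runLen w (pv u)) ∧
      ¬ Even (runLen w (pv (pv u)))))) := by
    intro u hu
    simp only [hU, Finset.mem_union, Finset.mem_filter]
    tauto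
  have hone : (E.filter fun u => pv u = 0).card ≤ 1 := by
    refine Finset.card_le_one.2 fun a ha b hb => ?_
    obtain ⟨ha, ha'⟩ := Finset.mem_filter.1 ha
    obtain ⟨hb, hb'⟩ := Finset.mem_filter.1 hb
    exact sub_runLen_injOn h01 ha hb (ha'.trans hb'.symm)
  have c := (Finset.card_le_card hcov).trans ((Finset.card_union_le _ _).trans (add_le_add_right
    ((Finset.card_union_le _ _).trans (add_le_add_right ((Finset.card_union_le _ _).trans
    (add_le_add_right (Finset.card_union_le _ _) _)) _)) _))
  have c' : (E.card : ℝ) ≤ _ := Nat.cast_le.2 c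
  push_cast at c'
  have hone' : ((E.filter fun u => pv u = 0).card : ℝ) ≤ 1 := by exact_mod_cast hone
  linarith

theorem trace_le (hK : 1 ≤ K) : (((h 0 0 + h 1 1 : ℤ)) : ℝ) ≤
    2 * Real.exp ((12 * Fintype.card SL(2, ZMod 2) + 2) * √K) := by
  classical
  have h01 : w 0 ≠ w (-1) := by rw [h0, h1]; simp
  set c : ℝ := ((Fintype.card SL(2, ZMod 2) : ℕ) : ℝ) with hc
  have hK1 : 1 ≤ √(K : ℝ) := Real.one_le_sqrt.2 (by exact_mod_cast hK)
  have logs : ∀ x, ∑ v ∈ runEnds w N x, Real.log (1 + runLen w v) ≤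
      (runEnds w N x).card + c * (2 * √K) := by
    intro x
    have e1 : ∀ v : ℕ, Real.log (1 + runLen w v) ≤ 1 + Real.log (1 + (runLen w v / 2 : ℕ)) := by
      intro v
      have : (1 + runLen w v : ℝ) ≤ 2 * (1 + (runLen w v / 2 : ℕ)) := by
        have : 1 + runLen w v ≤ 2 * (1 + runLen w v / 2) := by omega
        exact_mod_cast this
      have h2 := Real.log_le_log (by positivity) this
      rw [Real.log_mul (by norm_num) (by positivity)] at h2
      have := Real.log_two_lt_d9
      linarith
    have e2 : ∑ v ∈ runEnds w N x, Real.log (1 + (runLen w v / 2 : ℕ)) ≤ c * (2 * √K) := by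
      rw [← Finset.sum_fiberwise_of_maps_to (s := runEnds w N x) (t := Finset.univ)
        (g := fun v => modTwo (G v)) (fun _ _ => by simp)]
      calc _ ≤ ∑ _σ : SL(2, ZMod 2), 2 * √(K : ℝ) := by
            refine Finset.sum_le_sum fun σ _ => sum_log_one_add_le _ _ hK ?_
            refine hG.sum_min_runLen_le hγ hN hp hpos h0 h1 x _ (Finset.filter_subset _ _) ?_
            intro u hu v hv
            rw [(Finset.mem_filter.1 hu).2, (Finset.mem_filter.1 hv).2]
        _ = _ := by simp [hc]
    calc _ ≤ ∑ v ∈ runEnds w N x, (1 + Real.log (1 + (runLen w v / 2 : ℕ))) :=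
          Finset.sum_le_sum fun v _ => e1 v
      _ ≤ _ := by rw [Finset.sum_add_distrib]; simpa using e2
  have hprod : (runProd w N : ℝ) ≤ Real.exp ((12 * c + 2) * √K) := by
    have hpp : (0 : ℝ) < runProd w N := by
      rw [runProd]; push_cast
      refine Finset.prod_pos fun e _ => ?_
      split_ifs <;> positivity
    rw [← Real.log_le_iff_le_exp hpp, runProd]
    push_cast
    rw [Real.log_prod (fun e _ => by split_ifs <;> positivity)]
    have e1 : ∑ e ∈ Finset.range N, Real.log (if w ((e : ℤ) + 1) ≠ w e then
        1 + (runLen w (e + 1) : ℝ) else 1) =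
        ∑ v ∈ runEnds w N true, Real.log (1 + runLen w v) +
        ∑ v ∈ runEnds w N false, Real.log (1 + runLen w v) := by
      rw [runEnds, runEnds, Finset.sum_filter, Finset.sum_filter, ← Finset.sum_add_distrib,
        show Finset.Icc 1 N = Finset.Ico 1 (N + 1) from rfl, Finset.sum_Ico_eq_sum_range,
        Nat.add_sub_cancel]
      refine Finset.sum_congr rfl fun e _ => ?_
      rw [show (((1 + e : ℕ) : ℤ) - 1) = e by push_cast; ring,
        show ((1 + e : ℕ) : ℤ) = e + 1 by push_cast; ring, add_comm 1 e]
      cases w e <;> cases w ((e : ℤ) + 1) <;> simp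
    rw [e1]
    have := logs true
    have := logs false
    have e3 := hG.card_runEnds_true_le hγ hN hp hpos h0 h1
    have e4 : ((runEnds w N false).card : ℝ) ≤ (runEnds w N true).card := by
      exact_mod_cast card_runEnds_false_le h0 h1
    nlinarith
  obtain ⟨s, rfl⟩ : ∃ s, N = s + 1 := ⟨N - 1, by omega⟩
  have hcol := hG.columns_le h0 h1 s
  have es : ((s : ℤ) + 1) = 0 + ((s + 1 : ℕ) : ℤ) := by push_cast; ring
  have q1 : w ((s : ℤ) + 1) = true := by
    have := hG.period_letter hp 0 1
    rw [one_mul] at this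
    rw [es, this, h1]
  have q2 : w s = false := by
    have := hG.period_letter hp (-1) 1
    rw [h0] at this
    rw [← this]; congr 1; push_cast; ring
  rw [q2, es, hp, ← mul_assoc] at hcol
  simp only [Bool.false_eq_true, if_false] at hcol
  rw [runProd_succ, if_pos (by rw [q1, q2]; simp)] at hprod
  have tr : h 0 0 + h 1 1 = ((G 0)⁻¹ * h * G 0) 0 0 + ((G 0)⁻¹ * h * G 0) 1 1 := by
    have hd := sl_det_eq (G 0)
    obtain ⟨i1, i2, i3, i4⟩ := sl_inv_apply (G 0)
    simp only [sl_mul_apply, i1, i2, i3, i4]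
    linear_combination -(h 0 0 + h 1 1) * hd
  have p1 := hpos 0 1
  have p2 := hpos 1 0
  have hb : (0 : ℤ) ≤ runProd w s * runLen w (s + 1) := by positivity
  have : h 0 0 + h 1 1 ≤ 2 * (runProd w s * (1 + runLen w (s + 1)) : ℕ) := by
    rw [tr]; push_cast; linarith [hcol.1, hcol.2]
  have hr : ((h 0 0 + h 1 1 : ℤ) : ℝ) ≤ 2 * (runProd w s * (1 + runLen w (s + 1)) : ℕ) := by
    exact_mod_cast this
  linarith

end IsLetterProduct

end

section

open scoped MatrixGroups UpperHalfPlane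
open CongruenceSubgroup

theorem sl_neg_zpow (h : SL(2, ℤ)) (a : ℤ) : (-h) ^ a = h ^ a ∨ (-h) ^ a = -h ^ a := by
  induction a using Int.induction_on with
  | zero => simp
  | succ n ih =>
    rw [zpow_add_one, zpow_add_one]
    rcases ih with ih | ih <;> rw [ih] <;> simp
  | pred n ih =>
    have hn : (-h)⁻¹ = -h⁻¹ := inv_eq_of_mul_eq_one_right (by rw [neg_mul_neg, mul_inv_cancel])
    rw [zpow_sub_one, zpow_sub_one, hn]
    rcases ih with ih | ih <;> rw [ih] <;> simp

theorem sl_trace_conj (g h : SL(2, ℤ)) :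
    (g⁻¹ * h * g) 0 0 + (g⁻¹ * h * g) 1 1 = h 0 0 + h 1 1 := by
  have hd := sl_det_eq g
  obtain ⟨i1, i2, i3, i4⟩ := sl_inv_apply g
  simp only [sl_mul_apply, i1, i2, i3, i4]
  linear_combination (h 0 0 + h 1 1) * hd

namespace CrossBound

variable {γ : ℝ → ℍ} {h : SL(2, ℤ)} {K : ℕ} (hγ : CrossBound γ h K)
include hγ

theorem neg : CrossBound γ (-h) K where
  continuous := hγ.continuous
  mem := by
    have := hγ.mem
    rw [mem_gamma_two_iff] at this ⊢
    simpa only [sl_neg_apply, even_neg, odd_neg] using this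
  map_add_one t := by rw [hγ.map_add_one, ModularGroup.SL_neg_smul]
  card_le F c h1 h2 h3 h4 := by
    refine hγ.card_le F c h1 h2 (fun i hi a => ?_) (fun i hi j hj a b hab => ?_)
    · obtain ⟨e1, e2⟩ := h3 i hi a
      rcases sl_neg_zpow h a with e | e <;> rw [e] at e1 e2
      · exact ⟨e1, e2⟩
      · exact ⟨by simpa using e2, e1⟩
    · refine h4 i hi j hj a b ?_
      rcases sl_neg_zpow h a with e | e <;> rcases sl_neg_zpow h b with e' | e' <;>
        rw [e, e'] <;> (try simp only [neg_mul, mul_neg, neg_neg]) <;> tauto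

theorem conj (g : SL(2, ℤ)) : CrossBound (fun t => g • γ t) (g * h * g⁻¹) K where
  continuous := (continuous_sl_smul g).comp hγ.continuous
  mem := (Gamma_normal 2).conj_mem _ hγ.mem _
  map_add_one t := by
    rw [hγ.map_add_one, ← mul_smul, ← mul_smul]
    congr 1; group
  card_le F c h1 h2 h3 h4 := by
    refine hγ.card_le F (fun i => g⁻¹ * c i * g) (fun i hi => ?_) (fun i hi => ?_)
      (fun i hi a => ?_) (fun i hi j hj a b hab => ?_)
    · have := (Gamma_normal 2).conj_mem _ (h1 i hi) g⁻¹
      simpa using this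
    · obtain ⟨t, u, e⟩ := h2 i hi
      refine ⟨t, u, ?_⟩
      change g • γ t = c i • g • γ u at e
      rw [mul_smul, mul_smul, ← e, inv_smul_smul]
    · obtain ⟨e1, e2⟩ := h3 i hi a
      rw [conj_zpow] at e1 e2
      refine ⟨fun h => e1 ?_, fun h => e2 ?_⟩
      · rw [← h]; group
      · have : c i = g * (g⁻¹ * c i * g) * g⁻¹ := by group
        rw [this]
        simp only [h, mul_neg, neg_mul]
    · refine h4 i hi j hj a b ?_
      rw [conj_zpow, conj_zpow]
      have e : c i = g * (g⁻¹ * c i * g) * g⁻¹ := by group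
      rcases hab with hab | hab
      · left; rw [e]; simp only [hab]; group
      · right; rw [e]; simp only [hab, mul_neg, neg_mul, neg_inj]; group

end CrossBound

theorem exists_abs_sub_two_mul_le (x : ℤ) {c : ℤ} (hc : c ≠ 0) : ∃ n : ℤ, |x - 2 * n * c| ≤ |c| := by
  have hc' : 0 < |c| := abs_pos.2 hc
  have e1 := Int.emod_add_mul_ediv (x + |c|) (2 * |c|)
  have e2 := Int.emod_nonneg (x + |c|) (b := 2 * |c|) (by omega)
  have e3 := Int.emod_lt_of_pos (x + |c|) (b := 2 * |c|) (by omega)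
  generalize (x + |c|) % (2 * |c|) = r at *
  generalize (x + |c|) / (2 * |c|) = q at *
  rcases abs_choice c with h | h <;> rw [h] at e1 e3 ⊢
  · exact ⟨q, abs_le.2 ⟨by linarith, by linarith⟩⟩
  · exact ⟨-q, abs_le.2 ⟨by linarith, by linarith⟩⟩

theorem sl_conj_T_zpow (A : SL(2, ℤ)) (n : ℤ) :
    ((ModularGroup.T ^ n)⁻¹ * A * ModularGroup.T ^ n) 1 0 = A 1 0 ∧
    ((ModularGroup.T ^ n)⁻¹ * A * ModularGroup.T ^ n) 0 0 -
      ((ModularGroup.T ^ n)⁻¹ * A * ModularGroup.T ^ n) 1 1 = A 0 0 - A 1 1 - 2 * n * A 1 0 := by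
  have e := ModularGroup.coe_T_zpow n
  obtain ⟨i1, i2, i3, i4⟩ := sl_inv_apply (ModularGroup.T ^ n)
  have t1 : (ModularGroup.T ^ n) 0 0 = 1 := by rw [e]; simp
  have t2 : (ModularGroup.T ^ n) 0 1 = n := by rw [e]; simp
  have t3 : (ModularGroup.T ^ n) 1 0 = 0 := by rw [e]; simp
  have t4 : (ModularGroup.T ^ n) 1 1 = 1 := by rw [e]; simp
  simp only [sl_mul_apply, i1, i2, i3, i4, t1, t2, t3, t4]
  constructor <;> ring

theorem sl_conj_S (A : SL(2, ℤ)) :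
    (ModularGroup.S⁻¹ * A * ModularGroup.S) 0 0 = A 1 1 ∧
    (ModularGroup.S⁻¹ * A * ModularGroup.S) 0 1 = -A 1 0 ∧
    (ModularGroup.S⁻¹ * A * ModularGroup.S) 1 0 = -A 0 1 ∧
    (ModularGroup.S⁻¹ * A * ModularGroup.S) 1 1 = A 0 0 := by
  obtain ⟨i1, i2, i3, i4⟩ := sl_inv_apply ModularGroup.S
  obtain ⟨s1, s2, s3, s4⟩ := sl_S_apply
  simp only [sl_mul_apply, i1, i2, i3, i4, s1, s2, s3, s4]
  refine ⟨?_, ?_, ?_, ?_⟩ <;> ring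

theorem sl_forall_pos {A : SL(2, ℤ)} (h1 : 0 < A 0 0) (h2 : 0 < A 0 1) (h3 : 0 < A 1 0)
    (h4 : 0 < A 1 1) (i j : Fin 2) : 0 < A i j := by
  fin_cases i <;> fin_cases j <;> assumption

/-- Every integral matrix is conjugate to a triangular one, or to one whose lower left entry is
dominated by the upper right one and dominates the difference of the diagonal entries. -/
theorem exists_conj_reduced (h : SL(2, ℤ)) : ∃ g : SL(2, ℤ), (g⁻¹ * h * g) 1 0 = 0 ∨
    ((g⁻¹ * h * g) 1 0 ≠ 0 ∧
      |(g⁻¹ * h * g) 0 0 - (g⁻¹ * h * g) 1 1| ≤ |(g⁻¹ * h * g) 1 0| ∧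
      |(g⁻¹ * h * g) 1 0| ≤ |(g⁻¹ * h * g) 0 1|) := by
  obtain ⟨g₀, -, hg₀⟩ := (InvImage.wf (fun g : SL(2, ℤ) => ((g⁻¹ * h * g) 1 0).natAbs)
    Nat.lt_wfRel.wf).has_min Set.univ ⟨1, trivial⟩
  have hmin : ∀ g : SL(2, ℤ), |(g₀⁻¹ * h * g₀) 1 0| ≤ |(g⁻¹ * h * g) 1 0| := by
    intro g
    have := hg₀ g trivial
    change ¬ _ < _ at this
    simp only at this
    rw [Int.abs_eq_natAbs, Int.abs_eq_natAbs]
    omega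
  by_cases hc0 : (g₀⁻¹ * h * g₀) 1 0 = 0
  · exact ⟨g₀, Or.inl hc0⟩
  obtain ⟨n, hn⟩ := exists_abs_sub_two_mul_le
    ((g₀⁻¹ * h * g₀) 0 0 - (g₀⁻¹ * h * g₀) 1 1) hc0
  obtain ⟨t1, t2⟩ := sl_conj_T_zpow (g₀⁻¹ * h * g₀) n
  obtain ⟨g₁, hg₁⟩ : ∃ g, g = g₀ * ModularGroup.T ^ n := ⟨_, rfl⟩
  have e1 : (ModularGroup.T ^ n)⁻¹ * (g₀⁻¹ * h * g₀) * ModularGroup.T ^ n = g₁⁻¹ * h * g₁ := by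
    rw [hg₁]; group
  rw [e1] at t1 t2
  have hS := hmin (g₁ * ModularGroup.S)
  have e2 : (g₁ * ModularGroup.S)⁻¹ * h * (g₁ * ModularGroup.S) =
    ModularGroup.S⁻¹ * (g₁⁻¹ * h * g₁) * ModularGroup.S := by group
  obtain ⟨s1, s2, s3, s4⟩ := sl_conj_S (g₁⁻¹ * h * g₁)
  rw [e2, s3, abs_neg, ← t1] at hS
  rw [← t2, ← t1] at hn
  rw [← t1] at hc0
  exact ⟨g₁, Or.inr ⟨hc0, hn, hS⟩⟩

theorem exists_conj_pos {h : SL(2, ℤ)} (ht : 3 ≤ h 0 0 + h 1 1) :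
    ∃ g : SL(2, ℤ), ∀ i j, 0 < (g⁻¹ * h * g) i j := by
  obtain ⟨g₁, hg₁⟩ := exists_conj_reduced h
  have e2 : (g₁ * ModularGroup.S)⁻¹ * h * (g₁ * ModularGroup.S) =
    ModularGroup.S⁻¹ * (g₁⁻¹ * h * g₁) * ModularGroup.S := by group
  obtain ⟨s1, s2, s3, s4⟩ := sl_conj_S (g₁⁻¹ * h * g₁)
  have hd := sl_det_eq (g₁⁻¹ * h * g₁)
  have tr := sl_trace_conj g₁ h
  rw [← tr] at ht
  have hc0 : (g₁⁻¹ * h * g₁) 1 0 ≠ 0 := by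
    intro hg
    rw [hg, mul_zero, sub_zero] at hd
    rcases Int.mul_eq_one_iff_eq_one_or_neg_one.1 hd with ⟨h1, h2⟩ | ⟨h1, h2⟩ <;> linarith
  obtain ⟨hc, hn, hS⟩ := hg₁.resolve_left hc0
  have key : (∀ i j, 0 < (g₁⁻¹ * h * g₁) i j) ∨ ((0 < (g₁⁻¹ * h * g₁) 0 0 ∧
      0 < (g₁⁻¹ * h * g₁) 1 1) ∧ ((g₁⁻¹ * h * g₁) 0 1 < 0 ∧ (g₁⁻¹ * h * g₁) 1 0 < 0)) := by
    have hall : (0 < (g₁⁻¹ * h * g₁) 0 0 ∧ 0 < (g₁⁻¹ * h * g₁) 1 1) ∧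
        ((0 < (g₁⁻¹ * h * g₁) 0 1 ∧ 0 < (g₁⁻¹ * h * g₁) 1 0) ∨
        ((g₁⁻¹ * h * g₁) 0 1 < 0 ∧ (g₁⁻¹ * h * g₁) 1 0 < 0)) := by
      clear s1 s2 s3 s4 e2 tr hg₁ hc0
      generalize (g₁⁻¹ * h * g₁) 0 0 = a at *
      generalize (g₁⁻¹ * h * g₁) 0 1 = b at *
      generalize (g₁⁻¹ * h * g₁) 1 0 = c at *
      generalize (g₁⁻¹ * h * g₁) 1 1 = d at *
      have k1 : (a - d) ^ 2 ≤ c ^ 2 := sq_le_sq.2 hn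
      have k2 : 4 * (b * c) = (a + d) ^ 2 - (a - d) ^ 2 - 4 := by linear_combination -4 * hd
      have k3 : 0 < c ^ 2 := by positivity
      have k4 : c ^ 2 ≤ |b * c| := by rw [abs_mul, ← sq_abs c, sq]; gcongr
      have hbc : 0 < b * c := by
        by_contra! hneg
        rw [abs_of_nonpos hneg] at k4
        nlinarith
      have had : 0 < a * d := by linarith
      have hbc' := pos_and_pos_or_neg_and_neg_of_mul_pos hbc
      refine ⟨?_, hbc'⟩
      rcases pos_and_pos_or_neg_and_neg_of_mul_pos had with h | h
      · exact h
      · linarith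
    obtain ⟨q1, q2 | q2⟩ := hall
    · left
      exact sl_forall_pos q1.1 q2.1 q2.2 q1.2
    · exact Or.inr ⟨q1, q2⟩
  rcases key with hk | ⟨hk1, hk2⟩
  · exact ⟨g₁, hk⟩
  · refine ⟨g₁ * ModularGroup.S, ?_⟩
    rw [e2]
    refine sl_forall_pos ?_ ?_ ?_ ?_
    · rw [s1]; exact hk1.2
    · rw [s2]; exact neg_pos.2 hk2.2
    · rw [s3]; exact neg_pos.2 hk2.1
    · rw [s4]; exact hk1.1

end

section

open scoped MatrixGroups UpperHalfPlane
open CongruenceSubgroup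

theorem SLNonneg.diag_pos {A : SL(2, ℤ)} (hA : SLNonneg A) : 0 < A 0 0 ∧ 0 < A 1 1 := by
  obtain ⟨h1, h2, h3, h4⟩ := hA
  have hd := sl_det_eq A
  have := mul_nonneg h2 h3
  constructor
  · rcases h1.eq_or_lt with h | h
    · rw [← h, zero_mul] at hd; linarith
    · exact h
  · rcases h4.eq_or_lt with h | h
    · rw [← h, mul_zero] at hd; linarith
    · exact h

theorem offDiag_eq_zero_of_det {a b c d : ℤ} (hb : 0 ≤ b) (hc : 0 ≤ c) (hd : 0 < d)
    (h : a * d - b * c = 1) (h1 : ¬ (c ≤ a ∧ d ≤ b)) (h2 : ¬ (a ≤ c ∧ b ≤ d)) :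
    b = 0 ∧ c = 0 := by
  rcases lt_or_ge c a with hca | hca
  · have hbd : b < d := by
      by_contra! hcon
      exact h1 ⟨hca.le, hcon⟩
    have := mul_nonneg (by omega : 0 ≤ a - c - 1) hd.le
    have := mul_nonneg (by omega : 0 ≤ d - b - 1) (by omega : 0 ≤ c + 1)
    have : b + c ≤ 0 := by linarith
    omega
  · have hbd : d < b := by
      by_contra! hcon
      exact h2 ⟨hca, hcon⟩
    have := mul_le_mul hca hbd.le hd.le hc
    linarith

theorem SLNonneg.exists_word {A : SL(2, ℤ)} (hA : SLNonneg A) :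
    ∃ l : List Bool, A = (l.map slLetter).prod := by
  induction hn : (A 0 0 + A 0 1 + A 1 0 + A 1 1).toNat using Nat.strong_induction_on
    generalizing A with
  | _ n ih =>
    have hpos := hA.diag_pos
    obtain ⟨h1, h2, h3, h4⟩ := id hA
    have hd := sl_det_eq A
    obtain ⟨T1, T2, T3, T4⟩ := slLetter_true_apply
    obtain ⟨L1, L2, L3, L4⟩ := slLetter_false_apply
    obtain ⟨Ti1, Ti2, Ti3, Ti4⟩ := sl_inv_apply (slLetter true)
    obtain ⟨Li1, Li2, Li3, Li4⟩ := sl_inv_apply (slLetter false)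
    have step : ∀ x, SLNonneg ((slLetter x)⁻¹ * A) →
        ((slLetter x)⁻¹ * A) 0 0 + ((slLetter x)⁻¹ * A) 0 1 + ((slLetter x)⁻¹ * A) 1 0 +
        ((slLetter x)⁻¹ * A) 1 1 < A 0 0 + A 0 1 + A 1 0 + A 1 1 →
        ∃ l : List Bool, A = (l.map slLetter).prod := by
      intro x hx hlt
      obtain ⟨l, hl⟩ := ih _ (by omega) hx rfl
      refine ⟨x :: l, ?_⟩
      rw [List.map_cons, List.prod_cons, ← hl, mul_inv_cancel_left]
    by_cases hT : A 1 0 ≤ A 0 0 ∧ A 1 1 ≤ A 0 1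
    · refine step true ?_ ?_
      · simp only [SLNonneg, sl_mul_apply, Ti1, Ti2, Ti3, Ti4, T1, T2, T3, T4]
        refine ⟨?_, ?_, ?_, ?_⟩ <;> linarith [hT.1, hT.2]
      · simp only [sl_mul_apply, Ti1, Ti2, Ti3, Ti4, T1, T2, T3, T4]
        linarith
    by_cases hL : A 0 0 ≤ A 1 0 ∧ A 0 1 ≤ A 1 1
    · refine step false ?_ ?_
      · simp only [SLNonneg, sl_mul_apply, Li1, Li2, Li3, Li4, L1, L2, L3, L4]
        refine ⟨?_, ?_, ?_, ?_⟩ <;> linarith [hL.1, hL.2]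
      · simp only [sl_mul_apply, Li1, Li2, Li3, Li4, L1, L2, L3, L4]
        linarith
    refine ⟨[], ?_⟩
    obtain ⟨O1, O2, O3, O4⟩ := sl_one_apply
    obtain ⟨hb, hc⟩ := offDiag_eq_zero_of_det h2 h3 hpos.2 hd hT hL
    rcases eq_one_or_eq_neg_one_of_entries hb hc with h | h
    · simpa using h
    · have := hpos.1
      rw [h, sl_neg_apply, O1] at this
      omega

/-- The letter at position `s` of the periodic word obtained by repeating `l`. -/
def periodicLetter (l : List Bool) (s : ℤ) : Bool := l.getD (s % l.length).toNat true

/-- The product of the first `s` letters of the periodic word obtained by repeating `l`. -/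
def periodicProd (l : List Bool) (s : ℤ) : SL(2, ℤ) :=
  (l.map slLetter).prod ^ (s / l.length) * ((l.take (s % l.length).toNat).map slLetter).prod

theorem isLetterProduct_periodic {l : List Bool} (hl : l ≠ []) :
    IsLetterProduct (periodicLetter l) (periodicProd l) := by
  intro s
  have hN : 0 < l.length := List.length_pos_iff.2 hl
  have hN' : (0 : ℤ) < l.length := by exact_mod_cast hN
  have e1 := Int.emod_add_mul_ediv s l.length
  have e2 := Int.emod_nonneg s hN'.ne'
  have e3 := Int.emod_lt_of_pos s hN'
  rw [periodicProd, periodicProd, periodicLetter]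
  obtain ⟨r, hr⟩ := Int.eq_ofNat_of_zero_le e2
  generalize s / (l.length : ℤ) = q at *
  rw [hr] at e1 e3 ⊢
  have hr' : r < l.length := by exact_mod_cast e3
  have htake : ((l.take (r + 1)).map slLetter).prod =
      ((l.take r).map slLetter).prod * slLetter (l.getD r true) := by
    rw [← List.take_concat_get' _ _ hr', List.map_append, List.prod_append]
    simp [hr']
  rw [Int.toNat_natCast, mul_assoc, ← htake]
  by_cases h : r + 1 < l.length
  · have q1 : (s + 1) / (l.length : ℤ) = q := by
      rw [← e1, show (r : ℤ) + l.length * q + 1 = ((r + 1 : ℕ) : ℤ) + l.length * q by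
        push_cast; ring, Int.add_mul_ediv_left _ _ hN'.ne', Int.ediv_eq_zero_of_lt (by omega)
        (by omega), zero_add]
    have q2 : (s + 1) % (l.length : ℤ) = (r + 1 : ℕ) := by
      rw [← e1, show (r : ℤ) + l.length * q + 1 = ((r + 1 : ℕ) : ℤ) + l.length * q by
        push_cast; ring, Int.add_mul_emod_self_left, Int.emod_eq_of_lt (by omega) (by omega)]
    rw [q1, q2, Int.toNat_natCast]
  · have hr2 : r + 1 = l.length := by omega
    have e4 : s + 1 = l.length * (q + 1) := by
      rw [← e1, ← hr2]; push_cast; ring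
    rw [e4, Int.mul_ediv_cancel_left _ hN'.ne', Int.mul_emod_right, hr2]
    simp [zpow_add_one]

theorem periodicProd_add (l : List Bool) (hl : l ≠ []) (s : ℤ) :
    periodicProd l (s + l.length) = (l.map slLetter).prod * periodicProd l s := by
  have hN' : (0 : ℤ) < l.length := by exact_mod_cast List.length_pos_iff.2 hl
  rw [periodicProd, periodicProd, Int.add_emod_right, Int.add_ediv_of_dvd_right (dvd_refl _),
    Int.ediv_self hN'.ne', add_comm, zpow_add, zpow_one, mul_assoc]

theorem periodicProd_zero (l : List Bool) : periodicProd l 0 = 1 := by simp [periodicProd]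

namespace IsLetterProduct

variable {w : ℤ → Bool} {G : ℤ → SL(2, ℤ)} (hG : IsLetterProduct w G)
include hG

theorem shift (s₀ : ℤ) : IsLetterProduct (fun s => w (s + s₀)) (fun s => G (s + s₀)) := by
  intro s
  simp only
  rw [← hG, add_right_comm]

theorem inv_mul_of_const_true (h : ∀ s, w s = true) (n : ℕ) : ((G 0)⁻¹ * G n) 1 0 = 0 := by
  obtain ⟨T1, T2, T3, T4⟩ := slLetter_true_apply
  induction n with
  | zero => simp [sl_one_apply.2.2.1]
  | succ n ih =>
    rw [Nat.cast_succ, hG.inv_mul_succ, h, sl_mul_apply, T1, T3, ih]; ring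

theorem inv_mul_of_const_false (h : ∀ s, w s = false) (n : ℕ) : ((G 0)⁻¹ * G n) 0 1 = 0 := by
  obtain ⟨T1, T2, T3, T4⟩ := slLetter_false_apply
  induction n with
  | zero => simp [sl_one_apply.2.1]
  | succ n ih =>
    rw [Nat.cast_succ, hG.inv_mul_succ, h, sl_mul_apply, T2, T4, ih]; ring

theorem exists_switch {A : SL(2, ℤ)} {N : ℕ} (hN : 0 < N) (hp : ∀ s, G (s + N) = A * G s)
    (h0 : G 0 = 1) (hA : ∀ i j, 0 < A i j) : ∃ s, w (s - 1) = false ∧ w s = true := by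
  have hGN : (G 0)⁻¹ * G N = A := by
    have := hp 0
    rw [zero_add] at this
    rw [this, h0]; simp
  obtain ⟨p, hpf⟩ : ∃ p, w p = false := by
    by_contra! hcon
    have := hG.inv_mul_of_const_true (fun s => by simpa using hcon s) N
    rw [hGN] at this
    exact (hA 1 0).ne' this
  obtain ⟨q, hq⟩ : ∃ q, w q = true := by
    by_contra! hcon
    have := hG.inv_mul_of_const_false (fun s => by simpa using hcon s) N
    rw [hGN] at this
    exact (hA 0 1).ne' this
  by_contra! hcon
  have hall : ∀ t, p ≤ t → w t = false := by
    intro t ht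
    induction t, ht using Int.leInduction with
    | base => exact hpf
    | succ t _ ih =>
      have := hcon (t + 1) (by rwa [add_sub_cancel_right])
      simpa using this
  have h1 := hG.period_letter hp q (|p| + |q|)
  rw [hall, hq] at h1
  · exact absurd h1 (by simp)
  · have := le_abs_self p
    have := neg_abs_le q
    have : (1 : ℤ) ≤ N := by exact_mod_cast hN
    nlinarith [abs_nonneg p, abs_nonneg q]

theorem period_pos {A : SL(2, ℤ)} {N : ℕ} (hN : 0 < N) (hp : ∀ s, G (s + N) = A * G s)
    (h0 : w (-1) = false) (h1 : w 0 = true) (i j : Fin 2) : 0 < ((G 0)⁻¹ * A * G 0) i j := by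
  obtain ⟨T1, T2, T3, T4⟩ := slLetter_true_apply
  obtain ⟨L1, L2, L3, L4⟩ := slLetter_false_apply
  have q2 : w (N - 1) = false := by
    have := hG.period_letter hp (-1) 1
    rw [h0] at this
    rw [← this]; congr 1; ring
  have hN2 : (1 : ℤ) ≤ N - 1 := by
    by_contra! hcon
    have : (N : ℤ) - 1 = 0 := by omega
    rw [this, h1] at q2
    exact absurd q2 (by simp)
  have e : (G 0)⁻¹ * A * G 0 = slLetter true * ((G 1)⁻¹ * G (N - 1)) * slLetter false := by
    have e1 := hp 0
    have e2 := hG.inv_mul_succ 0 (N - 1)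
    have e3 := hG.inv_mul_eq 0 (N - 1)
    rw [h1, zero_add] at e3
    rw [q2, e3, sub_add_cancel] at e2
    rw [zero_add] at e1
    rw [← e2, e1, mul_assoc]
  rw [e]
  have hM := hG.nonneg hN2
  have hM' := hM.diag_pos
  generalize (G 1)⁻¹ * G (N - 1) = M at hM hM' ⊢
  obtain ⟨m1, m2, m3, m4⟩ := hM
  refine sl_forall_pos ?_ ?_ ?_ ?_ i j <;>
    simp only [sl_mul_apply, T1, T2, T3, T4, L1, L2, L3, L4] <;> linarith [hM'.1, hM'.2]

end IsLetterProduct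

/-- The constant in the bound for the traces of curves with few self-crossings. -/
noncomputable def traceConst : ℝ := 12 * Fintype.card SL(2, ZMod 2) + 2

theorem traceConst_pos : 0 < traceConst := by rw [traceConst]; positivity

namespace CrossBound

theorem trace_le_of_three_le {γ : ℝ → ℍ} {h : SL(2, ℤ)} {K : ℕ} (hγ : CrossBound γ h K)
    (hK : 1 ≤ K) (ht : 3 ≤ h 0 0 + h 1 1) :
    ((h 0 0 + h 1 1 : ℤ) : ℝ) ≤ 2 * Real.exp (traceConst * √K) := by
  obtain ⟨g, hg⟩ := exists_conj_pos ht
  have hγ' := hγ.conj g⁻¹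
  rw [inv_inv] at hγ'
  rw [← sl_trace_conj g h]
  set A := g⁻¹ * h * g with hA
  obtain ⟨l, hl⟩ := SLNonneg.exists_word (A := A)
    ⟨(hg 0 0).le, (hg 0 1).le, (hg 1 0).le, (hg 1 1).le⟩
  have hl0 : l ≠ [] := by
    rintro rfl
    have := hg 0 1
    rw [hl] at this
    simp [sl_one_apply.2.1] at this
  have hN : 0 < l.length := List.length_pos_iff.2 hl0
  have hG := isLetterProduct_periodic hl0
  have hp := periodicProd_add l hl0
  rw [← hl] at hp
  obtain ⟨s₀, h1, h2⟩ := hG.exists_switch hN hp (periodicProd_zero l) hg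
  have hG' := hG.shift s₀
  have hp' : ∀ s : ℤ, periodicProd l (s + l.length + s₀) = A * periodicProd l (s + s₀) := by
    intro s
    rw [← hp]; congr 1; ring
  have h1' : periodicLetter l (-1 + s₀) = false := by rw [← h1]; congr 1; ring
  have h2' : periodicLetter l (0 + s₀) = true := by rw [← h2]; congr 1; ring
  exact hG'.trace_le hγ' hN hp' (hG'.period_pos hN hp' h1' h2') h1' h2' hK

theorem abs_trace_le {γ : ℝ → ℍ} {h : SL(2, ℤ)} {K : ℕ} (hγ : CrossBound γ h K) (hK : 1 ≤ K) :
    |((h 0 0 + h 1 1 : ℤ) : ℝ)| ≤ 2 * Real.exp (traceConst * √K) := by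
  have h1 : (1 : ℝ) ≤ Real.exp (traceConst * √K) :=
    Real.one_le_exp (mul_nonneg traceConst_pos.le (Real.sqrt_nonneg _))
  rcases le_or_gt 3 (h 0 0 + h 1 1) with h3 | h3
  · rw [abs_of_nonneg (by exact_mod_cast (by omega : 0 ≤ h 0 0 + h 1 1))]
    exact hγ.trace_le_of_three_le hK h3
  rcases le_or_gt (h 0 0 + h 1 1) (-3) with h4 | h4
  · rw [abs_of_nonpos (by exact_mod_cast (by omega : h 0 0 + h 1 1 ≤ 0))]
    have := hγ.neg.trace_le_of_three_le hK (by rw [sl_neg_apply, sl_neg_apply]; omega)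
    rw [sl_neg_apply, sl_neg_apply] at this
    push_cast at this ⊢
    linarith
  · have : |((h 0 0 + h 1 1 : ℤ) : ℝ)| ≤ 2 := by
      rw [abs_le]; constructor <;> exact_mod_cast (by omega)
    linarith

end CrossBound

end

section

open UpperHalfPlane CongruenceSubgroup MatrixGroups

theorem sl_T_zpow_apply (n : ℤ) : (ModularGroup.T ^ n) 0 0 = 1 ∧ (ModularGroup.T ^ n) 0 1 = n ∧
    (ModularGroup.T ^ n) 1 0 = 0 ∧ (ModularGroup.T ^ n) 1 1 = 1 := by
  have e := ModularGroup.coe_T_zpow n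
  refine ⟨?_, ?_, ?_, ?_⟩ <;> rw [e] <;> simp

theorem sl_T_zpow_injective {m n : ℤ} (h : ModularGroup.T ^ m = ModularGroup.T ^ n) : m = n := by
  rw [← (sl_T_zpow_apply m).2.1, h, (sl_T_zpow_apply n).2.1]

theorem sl_T_zpow_ne_neg (m n : ℤ) : ModularGroup.T ^ m ≠ -ModularGroup.T ^ n := by
  intro h
  have h1 := (sl_T_zpow_apply m).1
  rw [h, sl_neg_apply, (sl_T_zpow_apply n).1] at h1
  omega

theorem coe_T_zpow_smul (n : ℤ) (z : ℍ) :
    ((ModularGroup.T ^ n • z : ℍ) : ℂ) = z + ((n : ℝ) : ℂ) := by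
  have h1 := ModularGroup.re_T_zpow_smul z (n := n)
  have h2 := ModularGroup.im_T_zpow_smul z (n := n)
  generalize ModularGroup.T ^ n • z = w at *
  apply Complex.ext
  · simpa using h1
  · simpa using h2

theorem CrossBound.natAbs_le_of_T_zpow {γ : ℝ → ℍ} {N : ℤ} {K : ℕ}
    (hγ : CrossBound γ (ModularGroup.T ^ N) K) : N.natAbs ≤ 2 * K + 3 := by
  rcases eq_or_ne N 0 with rfl | hN
  · simp
  have key := hγ.card_le ((Finset.Ico 1 ((N.natAbs + 1) / 2)).image fun j : ℕ => ((j : ℤ), (0 : ℤ)))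
    (fun i => ModularGroup.T ^ (2 * i.1)) ?_ ?_ ?_ ?_
  · rw [Finset.card_image_of_injective _ fun a b h => by simpa using h, Nat.card_Ico] at key
    omega
  · intro i _
    exact T_zpow_mem_gamma_two (even_two_mul _)
  · intro i _
    obtain ⟨t, u, h⟩ := exists_eq_add_of_translation (γ := fun t => (γ t : ℂ)) (N := N)
      (UpperHalfPlane.continuous_coe.comp hγ.continuous) (by exact_mod_cast hN) (fun t => by
        have := hγ.map_add_one t
        rw [this]
        rw [coe_T_zpow_smul]) ((2 * i.1 : ℤ) : ℝ)
    refine ⟨t, u, ?_⟩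
    apply UpperHalfPlane.ext
    rw [coe_T_zpow_smul]
    exact h
  · intro i hi a
    obtain ⟨j, hj, rfl⟩ := Finset.mem_image.1 hi
    rw [Finset.mem_Ico] at hj
    simp only [← zpow_mul]
    refine ⟨fun h => ?_, sl_T_zpow_ne_neg _ _⟩
    have e := sl_T_zpow_injective h
    have : N ∣ 2 * (j : ℤ) := ⟨a, e⟩
    have := Int.natAbs_le_of_dvd_ne_zero this (by omega)
    omega
  · intro i hi i' hi' a b h
    obtain ⟨j, hj, rfl⟩ := Finset.mem_image.1 hi
    obtain ⟨j', hj', rfl⟩ := Finset.mem_image.1 hi'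
    rw [Finset.mem_Ico] at hj hj'
    simp only [← zpow_mul, ← zpow_add] at h
    have e := sl_T_zpow_injective (h.resolve_right (sl_T_zpow_ne_neg _ _))
    by_contra hne
    have hne' : j ≠ j' := fun h => hne (by rw [h])
    have : N ∣ 2 * (j : ℤ) - 2 * j' := ⟨a + b, by linear_combination e⟩
    have := Int.natAbs_le_of_dvd_ne_zero this (by omega)
    omega

/-- The trace of an element of `SL(2, ℤ)`. -/
def slTrace (A : SL(2, ℤ)) : ℤ := A 0 0 + A 1 1

/-- The negative of the determinant of the additive commutator of `A` and `B`, in terms of traces. -/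
def slFricke (A B : SL(2, ℤ)) : ℤ := slTrace A ^ 2 + slTrace B ^ 2 + slTrace (A * B) ^ 2 -
  slTrace A * slTrace B * slTrace (A * B) - 4

theorem slTrace_conj (g A : SL(2, ℤ)) : slTrace (g⁻¹ * A * g) = slTrace A := sl_trace_conj g A

theorem slFricke_conj (g A B : SL(2, ℤ)) : slFricke (g⁻¹ * A * g) (g⁻¹ * B * g) = slFricke A B := by
  have : g⁻¹ * A * g * (g⁻¹ * B * g) = g⁻¹ * (A * B) * g := by group
  simp only [slFricke, this, slTrace_conj]

theorem slFricke_eq (A B : SL(2, ℤ)) : slFricke A B = (A 0 1 * B 1 0 - B 0 1 * A 1 0) ^ 2 +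
    ((A 0 0 - A 1 1) * B 0 1 - (B 0 0 - B 1 1) * A 0 1) *
    (A 1 0 * (B 0 0 - B 1 1) - B 1 0 * (A 0 0 - A 1 1)) := by
  have hA := sl_det_eq A
  have hB := sl_det_eq B
  simp only [slFricke, slTrace, sl_mul_apply]
  generalize A 0 0 = a at *
  generalize A 0 1 = b at *
  generalize A 1 0 = c at *
  generalize A 1 1 = d at *
  generalize B 0 0 = a' at *
  generalize B 0 1 = b' at *
  generalize B 1 0 = c' at *
  generalize B 1 1 = d' at *
  linear_combination (-(a' + d') ^ 2 + 4 * (a' * d' - b' * c')) * hA + (-(a + d) ^ 2 + 4) * hB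

theorem eq_zero_of_trace_eq_zero {a b c d a' b' c' d' x y z w : ℤ}
    (hD : (b * c' - b' * c) ^ 2 + ((a - d) * b' - (a' - d') * b) * (c * (a' - d') - c' * (a - d)) ≠ 0)
    (h1 : x + w = 0) (h2 : a * x + b * z + c * y + d * w = 0)
    (h3 : a' * x + b' * z + c' * y + d' * w = 0)
    (h4 : (a * a' + b * c') * x + (a * b' + b * d') * z + (c * a' + d * c') * y +
      (c * b' + d * d') * w = 0) : x = 0 ∧ y = 0 ∧ z = 0 := by
  obtain rfl : w = -x := by linarith
  have r1 : (a - d) * x + c * y + b * z = 0 := by linarith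
  have r2 : (a' - d') * x + c' * y + b' * z = 0 := by linarith
  have r3 : 2 * (b * c' - b' * c) * x + (c * (a' - d') - c' * (a - d)) * y +
      ((a - d) * b' - (a' - d') * b) * z = 0 := by
    linear_combination 2 * h4 - (a + d) * r2 - (a' + d') * r1
  clear h1 h2 h3 h4
  generalize hp : a - d = p at *
  generalize hp' : a' - d' = p' at *
  have h2D : 2 * ((b * c' - b' * c) ^ 2 + (p * b' - p' * b) * (c * p' - c' * p)) ≠ 0 :=
    mul_ne_zero two_ne_zero hD
  refine ⟨(mul_eq_zero.1 (?_ : _ * x = 0)).resolve_left h2D,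
    (mul_eq_zero.1 (?_ : _ * y = 0)).resolve_left h2D,
    (mul_eq_zero.1 (?_ : _ * z = 0)).resolve_left h2D⟩
  · linear_combination -(c' * (p * b' - p' * b) - b' * (c * p' - c' * p)) * r1 -
      ((c * p' - c' * p) * b - (p * b' - p' * b) * c) * r2 - (c * b' - b * c') * r3
  · linear_combination -(b' * (2 * (b * c' - b' * c)) - p' * (p * b' - p' * b)) * r1 -
      ((p * b' - p' * b) * p - (2 * (b * c' - b' * c)) * b) * r2 - (b * p' - p * b') * r3
  · linear_combination -(p' * (c * p' - c' * p) - c' * (2 * (b * c' - b' * c))) * r1 -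
      ((2 * (b * c' - b' * c)) * c - (c * p' - c' * p) * p) * r2 - (p * c' - c * p') * r3

theorem sl_eq_of_slTrace_eq {A B X Y : SL(2, ℤ)} (hD : slFricke A B ≠ 0)
    (h1 : slTrace X = slTrace Y) (h2 : slTrace (A * X) = slTrace (A * Y))
    (h3 : slTrace (B * X) = slTrace (B * Y))
    (h4 : slTrace (A * B * X) = slTrace (A * B * Y)) : X = Y := by
  rw [slFricke_eq] at hD
  simp only [slTrace, sl_mul_apply] at h1 h2 h3 h4
  obtain ⟨e1, e2, e3⟩ := eq_zero_of_trace_eq_zero (x := X 0 0 - Y 0 0) (y := X 0 1 - Y 0 1)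
    (z := X 1 0 - Y 1 0) (w := X 1 1 - Y 1 1) hD (by linarith) (by linarith) (by linarith)
    (by linarith)
  exact sl_ext (by linarith) (by linarith) (by linarith) (by linarith)

theorem not_isSquare_sq_sub_four {t s : ℤ} (ht : 3 ≤ |t|) : t ^ 2 - 4 ≠ s ^ 2 := by
  intro h
  rw [← sq_abs t, ← sq_abs s] at h
  have := abs_nonneg s
  generalize |t| = t at *
  generalize |s| = s at *
  have h1 : s < t := by nlinarith
  have h2 : t - 1 ≤ s := by nlinarith
  have : s = t - 1 := by omega
  subst this
  have : 2 * t = 5 := by linarith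
  omega

theorem eq_zero_of_not_isSquare {Δ n s : ℤ} (hΔ : ∀ r, Δ ≠ r ^ 2) (h : Δ * n ^ 2 = s ^ 2) :
    n = 0 := by
  by_contra hn
  obtain ⟨r, rfl⟩ := (Int.pow_dvd_pow_iff two_ne_zero).1 (Dvd.intro_left _ h)
  have : n ^ 2 ≠ 0 := pow_ne_zero _ hn
  exact hΔ r (mul_right_cancel₀ this (by linear_combination h))

theorem entries_eq_zero_of_isotropic {p b c n₁ n₂ n₃ : ℤ} (hΔ : ∀ r, p ^ 2 + 4 * (b * c) ≠ r ^ 2)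
    (h : n₁ ^ 2 + n₂ * n₃ = 0) (h' : p * n₁ + c * n₂ + b * n₃ = 0) : n₁ = 0 ∧ n₂ = 0 ∧ n₃ = 0 := by
  have h3 : n₃ = 0 := eq_zero_of_not_isSquare (s := 2 * c * n₁ - p * n₃) hΔ
    (by linear_combination (-4 * c ^ 2) * h + 4 * c * n₃ * h')
  have h2 : n₂ = 0 := eq_zero_of_not_isSquare (s := 2 * b * n₁ - p * n₂) hΔ
    (by linear_combination (-4 * b ^ 2) * h + 4 * b * n₂ * h')
  subst h2 h3
  refine ⟨?_, rfl, rfl⟩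
  simpa using h

theorem eq_zero_of_proportional {p b c x y z : ℤ} (hΔ : p ^ 2 + 4 * (b * c) ≠ 0) (h1 : b * z = y * c)
    (h2 : p * y = 2 * x * b) (h3 : c * (2 * x) = z * p) (h4 : p * x + b * z + c * y = 0) :
    x = 0 ∧ y = 0 ∧ z = 0 := by
  have hx : x = 0 := (mul_eq_zero.1 (?_ : _ * x = 0)).resolve_left hΔ
  · subst hx
    refine ⟨rfl, (mul_eq_zero.1 (?_ : _ * y = 0)).resolve_left hΔ,
      (mul_eq_zero.1 (?_ : _ * z = 0)).resolve_left hΔ⟩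
    · linear_combination p * h2 + 2 * b * h4 - 2 * b * h1
    · linear_combination -p * h3 + 2 * c * h4 + 2 * c * h1
  · linear_combination p * h4 + b * h3 - c * h2

theorem sl_commute_entries {A B : SL(2, ℤ)} (hA : 3 ≤ |slTrace A|) (h : slFricke A B = 0) :
    A 0 1 * B 1 0 - B 0 1 * A 1 0 = 0 ∧ (A 0 0 - A 1 1) * B 0 1 - (B 0 0 - B 1 1) * A 0 1 = 0 ∧
    A 1 0 * (B 0 0 - B 1 1) - B 1 0 * (A 0 0 - A 1 1) = 0 := by
  rw [slFricke_eq] at h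
  have hd := sl_det_eq A
  refine entries_eq_zero_of_isotropic (p := A 0 0 - A 1 1) (b := A 0 1) (c := A 1 0)
    (fun r hr => not_isSquare_sq_sub_four (s := r) hA ?_) h (by ring)
  rw [← hr, slTrace]
  linear_combination 4 * hd

theorem sl_eq_of_commute {A X Y : SL(2, ℤ)} (hA : 3 ≤ |slTrace A|) (hX : slFricke A X = 0)
    (hY : slFricke A Y = 0) (h1 : slTrace X = slTrace Y)
    (h2 : slTrace (A * X) = slTrace (A * Y)) : X = Y := by
  obtain ⟨x1, x2, x3⟩ := sl_commute_entries hA hX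
  obtain ⟨y1, y2, y3⟩ := sl_commute_entries hA hY
  have hd := sl_det_eq A
  have hΔ : (A 0 0 - A 1 1) ^ 2 + 4 * (A 0 1 * A 1 0) ≠ 0 := by
    intro h0
    refine not_isSquare_sq_sub_four (s := 0) hA ?_
    rw [slTrace]
    linear_combination h0 + 4 * hd
  simp only [slTrace, sl_mul_apply] at h1 h2
  have e : X 1 1 - Y 1 1 = -(X 0 0 - Y 0 0) := by linarith
  obtain ⟨e1, e2, e3⟩ := eq_zero_of_proportional (x := X 0 0 - Y 0 0) (y := X 0 1 - Y 0 1)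
    (z := X 1 0 - Y 1 0) hΔ (by linear_combination x1 - y1)
    (by linear_combination x2 - y2 - A 0 1 * e) (by linear_combination x3 - y3 + A 1 0 * e)
    (by linear_combination h2 - A 1 1 * e)
  exact sl_ext (by linarith) (by linarith) (by linarith) (by linarith)

theorem slTrace_eq_of_mem_gammaTwo {A : SL(2, ℤ)} (hA : A ∈ Gamma 2) (h : |slTrace A| ≤ 2) :
    slTrace A ^ 2 = 4 := by
  obtain ⟨⟨a, ha⟩, ⟨b, hb⟩, ⟨c, hc⟩, ⟨d, hd⟩⟩ := (mem_gamma_two_iff A).1 hA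
  have hdet := sl_det_eq A
  rw [slTrace] at h ⊢
  rw [ha, hb, hc, hd] at hdet
  rw [ha, hd] at h ⊢
  have h1 : a + d = 2 * (b * c - a * d) := by linarith
  rw [abs_le] at h
  generalize b * c - a * d = e at h1
  have h2 : 2 * a + 1 + (2 * d + 1) = 4 * e + 2 := by linarith
  rw [h2] at h ⊢
  obtain rfl | rfl : e = 0 ∨ e = -1 := by omega
  · norm_num
  · norm_num

end

section

open UpperHalfPlane CongruenceSubgroup MatrixGroups

theorem Finset.card_le_of_injOn_prod {ι : Type*} {s : Finset ι} {f : ι → ℤ × ℤ} {M : ℕ}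
    (hf : ∀ i ∈ s, |(f i).1| ≤ M ∧ |(f i).2| ≤ M) (hinj : Set.InjOn f s) :
    s.card ≤ (2 * M + 1) ^ 2 := by
  have := Finset.card_le_card_of_injOn (t := Finset.Icc (-M : ℤ) M ×ˢ Finset.Icc (-M : ℤ) M) f
    (fun i hi => by
      obtain ⟨h1, h2⟩ := hf i hi
      rw [abs_le] at h1 h2
      simp [Prod.le_def, h1, h2]) hinj
  rw [Finset.card_product, Int.card_Icc] at this
  have e : ((M : ℤ) + 1 - -M).toNat = 2 * M + 1 := by omega
  rw [e] at this
  rwa [sq]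

theorem Finset.card_le_of_injOn_prod_prod {ι : Type*} {s : Finset ι} {f : ι → (ℤ × ℤ) × ℤ × ℤ} {M : ℕ}
    (hf : ∀ i ∈ s, (|(f i).1.1| ≤ M ∧ |(f i).1.2| ≤ M) ∧ |(f i).2.1| ≤ M ∧ |(f i).2.2| ≤ M)
    (hinj : Set.InjOn f s) :
    s.card ≤ (2 * M + 1) ^ 4 := by
  have := Finset.card_le_card_of_injOn
    (t := (Finset.Icc (-M : ℤ) M ×ˢ Finset.Icc (-M : ℤ) M) ×ˢ
      Finset.Icc (-M : ℤ) M ×ˢ Finset.Icc (-M : ℤ) M) f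
    (fun i hi => by
      obtain ⟨⟨h1, h2⟩, h3, h4⟩ := hf i hi
      rw [abs_le] at h1 h2 h3 h4
      simp [Prod.le_def, h1, h2, h3, h4]) hinj
  rw [Finset.card_product, Finset.card_product, Int.card_Icc] at this
  have e : ((M : ℤ) + 1 - -M).toNat = 2 * M + 1 := by omega
  rw [e] at this
  linarith [pow_succ (2 * M + 1) 3, show (2 * M + 1) ^ 4 = (2 * M + 1) * (2 * M + 1) * ((2 * M + 1) * (2 * M + 1)) by ring]

/-- A conjugate of a nontrivial parabolic element that is upper triangular. -/
theorem exists_conj_upper {A : SL(2, ℤ)} (hA : slTrace A ^ 2 = 4) :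
    ∃ g : SL(2, ℤ), (g⁻¹ * A * g) 1 0 = 0 := by
  obtain ⟨g, hg⟩ := exists_conj_reduced A
  refine ⟨g, hg.resolve_right ?_⟩
  rintro ⟨hc, h1, h2⟩
  have hd := sl_det_eq (g⁻¹ * A * g)
  rw [← slTrace_conj g, slTrace] at hA
  generalize g⁻¹ * A * g = B at *
  generalize B 0 0 = a at *
  generalize B 0 1 = b at *
  generalize B 1 0 = c at *
  generalize B 1 1 = d at *
  have k1 : (a - d) ^ 2 ≤ c ^ 2 := sq_le_sq.2 h1
  have k3 : 0 < c ^ 2 := by positivity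
  have k4 : c ^ 2 ≤ |b * c| := by rw [abs_mul, ← sq_abs c, sq]; gcongr
  have k5 : 4 * (b * c) = -(a - d) ^ 2 := by linear_combination hA - 4 * hd
  rw [abs_of_nonpos (by nlinarith)] at k4
  linarith

theorem CrossBound.eq_T_zpow {γ : ℝ → ℍ} {h : SL(2, ℤ)} {K : ℕ} (hγ : CrossBound γ h K)
    (hc : h 1 0 = 0) : ∃ n : ℤ, n.natAbs ≤ 2 * K + 3 ∧
      (h = ModularGroup.T ^ n ∨ h = -ModularGroup.T ^ n) := by
  have hd := sl_det_eq h
  rw [hc, mul_zero, sub_zero] at hd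
  rcases Int.mul_eq_one_iff_eq_one_or_neg_one.1 hd with ⟨h1, h2⟩ | ⟨h1, h2⟩
  · have e : h = ModularGroup.T ^ (h 0 1) := by
      obtain ⟨t1, t2, t3, t4⟩ := sl_T_zpow_apply (h 0 1)
      exact sl_ext (by rw [t1, h1]) t2.symm (by rw [t3, hc]) (by rw [t4, h2])
    generalize h 0 1 = n at e
    subst e
    exact ⟨n, hγ.natAbs_le_of_T_zpow, Or.inl rfl⟩
  · have e : h = -ModularGroup.T ^ (-h 0 1) := by
      obtain ⟨t1, t2, t3, t4⟩ := sl_T_zpow_apply (-h 0 1)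
      refine sl_ext ?_ ?_ ?_ ?_ <;> rw [sl_neg_apply]
      · rw [t1, h1]
      · rw [t2, neg_neg]
      · rw [t3, hc, neg_zero]
      · rw [t4, h2]
    generalize -h 0 1 = n at e
    subst e
    have := hγ.neg
    rw [neg_neg] at this
    exact ⟨n, this.natAbs_le_of_T_zpow, Or.inr rfl⟩

section Family

variable {m K : ℕ} {h : Fin m → SL(2, ℤ)}

/-- Families consisting of commuting parabolic elements have linear size. -/
theorem card_le_of_parabolic (hne : ∀ i j, i ≠ j → h i ≠ h j ∧ h i ≠ -h j)
    (h1 : ∀ i, ∃ γ, CrossBound γ (h i) K) (ht : ∀ i, slTrace (h i) ^ 2 = 4)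
    (hF : ∀ i j, slFricke (h i) (h j) = 0) : m ≤ 4 * K + 8 := by
  by_cases hm : m ≤ 1
  · omega
  obtain ⟨i, hi⟩ : ∃ i, h i ≠ 1 ∧ h i ≠ -1 := by
    by_contra! hcon
    have h01 := hne ⟨0, by omega⟩ ⟨1, by omega⟩ (by simp)
    have a0 := hcon ⟨0, by omega⟩
    have a1 := hcon ⟨1, by omega⟩
    generalize h ⟨0, by omega⟩ = x at *
    generalize h ⟨1, by omega⟩ = y at *
    by_cases hx : x = 1 <;> by_cases hy : y = 1
    · exact h01.1 (hx.trans hy.symm)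
    · exact h01.2 (by rw [hx, a1 hy, neg_neg])
    · exact h01.2 (by rw [hy, a0 hx])
    · exact h01.1 ((a0 hx).trans (a1 hy).symm)
  obtain ⟨g, hg⟩ := exists_conj_upper (ht i)
  have hb : (g⁻¹ * h i * g) 0 1 ≠ 0 := by
    intro hb
    rcases eq_one_or_eq_neg_one_of_entries hb hg with e | e
    · refine hi.1 ?_
      have : h i = g * (g⁻¹ * h i * g) * g⁻¹ := by group
      rw [this, e]; group
    · refine hi.2 ?_
      have : h i = g * (g⁻¹ * h i * g) * g⁻¹ := by group
      rw [this, e]; simp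
  have had : (g⁻¹ * h i * g) 0 0 = (g⁻¹ * h i * g) 1 1 := by
    have hd := sl_det_eq (g⁻¹ * h i * g)
    rw [hg, mul_zero, sub_zero] at hd
    rcases Int.mul_eq_one_iff_eq_one_or_neg_one.1 hd with ⟨h1, h2⟩ | ⟨h1, h2⟩ <;> rw [h1, h2]
  have hcj : ∀ j, (g⁻¹ * h j * g) 1 0 = 0 := by
    intro j
    have e := hF i j
    rw [← slFricke_conj g, slFricke_eq, hg, had] at e
    have e' : ((g⁻¹ * h i * g) 0 1 * (g⁻¹ * h j * g) 1 0) ^ 2 = 0 := by linear_combination e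
    exact (mul_eq_zero.1 (pow_eq_zero_iff two_ne_zero |>.1 e')).resolve_left hb
  have hex : ∀ j, ∃ n : ℤ, n.natAbs ≤ 2 * K + 3 ∧
      (g⁻¹ * h j * g = ModularGroup.T ^ n ∨ g⁻¹ * h j * g = -ModularGroup.T ^ n) := by
    intro j
    obtain ⟨γ, hγ⟩ := h1 j
    have := hγ.conj g⁻¹
    rw [inv_inv] at this
    exact this.eq_T_zpow (hcj j)
  choose n hn hn' using hex
  have hinj : Function.Injective n := by
    intro j l hjl
    by_contra hjl'
    have key : g⁻¹ * h j * g = g⁻¹ * h l * g ∨ g⁻¹ * h j * g = -(g⁻¹ * h l * g) := by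
      have e1 := hn' j
      have e2 := hn' l
      rw [hjl] at e1
      generalize ModularGroup.T ^ n l = u at e1 e2
      rcases e1 with e1 | e1 <;> rcases e2 with e2 | e2 <;> rw [e1, e2] <;> simp
    have ej : h j = g * (g⁻¹ * h j * g) * g⁻¹ := by group
    have el : h l = g * (g⁻¹ * h l * g) * g⁻¹ := by group
    rcases key with key | key
    · exact (hne j l hjl').1 (by rw [ej, key, ← el])
    · refine (hne j l hjl').2 ?_
      rw [ej, key, mul_neg, neg_mul, ← el]
  have := Finset.card_le_card_of_injOn (s := Finset.univ)
    (t := Finset.Icc (-(2 * K + 3 : ℕ) : ℤ) (2 * K + 3 : ℕ)) n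
    (fun j _ => by have := hn j; simp only [Finset.coe_Icc, Set.mem_Icc]; omega) hinj.injOn
  rw [Finset.card_univ, Fintype.card_fin, Int.card_Icc] at this
  omega

theorem card_le_of_slTrace_le {M : ℕ} (hmem : ∀ i, h i ∈ Gamma 2)
    (hne : ∀ i j, i ≠ j → h i ≠ h j ∧ h i ≠ -h j)
    (h1 : ∀ i, ∃ γ, CrossBound γ (h i) K)
    (t1 : ∀ i, |slTrace (h i)| ≤ M) (t2 : ∀ i j, i ≠ j → |slTrace (h i * h j)| ≤ M)
    (t3 : ∀ i j l, i ≠ j → i ≠ l → j ≠ l → |slTrace (h i * h j * h l)| ≤ M) :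
    m ≤ (2 * M + 1) ^ 4 + 4 * K + 8 := by
  have hh : Function.Injective h := fun i j e => by
    by_contra hij
    exact (hne i j hij).1 e
  by_cases hD : ∃ i j, slFricke (h i) (h j) ≠ 0
  · obtain ⟨i, j, hD⟩ := hD
    by_cases hij : i = j
    · refine absurd ?_ hD
      rw [hij, slFricke_eq]
      ring
    have := Finset.card_le_of_injOn_prod_prod (s := (Finset.univ.erase i).erase j)
      (f := fun l => ((slTrace (h l), slTrace (h i * h l)), slTrace (h j * h l),
        slTrace (h i * h j * h l))) (M := M) (fun l hl => by
          simp only [Finset.mem_erase] at hl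
          exact ⟨⟨t1 l, t2 i l (Ne.symm hl.2.1)⟩, t2 j l (Ne.symm hl.1),
            t3 i j l hij (Ne.symm hl.2.1) (Ne.symm hl.1)⟩) (fun l _ l' _ e => by
          simp only [Prod.mk.injEq] at e
          exact hh (sl_eq_of_slTrace_eq hD e.1.1 e.1.2 e.2.1 e.2.2))
    rw [Finset.card_erase_of_mem (by simp [Ne.symm hij]), Finset.card_erase_of_mem (by simp),
      Finset.card_univ, Fintype.card_fin] at this
    omega
  push Not at hD
  by_cases ht : ∃ i, 3 ≤ |slTrace (h i)|
  · obtain ⟨i, ht⟩ := ht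
    have := Finset.card_le_of_injOn_prod (s := Finset.univ.erase i)
      (f := fun l => (slTrace (h l), slTrace (h i * h l))) (M := M) (fun l hl => by
          simp only [Finset.mem_erase] at hl
          exact ⟨t1 l, t2 i l (Ne.symm hl.1)⟩) (fun l _ l' _ e => by
          simp only [Prod.mk.injEq] at e
          exact hh (sl_eq_of_commute ht (hD i l) (hD i l') e.1 e.2))
    rw [Finset.card_erase_of_mem (by simp), Finset.card_univ, Fintype.card_fin] at this
    have : (2 * M + 1) ^ 2 ≤ (2 * M + 1) ^ 4 := Nat.pow_le_pow_right (by omega) (by omega)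
    omega
  push Not at ht
  have := card_le_of_parabolic hne h1
    (fun i => slTrace_eq_of_mem_gammaTwo (hmem i) (by have := ht i; omega)) hD
  omega

theorem card_le_exp_of_crossBound (hK : 1 ≤ K) (hmem : ∀ i, h i ∈ Gamma 2)
    (hne : ∀ i j, i ≠ j → h i ≠ h j ∧ h i ≠ -h j)
    (h1 : ∀ i, ∃ γ, CrossBound γ (h i) K)
    (h2 : ∀ i j, i ≠ j → ∃ γ, CrossBound γ (h i * h j) K)
    (h3 : ∀ i j l, i ≠ j → i ≠ l → j ≠ l → ∃ γ, CrossBound γ (h i * h j * h l) K) :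
    (m : ℝ) ≤ Real.exp ((4 * traceConst + 7) * √K) := by
  set r := √(K : ℝ) with hr
  have hr1 : 1 ≤ r := Real.one_le_sqrt.2 (by exact_mod_cast hK)
  have hrK : r ^ 2 = K := Real.sq_sqrt (Nat.cast_nonneg K)
  set E := Real.exp (traceConst * r) with hE
  have hcr : 2 * r ≤ traceConst * r := by
    have : 2 ≤ traceConst := by rw [traceConst]; linarith [show (0:ℝ) ≤ 12 * Fintype.card SL(2, ZMod 2) by positivity]
    gcongr
  have hEr : r ^ 2 ≤ E := by
    have h0 : r ≤ Real.exp r := by linarith [Real.add_one_le_exp r]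
    calc r ^ 2 ≤ Real.exp r ^ 2 := by gcongr
      _ = Real.exp (2 * r) := by rw [← Real.exp_nat_mul]; norm_num
      _ ≤ E := Real.exp_le_exp.2 hcr
  have hE1 : 1 ≤ E := by nlinarith
  have htr : ∀ {A : SL(2, ℤ)}, (∃ γ, CrossBound γ A K) → |slTrace A| ≤ (⌊2 * E⌋₊ : ℤ) := by
    rintro A ⟨γ, hγ⟩
    have := hγ.abs_trace_le hK
    rw [Int.natCast_floor_eq_floor (by positivity), Int.le_floor, Int.cast_abs]
    exact this
  have key := card_le_of_slTrace_le hmem hne h1 (fun i => htr (h1 i)) (fun i j hij => htr (h2 i j hij))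
    (fun i j l a b c => htr (h3 i j l a b c))
  have hM : (⌊2 * E⌋₊ : ℝ) ≤ 2 * E := Nat.floor_le (by positivity)
  generalize ⌊2 * E⌋₊ = M at *
  have key' : (m : ℝ) ≤ (2 * M + 1) ^ 4 + 4 * K + 8 := by exact_mod_cast key
  have hexp : 637 ≤ Real.exp (7 * r) := by
    have e1 : (2.7182818283 : ℝ) ^ 7 ≤ Real.exp 1 ^ 7 := by gcongr; exact Real.exp_one_gt_d9.le
    rw [← Real.exp_nat_mul] at e1
    have e2 : Real.exp 7 ≤ Real.exp (7 * r) := Real.exp_le_exp.2 (by linarith)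
    norm_num at e1
    linarith
  calc (m : ℝ) ≤ (2 * M + 1) ^ 4 + 4 * K + 8 := key'
    _ ≤ (5 * E) ^ 4 + 4 * E + 8 := by
      rw [← hrK]
      have : 2 * (M : ℝ) + 1 ≤ 5 * E := by linarith
      gcongr
    _ ≤ 637 * E ^ 4 := by
      have : E ≤ E ^ 4 := le_self_pow₀ hE1 (by norm_num)
      nlinarith
    _ ≤ Real.exp (7 * r) * E ^ 4 := by gcongr
    _ = Real.exp ((4 * traceConst + 7) * r) := by
      rw [hE, ← Real.exp_nat_mul, ← Real.exp_add]
      congr 1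
      push_cast
      ring

end Family

end

/-- The ordered pairs of distinct parameters of the half-open unit interval with the same value. -/
def selfPairs (f : ℝ → ℝ × ℝ) : Set (ℝ × ℝ) :=
  {p | p.1 ∈ Set.Ico (0:ℝ) 1 ∧ p.2 ∈ Set.Ico (0:ℝ) 1 ∧ p.1 ≠ p.2 ∧ f p.1 = f p.2}

/-- The pairs of parameters of the half-open unit interval at which the values agree. -/
def crossPairs (f g : ℝ → ℝ × ℝ) : Set (ℝ × ℝ) :=
  {p | p.1 ∈ Set.Ico (0:ℝ) 1 ∧ p.2 ∈ Set.Ico (0:ℝ) 1 ∧ f p.1 = g p.2}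

/-- Concatenation of paths. -/
noncomputable def catPath (f g : ℝ → ℝ × ℝ) (t : ℝ) : ℝ × ℝ :=
  if t < 1 / 2 then f (2 * t) else g (2 * t - 1)

theorem FewerSelfInterThan.encard_le {k : ℕ} {f : ℝ → ℝ × ℝ} (h : FewerSelfInterThan k f) :
    (SelfIntersections f).encard + 1 ≤ k := by
  rw [← h.1.cast_ncard_eq]
  exact_mod_cast h.2

theorem FewerInterThan.encard_le {k : ℕ} {f g : ℝ → ℝ × ℝ} (h : FewerInterThan k f g) :
    (Intersections f g).encard + 1 ≤ k := by
  rw [← h.1.cast_ncard_eq]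
  exact_mod_cast h.2

theorem FewerSelfInterThan.encard_fiber_le {k : ℕ} {f : ℝ → ℝ × ℝ} (h : FewerSelfInterThan k f)
    (x : ℝ × ℝ) : {t ∈ Set.Ioo (0:ℝ) 1 | f t = x}.encard ≤ k := by
  rcases Set.eq_empty_or_nonempty {t ∈ Set.Ioo (0:ℝ) 1 | f t = x} with he | ⟨b, hb⟩
  · rw [he]; simp
  rw [← Set.encard_sdiff_singleton_add_one hb]
  refine le_trans (add_le_add_left (Set.encard_le_encard_of_injOn
    (f := fun t => (min t b, max t b)) ?_ ?_) 1) h.encard_le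
  · rintro t ⟨⟨ht, hfx⟩, hne⟩
    change (min t b, max t b) ∈ _
    rcases lt_or_gt_of_ne (show t ≠ b from hne) with hlt | hlt
    · rw [min_eq_left hlt.le, max_eq_right hlt.le]
      exact ⟨ht, hb.1, hlt, hfx.trans hb.2.symm⟩
    · rw [min_eq_right hlt.le, max_eq_left hlt.le]
      exact ⟨hb.1, ht, hlt, hb.2.trans hfx.symm⟩
  · rintro t - u - e
    simp only [Prod.mk.injEq] at e
    have h1 := min_add_max t b
    have h2 := min_add_max u b
    rw [e.1, e.2] at h1
    linarith

theorem FewerSelfInterThan.encard_selfPairs_le {k : ℕ} {f : ℝ → ℝ × ℝ}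
    (h : FewerSelfInterThan k f) : (selfPairs f).encard ≤ (4 * k : ℕ) := by
  have hsub : selfPairs f ⊆ (SelfIntersections f ∪ Prod.swap '' SelfIntersections f) ∪
      ((fun t => (t, (0:ℝ))) '' {t ∈ Set.Ioo (0:ℝ) 1 | f t = f 0} ∪
       (fun t => ((0:ℝ), t)) '' {t ∈ Set.Ioo (0:ℝ) 1 | f t = f 0}) := by
    rintro ⟨t, u⟩ ⟨ht, hu, hne, e⟩
    simp only at ht hu hne e
    rcases ht.1.eq_or_lt with rfl | ht0
    · have hu0 : 0 < u := lt_of_le_of_ne hu.1 hne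
      exact Or.inr (Or.inr ⟨u, ⟨⟨hu0, hu.2⟩, e.symm⟩, rfl⟩)
    rcases hu.1.eq_or_lt with rfl | hu0
    · exact Or.inr (Or.inl ⟨t, ⟨⟨ht0, ht.2⟩, e⟩, rfl⟩)
    rcases lt_or_gt_of_ne hne with hlt | hlt
    · exact Or.inl (Or.inl ⟨⟨ht0, ht.2⟩, ⟨hu0, hu.2⟩, hlt, e⟩)
    · exact Or.inl (Or.inr ⟨(u, t), ⟨⟨hu0, hu.2⟩, ⟨ht0, ht.2⟩, hlt, e.symm⟩, rfl⟩)
  have hS : (SelfIntersections f).encard ≤ k := le_trans le_self_add h.encard_le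
  have hB := h.encard_fiber_le (f 0)
  calc (selfPairs f).encard ≤ _ := Set.encard_le_encard hsub
    _ ≤ (k + k) + (k + k) := by
      refine (Set.encard_union_le _ _).trans (add_le_add ?_ ?_)
      · exact (Set.encard_union_le _ _).trans
          (add_le_add hS ((Set.encard_image_le _ _).trans hS))
      · exact (Set.encard_union_le _ _).trans
          (add_le_add ((Set.encard_image_le _ _).trans hB) ((Set.encard_image_le _ _).trans hB))
    _ = (4 * k : ℕ) := by push_cast; ring

theorem FewerInterThan.encard_crossPairs_le {k : ℕ} {f g : ℝ → ℝ × ℝ} (h : FewerInterThan k f g)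
    (hf : FewerSelfInterThan k f) (hg : FewerSelfInterThan k g) :
    (crossPairs f g).encard ≤ (4 * k : ℕ) := by
  have hsub : crossPairs f g ⊆ (Intersections f g ∪ {((0:ℝ), (0:ℝ))}) ∪
      ((fun t => (t, (0:ℝ))) '' {t ∈ Set.Ioo (0:ℝ) 1 | f t = g 0} ∪
       (fun t => ((0:ℝ), t)) '' {t ∈ Set.Ioo (0:ℝ) 1 | g t = f 0}) := by
    rintro ⟨t, u⟩ ⟨ht, hu, e⟩
    simp only at ht hu e
    rcases ht.1.eq_or_lt with rfl | ht0
    · rcases hu.1.eq_or_lt with rfl | hu0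
      · exact Or.inl (Or.inr rfl)
      · exact Or.inr (Or.inr ⟨u, ⟨⟨hu0, hu.2⟩, e.symm⟩, rfl⟩)
    rcases hu.1.eq_or_lt with rfl | hu0
    · exact Or.inr (Or.inl ⟨t, ⟨⟨ht0, ht.2⟩, e⟩, rfl⟩)
    exact Or.inl (Or.inl ⟨⟨ht0, ht.2⟩, ⟨hu0, hu.2⟩, e⟩)
  calc (crossPairs f g).encard ≤ _ := Set.encard_le_encard hsub
    _ ≤ k + (k + k) := by
      refine (Set.encard_union_le _ _).trans (add_le_add ?_ ?_)
      · refine (Set.encard_union_le _ _).trans ?_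
        rw [Set.encard_singleton]
        exact h.encard_le
      · exact (Set.encard_union_le _ _).trans (add_le_add
          ((Set.encard_image_le _ _).trans (hf.encard_fiber_le _))
          ((Set.encard_image_le _ _).trans (hg.encard_fiber_le _)))
    _ = (3 * k : ℕ) := by push_cast; ring
    _ ≤ (4 * k : ℕ) := by gcongr; norm_num

theorem catPath_cases (f g : ℝ → ℝ × ℝ) {t : ℝ} (ht : t ∈ Set.Ico (0:ℝ) 1) :
    (∃ s ∈ Set.Ico (0:ℝ) 1, t = s / 2 ∧ catPath f g t = f s) ∨
    (∃ s ∈ Set.Ico (0:ℝ) 1, t = (s + 1) / 2 ∧ catPath f g t = g s) := by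
  obtain ⟨h1, h2⟩ := ht
  rcases lt_or_ge t (1 / 2) with h | h
  · exact Or.inl ⟨2 * t, ⟨by linarith, by linarith⟩, by ring, if_pos h⟩
  · exact Or.inr ⟨2 * t - 1, ⟨by linarith, by linarith⟩, by ring, if_neg h.not_gt⟩

theorem encard_crossPairs_swap (f g : ℝ → ℝ × ℝ) :
    (crossPairs f g).encard ≤ (crossPairs g f).encard := by
  refine (Set.encard_le_encard (t := Prod.swap '' crossPairs g f) ?_).trans
    (Set.encard_image_le _ _)
  rintro ⟨t, u⟩ ⟨ht, hu, e⟩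
  exact ⟨(u, t), ⟨hu, ht, e.symm⟩, rfl⟩

theorem encard_crossPairs_catPath_le {f g k : ℝ → ℝ × ℝ} {a b : ℕ}
    (hf : (crossPairs f k).encard ≤ a) (hg : (crossPairs g k).encard ≤ b) :
    (crossPairs (catPath f g) k).encard ≤ (a + b : ℕ) := by
  have hsub : crossPairs (catPath f g) k ⊆ (fun p : ℝ × ℝ => (p.1 / 2, p.2)) '' crossPairs f k ∪
      (fun p : ℝ × ℝ => ((p.1 + 1) / 2, p.2)) '' crossPairs g k := by
    rintro ⟨t, u⟩ ⟨ht, hu, e⟩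
    rcases catPath_cases f g ht with ⟨s, hs, e1, e2⟩ | ⟨s, hs, e1, e2⟩
    · exact Or.inl ⟨(s, u), ⟨hs, hu, e2.symm.trans e⟩, Prod.ext e1.symm rfl⟩
    · exact Or.inr ⟨(s, u), ⟨hs, hu, e2.symm.trans e⟩, Prod.ext e1.symm rfl⟩
  refine (Set.encard_le_encard hsub).trans ((Set.encard_union_le _ _).trans ?_)
  rw [Nat.cast_add]
  exact add_le_add ((Set.encard_image_le _ _).trans hf) ((Set.encard_image_le _ _).trans hg)

theorem encard_selfPairs_catPath_le {f g : ℝ → ℝ × ℝ} {a b c : ℕ}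
    (hf : (selfPairs f).encard ≤ a) (hg : (selfPairs g).encard ≤ b)
    (hfg : (crossPairs f g).encard ≤ c) :
    (selfPairs (catPath f g)).encard ≤ (a + b + (c + c) : ℕ) := by
  have hsub : selfPairs (catPath f g) ⊆ ((fun p : ℝ × ℝ => (p.1 / 2, p.2 / 2)) '' selfPairs f ∪
      (fun p : ℝ × ℝ => ((p.1 + 1) / 2, (p.2 + 1) / 2)) '' selfPairs g) ∪
      ((fun p : ℝ × ℝ => (p.1 / 2, (p.2 + 1) / 2)) '' crossPairs f g ∪
      (fun p : ℝ × ℝ => ((p.1 + 1) / 2, p.2 / 2)) '' crossPairs g f) := by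
    rintro ⟨t, u⟩ ⟨ht, hu, hne, e⟩
    simp only at ht hu hne e
    rcases catPath_cases f g ht with ⟨s, hs, e1, e2⟩ | ⟨s, hs, e1, e2⟩ <;>
      rcases catPath_cases f g hu with ⟨r, hr, e3, e4⟩ | ⟨r, hr, e3, e4⟩
    · refine Or.inl (Or.inl ⟨(s, r), ⟨hs, hr, fun h => hne ?_, e2.symm.trans (e.trans e4)⟩,
        Prod.ext e1.symm e3.symm⟩)
      change s = r at h
      rw [e1, e3, h]
    · exact Or.inr (Or.inl ⟨(s, r), ⟨hs, hr, e2.symm.trans (e.trans e4)⟩,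
        Prod.ext e1.symm e3.symm⟩)
    · exact Or.inr (Or.inr ⟨(s, r), ⟨hs, hr, e2.symm.trans (e.trans e4)⟩,
        Prod.ext e1.symm e3.symm⟩)
    · refine Or.inl (Or.inr ⟨(s, r), ⟨hs, hr, fun h => hne ?_, e2.symm.trans (e.trans e4)⟩,
        Prod.ext e1.symm e3.symm⟩)
      change s = r at h
      rw [e1, e3, h]
  refine (Set.encard_le_encard hsub).trans ((Set.encard_union_le _ _).trans ?_)
  push_cast
  refine add_le_add ((Set.encard_union_le _ _).trans ?_) ((Set.encard_union_le _ _).trans ?_)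
  · exact add_le_add ((Set.encard_image_le _ _).trans hf) ((Set.encard_image_le _ _).trans hg)
  · exact add_le_add ((Set.encard_image_le _ _).trans hfg)
      ((Set.encard_image_le _ _).trans ((encard_crossPairs_swap g f).trans hfg))

section

open UpperHalfPlane CongruenceSubgroup MatrixGroups

/-- Linear interpolation in the upper half plane, constant outside of the unit interval. -/
noncomputable def halfPlaneLerp (s : ℝ) (z w : ℍ) : ℍ :=
  ⟨((1 - max 0 (min s 1) : ℝ) : ℂ) * z + ((max 0 (min s 1) : ℝ) : ℂ) * w, by
    have h1 := z.im_pos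
    have h2 := w.im_pos
    have h3 : 0 ≤ max 0 (min s 1) := le_max_left _ _
    have h4 : max 0 (min s 1) ≤ 1 := max_le zero_le_one (min_le_right _ _)
    generalize max 0 (min s 1) = r at *
    simp only [Complex.add_im, Complex.im_ofReal_mul, UpperHalfPlane.coe_im]
    rcases h3.eq_or_lt with rfl | h3
    · simpa using h1
    · nlinarith [mul_nonneg (sub_nonneg.2 h4) h1.le, mul_pos h3 h2]⟩

theorem halfPlaneLerp_zero (z w : ℍ) : halfPlaneLerp 0 z w = z := by
  apply UpperHalfPlane.ext
  simp [halfPlaneLerp]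

theorem halfPlaneLerp_one (z w : ℍ) : halfPlaneLerp 1 z w = w := by
  apply UpperHalfPlane.ext
  simp [halfPlaneLerp]

theorem halfPlaneLerp_self (s : ℝ) (z : ℍ) : halfPlaneLerp s z z = z := by
  apply UpperHalfPlane.ext
  simp only [halfPlaneLerp]
  push_cast
  ring

theorem continuous_halfPlaneLerp {F G : ℝ → ℍ} (hF : Continuous F) (hG : Continuous G) :
    Continuous fun q : ℝ × ℝ => halfPlaneLerp q.1 (F q.2) (G q.2) := by
  rw [UpperHalfPlane.isEmbedding_coe.continuous_iff]
  have h1 := UpperHalfPlane.continuous_coe.comp hF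
  have h2 := UpperHalfPlane.continuous_coe.comp hG
  change Continuous fun q : ℝ × ℝ => ((1 - max 0 (min q.1 1) : ℝ) : ℂ) * (F q.2 : ℂ) +
    ((max 0 (min q.1 1) : ℝ) : ℂ) * (G q.2 : ℂ)
  have h3 : Continuous fun q : ℝ × ℝ => (F q.2 : ℂ) := h1.comp continuous_snd
  have h4 : Continuous fun q : ℝ × ℝ => (G q.2 : ℂ) := h2.comp continuous_snd
  fun_prop

/-- `F` lifts the loop `f` along `p`, starting from `z` and ending at its translate by `h`. -/
structure LoopLift (p : ℍ → ℝ × ℝ) (z : ℍ) (f : ℝ → ℝ × ℝ) (h : SL(2, ℤ)) (F : ℝ → ℍ) : Prop where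
  continuous : Continuous F
  mem : h ∈ Gamma 2
  map_zero : F 0 = z
  map_one : F 1 = h • z
  lift : ∀ t ∈ Set.Icc (0:ℝ) 1, p (F t) = f t

namespace LoopLift

variable {p : ℍ → ℝ × ℝ} {z : ℍ} {f g : ℝ → ℝ × ℝ} {h h' : SL(2, ℤ)} {F G : ℝ → ℍ}

theorem catPath (hp : ∀ z w, p z = p w ↔ ∃ g ∈ Gamma 2, g • z = w) (hF : LoopLift p z f h F)
    (hG : LoopLift p z g h' G) : ∃ F', LoopLift p z (catPath f g) (h * h') F' := by
  refine ⟨fun t => if t ≤ 1 / 2 then F (2 * t) else h • G (2 * t - 1), ?_, mul_mem hF.mem hG.mem,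
    ?_, ?_, ?_⟩
  · refine Continuous.if_le (hF.continuous.comp (by fun_prop))
      ((continuous_sl_smul h).comp (hG.continuous.comp (by fun_prop))) continuous_id
      continuous_const ?_
    rintro t rfl
    rw [show 2 * (1 / 2 : ℝ) = 1 by norm_num, sub_self]
    rw [hF.map_one, hG.map_zero]
  · norm_num
    exact hF.map_zero
  · have e1 : (2 : ℝ) * 1 - 1 = 1 := by norm_num
    rw [if_neg (by norm_num), e1, hG.map_one, mul_smul]
  · intro t ht
    have hpg : ∀ w, p (h • w) = p w := fun w => ((hp w (h • w)).2 ⟨h, hF.mem, rfl⟩).symm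
    simp only [_root_.catPath]
    rcases lt_trichotomy t (1 / 2) with hlt | rfl | hlt
    · rw [if_pos hlt.le, if_pos hlt]
      exact hF.lift _ ⟨by linarith [ht.1], by linarith⟩
    · rw [if_pos le_rfl, if_neg (lt_irrefl _)]
      norm_num
      rw [hF.map_one, hpg, ← hG.map_zero]
      exact hG.lift 0 ⟨le_rfl, zero_le_one⟩
    · rw [if_neg hlt.not_ge, if_neg hlt.not_gt, hpg]
      exact hG.lift _ ⟨by linarith, by linarith [ht.2]⟩

theorem continuous_extend (hF : LoopLift p z f h F) :
    Continuous fun t : ℝ => h ^ ⌊t⌋ • F (Int.fract t) := by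
  have hlf : LocallyFinite fun n : ℤ => Set.Icc (n : ℝ) (n + 1) :=
    locallyFinite_Icc_of_tendsto tendsto_intCast_atTop_atTop
      (Filter.tendsto_atBot_add_const_right _ _ (tendsto_intCast_atBot_iff.2 Filter.tendsto_id))
  refine hlf.continuous ?_ (fun _ => isClosed_Icc) ?_
  · refine Set.eq_univ_of_forall fun t => Set.mem_iUnion.2 ⟨⌊t⌋, Int.floor_le t, ?_⟩
    exact (Int.lt_floor_add_one t).le
  · intro n
    have hc : Continuous fun t : ℝ => h ^ n • F (t - n) :=
      (continuous_sl_smul (h ^ n)).comp (hF.continuous.comp (by fun_prop))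
    refine hc.continuousOn.congr ?_
    intro t ht
    rcases ht.2.eq_or_lt with rfl | hlt
    · change h ^ ⌊(n : ℝ) + 1⌋ • F (Int.fract ((n : ℝ) + 1)) = h ^ n • F ((n : ℝ) + 1 - n)
      have e1 : ⌊(n : ℝ) + 1⌋ = n + 1 := by simp
      have e2 : Int.fract ((n : ℝ) + 1) = 0 := by simp
      have e3 : (n : ℝ) + 1 - n = 1 := by ring
      rw [e1, e2, e3, hF.map_zero, hF.map_one, zpow_add_one, mul_smul]
    · have e1 : ⌊t⌋ = n := Int.floor_eq_iff.2 ⟨ht.1, hlt⟩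
      change h ^ ⌊t⌋ • F (Int.fract t) = h ^ n • F (t - n)
      rw [Int.fract, e1]

theorem crossBound (hp : ∀ z w, p z = p w ↔ ∃ g ∈ Gamma 2, g • z = w) (hF : LoopLift p z f h F)
    {K : ℕ} (hK : (selfPairs f).encard ≤ K) : ∃ γ, CrossBound γ h K := by
  refine ⟨fun t => h ^ ⌊t⌋ • F (Int.fract t), hF.continuous_extend, hF.mem, ?_, ?_⟩
  · intro t
    rw [Int.floor_add_one, Int.fract_add_one, add_comm, zpow_one_add, mul_smul]
  intro S c hc hex hne hdist
  have hz : ∀ n : ℤ, h ^ n ∈ Gamma 2 := fun n => zpow_mem hF.mem n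
  have hex' : ∀ i ∈ S, ∃ q ∈ selfPairs f, ∃ a b : ℤ, h ^ a • F q.1 = c i • h ^ b • F q.2 := by
    intro i hi
    obtain ⟨t, u, e⟩ := hex i hi
    change h ^ ⌊t⌋ • F (Int.fract t) = c i • h ^ ⌊u⌋ • F (Int.fract u) at e
    refine ⟨(Int.fract t, Int.fract u), ⟨⟨Int.fract_nonneg t, Int.fract_lt_one t⟩,
      ⟨Int.fract_nonneg u, Int.fract_lt_one u⟩, ?_, ?_⟩, _, _, e⟩
    · intro heq
      change Int.fract t = Int.fract u at heq
      rw [heq, ← mul_smul, ← inv_smul_eq_iff, ← mul_smul] at e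
      have hm := mul_mem (inv_mem (mul_mem (hc i hi) (hz ⌊u⌋))) (hz ⌊t⌋)
      have hci : c i = h ^ ⌊t⌋ * ((c i * h ^ ⌊u⌋)⁻¹ * h ^ ⌊t⌋)⁻¹ * (h ^ ⌊u⌋)⁻¹ := by group
      rcases gammaTwo_eq_of_smul_eq hm e with e1 | e1
      · refine (hne i hi (⌊t⌋ - ⌊u⌋)).1 ?_
        rw [hci, e1, inv_one, mul_one, zpow_sub]
      · refine (hne i hi (⌊t⌋ - ⌊u⌋)).2 ?_
        rw [hci, e1, inv_eq_of_mul_eq_one_right (neg_mul_neg (1 : SL(2, ℤ)) 1 |>.trans (mul_one 1)), mul_neg_one, neg_mul, zpow_sub]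
    · change f (Int.fract t) = f (Int.fract u)
      rw [← hF.lift _ ⟨Int.fract_nonneg t, (Int.fract_lt_one t).le⟩,
        ← hF.lift _ ⟨Int.fract_nonneg u, (Int.fract_lt_one u).le⟩, hp]
      refine ⟨(c i * h ^ ⌊u⌋)⁻¹ * h ^ ⌊t⌋, mul_mem (inv_mem (mul_mem (hc i hi) (hz _))) (hz _), ?_⟩
      rw [mul_smul, e, ← mul_smul (c i), inv_smul_smul]
  choose! q hq a b hab using hex'
  have hinj : Set.InjOn q S := by
    intro i hi j hj hij
    have e1 := hab i hi
    have e2 := hab j hj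
    rw [← hij] at e2
    generalize F (q i).1 = P at e1 e2
    generalize F (q i).2 = Q at e1 e2
    rw [← mul_smul, smul_eq_iff_eq_inv_smul, ← mul_smul] at e1 e2
    rw [e1, eq_comm, ← inv_smul_eq_iff, ← mul_smul] at e2
    have hm := mul_mem (inv_mem (mul_mem (inv_mem (hz (a i))) (mul_mem (hc i hi) (hz (b i)))))
      (mul_mem (inv_mem (hz (a j))) (mul_mem (hc j hj) (hz (b j))))
    refine hdist i hi j hj (a i - a j) (b j - b i) ?_
    have hcj : h ^ (a i - a j) * c j * h ^ (b j - b i) = h ^ a i *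
      ((h ^ a i)⁻¹ * (c i * h ^ b i)) * (((h ^ a i)⁻¹ * (c i * h ^ b i))⁻¹ *
      ((h ^ a j)⁻¹ * (c j * h ^ b j))) * (h ^ b i)⁻¹ := by group
    rw [hcj]
    rcases gammaTwo_eq_of_smul_eq hm e2 with e | e
    · left
      rw [e]; group
    · right
      rw [e, mul_neg_one, neg_mul, neg_neg]; group
  have := Set.encard_le_encard_of_injOn (s := (S : Set (ℤ × ℤ))) (t := selfPairs f) (f := q)
    (fun i hi => hq i hi) hinj
  rw [Set.encard_coe_eq_coe_finsetCard] at this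
  exact_mod_cast this.trans hK

theorem loopHomotopic {V : Set (ℝ × ℝ)} {x : ℝ × ℝ} (hpc : Continuous p) (hV : ∀ w, p w ∉ V)
    (hF : LoopLift p z f h F) (hG : LoopLift p z g h' G) (hf0 : f 0 = x) (hf1 : f 1 = x)
    (heq : h • z = h' • z) : LoopHomotopic V x f g := by
  have h01 : (0 : ℝ) ∈ Set.Icc (0:ℝ) 1 := ⟨le_rfl, zero_le_one⟩
  have h11 : (1 : ℝ) ∈ Set.Icc (0:ℝ) 1 := ⟨zero_le_one, le_rfl⟩
  refine ⟨fun s t => p (halfPlaneLerp s (F t) (G t)),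
    (hpc.comp (continuous_halfPlaneLerp hF.continuous hG.continuous)).continuousOn, ?_, ?_,
    fun s _ t _ => hV _⟩
  · intro t ht
    simp only [halfPlaneLerp_zero, halfPlaneLerp_one]
    exact ⟨hF.lift t ht, hG.lift t ht⟩
  · intro s _
    constructor
    · change p (halfPlaneLerp s (F 0) (G 0)) = x
      rw [hG.map_zero, ← hF.map_zero, halfPlaneLerp_self, hF.lift 0 h01, hf0]
    · change p (halfPlaneLerp s (F 1) (G 1)) = x
      rw [hG.map_one, ← heq, ← hF.map_one, halfPlaneLerp_self, hF.lift 1 h11, hf1]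

end LoopLift

end

/-- There is a constant `C > 0` such that for every `k ≥ 1`, every set `V ⊆ ℝ²` of
exactly 2 points, every `x ∉ V`, and every finite family of pairwise non-homotopic
`x`-loops, each with fewer than `k` self-intersections and pairwise fewer than `k`
intersections, has at most `exp (C √k)` members. -/
theorem nonhomotopic_xloops_two_obstacles_bound :
    ∃ C : ℝ, 0 < C ∧ ∀ k : ℕ, 1 ≤ k →
      ∀ V : Set (ℝ × ℝ), V.ncard = 2 → ∀ x : ℝ × ℝ, x ∉ V →
        ∀ m : ℕ, ∀ L : Fin m → (ℝ → ℝ × ℝ),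
          (∀ i, IsLoop V x (L i)) →
          (∀ i, FewerSelfInterThan k (L i)) →
          (∀ i j, i ≠ j → FewerInterThan k (L i) (L j)) →
          (∀ i j, i ≠ j → ¬ LoopHomotopic V x (L i) (L j)) →
          (m : ℝ) ≤ Real.exp (C * Real.sqrt k) := by
  refine ⟨(4 * traceConst + 7) * 6, by have := traceConst_pos; positivity, ?_⟩
  intro k hk V hV x hx m L hL hself hcross hhom
  obtain ⟨a, b, hab, rfl⟩ := Set.ncard_eq_two.1 hV
  obtain ⟨p, hpc, hpV, hp, hsurj, hlift⟩ := exists_cover hab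
  have hxa : x ≠ a := fun h => hx (by simp [h])
  have hxb : x ≠ b := fun h => hx (by simp [h])
  obtain ⟨z, hz⟩ := hsurj x hxa hxb
  have hex : ∀ i, ∃ h F, LoopLift p z (L i) h F := by
    intro i
    obtain ⟨hc, h0, h1, hav⟩ := hL i
    obtain ⟨F, hF, hF0, hFl⟩ := hlift (L i) hc (fun t ht => by
      rcases ht.1.eq_or_lt with rfl | ht0
      · rw [h0]; exact ⟨hxa, hxb⟩
      rcases ht.2.eq_or_lt with rfl | ht1
      · rw [h1]; exact ⟨hxa, hxb⟩
      have := hav t ⟨ht0, ht1⟩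
      simpa using this) z (by rw [hz, h0])
    obtain ⟨g, hg, hg'⟩ := (hp z (F 1)).1 (by rw [hFl 1 ⟨zero_le_one, le_rfl⟩, hz, h1])
    exact ⟨g, F, hF, hg, hF0, hg'.symm, hFl⟩
  choose h F hF using hex
  have hne : ∀ i j, i ≠ j → h i • z ≠ h j • z := fun i j hij e =>
    hhom i j hij ((hF i).loopHomotopic hpc (fun w hw => by
      rcases hw with hw | hw
      · exact (hpV w).1 hw
      · exact (hpV w).2 hw) (hF j) (hL i).2.1 (hL i).2.2.1 e)
  have hS : ∀ i, (selfPairs (L i)).encard ≤ (4 * k : ℕ) := fun i => (hself i).encard_selfPairs_le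
  have hX : ∀ i j, i ≠ j → (crossPairs (L i) (L j)).encard ≤ (4 * k : ℕ) := fun i j hij =>
    (hcross i j hij).encard_crossPairs_le (hself i) (hself j)
  have key := card_le_exp_of_crossBound (m := m) (K := 36 * k) (h := h) (by omega)
    (fun i => (hF i).mem)
    (fun i j hij => ⟨fun e => hne i j hij (by rw [e]), fun e => hne i j hij (by
      rw [e, ModularGroup.SL_neg_smul])⟩)
    (fun i => (hF i).crossBound hp ((hS i).trans (by gcongr; norm_num)))
    (fun i j hij => by
      obtain ⟨G, hG⟩ := (hF i).catPath hp (hF j)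
      refine hG.crossBound hp ((encard_selfPairs_catPath_le (hS i) (hS j) (hX i j hij)).trans ?_)
      exact_mod_cast (by omega))
    (fun i j l hij hil hjl => by
      obtain ⟨G, hG⟩ := (hF i).catPath hp (hF j)
      obtain ⟨G', hG'⟩ := hG.catPath hp (hF l)
      refine hG'.crossBound hp ((encard_selfPairs_catPath_le
        (encard_selfPairs_catPath_le (hS i) (hS j) (hX i j hij)) (hS l)
        (encard_crossPairs_catPath_le (hX i l hil) (hX j l hjl))).trans ?_)
      exact_mod_cast (by omega))
  refine key.trans_eq ?_
  have e : √((36 * k : ℕ) : ℝ) = 6 * √k := by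
    push_cast
    rw [Real.sqrt_mul (by norm_num), show (36 : ℝ) = 6 ^ 2 by norm_num,
      Real.sqrt_sq (by norm_num)]
  rw [e]
  congr 1
  ring
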